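/- Let R be a Gorenstein local ring of dimension d and let a and b be perfect Gorenstein ideals of R. Assume M ∈ CM^n(R) and M ∼_a N. Then: (i) β̂_i^R(M) = μ̂^{m+i−1}_R(N) for all i ∈ ℤ, where m = depth_R(M); in particular β_i^R(M) = μ^{m+i−1}_R(N) for all i > n+1. (ii) If moreover M is evenly linked to L, i.e. M ∼_a N ∼_b L, then β̂_i^R(M) = β̂_i^R(L) and μ̂^i_R(M) = μ̂^i_R(L) for all i ∈ ℤ; in particular β_i^R(M) = β_i^R(L) for all i > n and μ^i_R(M) = μ^i_R(L) for all i > d. -/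

import Mathlib

open CategoryTheory CategoryTheory.Limits CategoryTheory.MonoidalCategory Opposite

noncomputable section

universe u

variable (R : Type u) [CommRing R]

/-- Ordinary `Ext` of `R`-modules, via the derived functor `Ext` of Mathlib. -/
abbrev ExtMod (n : ℕ) (M N : ModuleCat.{u} R) : ModuleCat.{u} R :=
  ((Ext R (ModuleCat.{u} R) n).obj (op M)).obj N

/-- Ordinary `Tor` of `R`-modules, via the derived functor `Tor` of Mathlib. -/
abbrev TorMod (n : ℕ) (M N : ModuleCat.{u} R) : ModuleCat.{u} R :=
  ((Tor (ModuleCat.{u} R) n).obj M).obj N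

/-- A finitely generated module `M` is totally reflexive (of G-dimension zero) if the
biduality map is an isomorphism and `Ext^i(M,R) = 0 = Ext^i(M^*,R)` for all `i > 0`. -/
def IsTotallyReflexive (M : ModuleCat.{u} R) : Prop :=
  Module.Finite R M ∧
  Function.Bijective (Module.Dual.eval R M) ∧
  (∀ i : ℕ, 0 < i → IsZero (ExtMod R i M (ModuleCat.of R R))) ∧
  (∀ i : ℕ, 0 < i → IsZero (ExtMod R i (ModuleCat.of R (Module.Dual R M)) (ModuleCat.of R R)))

/-- `M` admits a resolution `0 → G_n → ⋯ → G_0 → M → 0` by totally reflexive modules. -/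
def GDimLE (M : ModuleCat.{u} R) (n : ℕ) : Prop :=
  ∃ (G : ChainComplex (ModuleCat.{u} R) ℕ) (ε : G.X 0 ⟶ M),
    (∀ i, i ≤ n → IsTotallyReflexive R (G.X i)) ∧
    (∀ i, n < i → IsZero (G.X i)) ∧
    Epi ε ∧
    (∃ w : G.d 1 0 ≫ ε = 0, (ShortComplex.mk (G.d 1 0) ε w).Exact) ∧
    (∀ i, 0 < i → G.ExactAt i)

/-- `M` has finite Gorenstein dimension. -/
def HasFiniteGDim (M : ModuleCat.{u} R) : Prop := ∃ n, GDimLE R M n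

/-- The Gorenstein dimension of `M`, as an element of `ℕ∞`. -/
def gdim (M : ModuleCat.{u} R) : ℕ∞ :=
  sInf {c : ℕ∞ | ∃ n : ℕ, c = n ∧ GDimLE R M n}

/-- `M` admits a projective resolution of length at most `n`. -/
def PdLE (M : ModuleCat.{u} R) (n : ℕ) : Prop :=
  ∃ (G : ChainComplex (ModuleCat.{u} R) ℕ) (ε : G.X 0 ⟶ M),
    (∀ i, Projective (G.X i)) ∧
    (∀ i, n < i → IsZero (G.X i)) ∧
    Epi ε ∧
    (∃ w : G.d 1 0 ≫ ε = 0, (ShortComplex.mk (G.d 1 0) ε w).Exact) ∧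
    (∀ i, 0 < i → G.ExactAt i)

/-- `M` has finite projective dimension. -/
def HasFinitePd (M : ModuleCat.{u} R) : Prop := ∃ n, PdLE R M n

/-- The projective dimension of `M`, as an element of `ℕ∞`. -/
def pdim (M : ModuleCat.{u} R) : ℕ∞ :=
  sInf {c : ℕ∞ | ∃ n : ℕ, c = n ∧ PdLE R M n}

/-- `M` admits an injective resolution `0 → M → I^0 → ⋯ → I^n → 0`. -/
def InjDimLE (M : ModuleCat.{u} R) (n : ℕ) : Prop :=
  ∃ (I : CochainComplex (ModuleCat.{u} R) ℕ) (ι : M ⟶ I.X 0),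
    (∀ i, Injective (I.X i)) ∧
    (∀ i, n < i → IsZero (I.X i)) ∧
    Mono ι ∧
    (∃ w : ι ≫ I.d 0 1 = 0, (ShortComplex.mk ι (I.d 0 1) w).Exact) ∧
    (∀ i, 0 < i → I.ExactAt i)

/-- `M` has finite injective dimension. -/
def HasFiniteInjDim (M : ModuleCat.{u} R) : Prop := ∃ n, InjDimLE R M n

/-- A Gorenstein local ring: a commutative Noetherian local ring of finite self-injective
dimension. -/
def IsGorensteinLocalRing : Prop :=
  IsLocalRing R ∧ IsNoetherianRing R ∧ HasFiniteInjDim R (ModuleCat.of R R)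

/-- The grade of a module: `grade M = inf { i | Ext^i(M,R) ≠ 0 }`. -/
def gradeM (M : ModuleCat.{u} R) : ℕ∞ :=
  sInf {c : ℕ∞ | ∃ i : ℕ, c = i ∧ ¬ IsZero (ExtMod R i M (ModuleCat.of R R))}

/-- A module is G-perfect if its grade equals its Gorenstein dimension. -/
def IsGPerfect (M : ModuleCat.{u} R) : Prop := gradeM R M = gdim R M

/-- An ideal `c` is perfect if `grade (R/c) = pd (R/c)`. -/
def IsPerfectIdeal (c : Ideal R) : Prop :=
  gradeM R (ModuleCat.of R (R ⧸ c)) = pdim R (ModuleCat.of R (R ⧸ c))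

/-- A complete resolution `T → P → M` of `M`: `P → M` is a resolution by finite projective
modules, `T` is a totally acyclic complex of finite projective modules, and `θ i` is an
isomorphism for all `i ≫ 0`. -/
structure CompleteResolution (M : ModuleCat.{u} R) where
  T : ChainComplex (ModuleCat.{u} R) ℤ
  P : ChainComplex (ModuleCat.{u} R) ℤ
  θ : T ⟶ P
  π : P.X 0 ⟶ M
  projT : ∀ i, Projective (T.X i)
  fgT : ∀ i, Module.Finite R (T.X i)
  projP : ∀ i, Projective (P.X i)
  fgP : ∀ i, Module.Finite R (P.X i)
  zeroP : ∀ i : ℤ, i < 0 → IsZero (P.X i)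
  epiπ : Epi π
  wπ : P.d 1 0 ≫ π = 0
  exact0 : (ShortComplex.mk (P.d 1 0) π wπ).Exact
  exactP : ∀ i : ℤ, 0 < i → P.ExactAt i
  exactT : ∀ i : ℤ, T.ExactAt i
  exactTdual : ∀ i : ℤ, (T.linearYonedaObj R (ModuleCat.of R R)).ExactAt i
  iso_eventually : ∃ n₀ : ℤ, ∀ i : ℤ, n₀ ≤ i → IsIso (θ.f i)

/-- Tate cohomology `Êxt^i(M,N) = H^i(Hom(T,N))` computed from a complete resolution of `M`. -/
def TateExt {M : ModuleCat.{u} R} (C : CompleteResolution R M) (N : ModuleCat.{u} R)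
    (i : ℤ) : ModuleCat.{u} R :=
  (C.T.linearYonedaObj R N).homology i

/-- Tate homology `T̂or_i(M,N) = H_i(T ⊗ N)` computed from a complete resolution of `M`. -/
def TateTor {M : ModuleCat.{u} R} (C : CompleteResolution R M) (N : ModuleCat.{u} R)
    (i : ℤ) : ModuleCat.{u} R :=
  ((((tensoringRight (ModuleCat.{u} R)).obj N).mapHomologicalComplex _).obj C.T).homology i

/-- The depth of a module over a local ring: the supremum of the lengths of the
`M`-regular sequences contained in the maximal ideal. -/
def moduleDepth [IsLocalRing R] (M : Type u) [AddCommGroup M] [Module R M] : ℕ∞ :=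
  sSup {c : ℕ∞ | ∃ rs : List R, c = rs.length ∧
    (∀ r ∈ rs, r ∈ IsLocalRing.maximalIdeal R) ∧ RingTheory.Sequence.IsRegular M rs}

/-- `E` is an injective envelope of the residue field `k`: an injective module which is an
essential extension of `k`. -/
def IsInjectiveEnvelopeOfResidueField [IsLocalRing R] (E : Type u) [AddCommGroup E]
    [Module R E] : Prop :=
  Injective (ModuleCat.of R E) ∧
  ∃ ι : IsLocalRing.ResidueField R →ₗ[R] E,
    Function.Injective ι ∧
    ∀ N : Submodule R E, N ≠ ⊥ → N ⊓ LinearMap.range ι ≠ ⊥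


/-- A minimal free resolution `⋯ → F_1 → F_0 → M → 0` of a finitely generated module over a
local ring, recorded by its Betti numbers `b n` and differentials with image inside
`m • F_n`. -/
structure MinFreeRes [IsLocalRing R] (M : Type u) [AddCommGroup M] [Module R M] where
  b : ℕ → ℕ
  d : ∀ n : ℕ, ((Fin (b (n+1)) → R) →ₗ[R] (Fin (b n) → R))
  aug : (Fin (b 0) → R) →ₗ[R] M
  aug_surj : Function.Surjective aug
  exact_zero : LinearMap.ker aug = LinearMap.range (d 0)
  exact_succ : ∀ n, LinearMap.ker (d n) = LinearMap.range (d (n+1))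
  minimal : ∀ n, LinearMap.range (d n) ≤ (IsLocalRing.maximalIdeal R) • ⊤

/-- The Betti numbers of `M` are eventually bounded by `γ · n^(c-1)`. -/
def CxLE [IsLocalRing R] (M : Type u) [AddCommGroup M] [Module R M] (c : ℕ) : Prop :=
  ∃ (F : MinFreeRes R M) (γ : ℝ) (n₀ : ℕ),
    ∀ n : ℕ, n₀ ≤ n → (F.b n : ℝ) ≤ γ * (n : ℝ) ^ ((c : ℤ) - 1)

/-- The complexity of a module: the least `c` such that the Betti numbers are eventually
bounded by `γ · n^(c-1)` for some `γ`. -/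
def complexity [IsLocalRing R] (M : Type u) [AddCommGroup M] [Module R M] : ℕ∞ :=
  sInf {e : ℕ∞ | ∃ c : ℕ, e = c ∧ CxLE R M c}

/-- The pushout `K_η` of a map `f : Ω^{j+1} M → M` (representing a degree-`(j+1)`
homogeneous element `η` of `Ext^*(M,M)`) along the inclusion `Ω^{j+1} M ↪ F_j`: the
cokernel of `(f, -incl) : Ω^{j+1} M → M ⊕ F_j`. -/
abbrev PushoutMod [IsLocalRing R] {M : Type u} [AddCommGroup M] [Module R M]
    (F : MinFreeRes R M) (j : ℕ) (f : LinearMap.range (F.d j) →ₗ[R] M) : Type u :=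
  (M × (Fin (F.b j) → R)) ⧸
    LinearMap.range (LinearMap.prod f (-(LinearMap.range (F.d j)).subtype))

/-- Auxiliary predicate: `M` has reducible complexity, with recursion depth `≤ c`. -/
def RedCxAux [IsLocalRing R] :
    ℕ → ∀ (M : Type u) (_ : AddCommGroup M) (_ : Module R M), Prop
  | 0, M, g, m =>
      letI := g; letI := m
      HasFinitePd R (ModuleCat.of R M)
  | (c+1), M, g, m =>
      letI := g; letI := m
      HasFinitePd R (ModuleCat.of R M) ∨
      (complexity R M < ⊤ ∧ 0 < complexity R M ∧
        ∃ (j : ℕ) (F : MinFreeRes R M) (f : LinearMap.range (F.d j) →ₗ[R] M),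
          complexity R (PushoutMod R F j f) < complexity R M ∧
          moduleDepth R (PushoutMod R F j f) = moduleDepth R M ∧
          RedCxAux c (PushoutMod R F j f) inferInstance inferInstance)

/-- `M` has reducible complexity. -/
def HasReducibleComplexity [IsLocalRing R] (M : Type u) [AddCommGroup M] [Module R M] :
    Prop :=
  ∃ c : ℕ, RedCxAux R c M inferInstance inferInstance

/-- `L` is (isomorphic to) `λ N = Ω Tr N`, computed from a minimal free presentation of `N`
over the local ring `S`. -/
def IsLambdaOf (S : Type u) [CommRing S] [IsLocalRing S]
    (N L : Type u) [AddCommGroup N] [Module S N] [AddCommGroup L] [Module S L] : Prop :=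
  ∃ (n₀ n₁ : ℕ) (g : (Fin n₀ → S) →ₗ[S] N) (f : (Fin n₁ → S) →ₗ[S] (Fin n₀ → S)),
    Function.Surjective g ∧
    LinearMap.range f = LinearMap.ker g ∧
    LinearMap.ker g ≤ (IsLocalRing.maximalIdeal S) • ⊤ ∧
    LinearMap.ker f ≤ (IsLocalRing.maximalIdeal S) • ⊤ ∧
    Nonempty (L ≃ₗ[S] LinearMap.range f.dualMap)

/-- `M` and `N` are linked by the ideal `c`: both are annihilated by `c` (hence are
`R/c`-modules) and `M ≅ λ_{R/c} N`, `N ≅ λ_{R/c} M`. -/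
def LinkedBy (c : Ideal R) (M N : Type u) [AddCommGroup M] [Module (R ⧸ c) M]
    [AddCommGroup N] [Module (R ⧸ c) N] [IsLocalRing (R ⧸ c)] : Prop :=
  IsLambdaOf (R ⧸ c) N M ∧ IsLambdaOf (R ⧸ c) M N

namespace Linkage

open Abelian

section ExtShift

variable {R : Type u} [CommRing R] {S : ShortComplex (ModuleCat.{u} R)} (hS : S.ShortExact)

include hS in
theorem subsingleton_ext_X₃ {Y : ModuleCat.{u} R} {n : ℕ}
    (h₁ : Subsingleton (Abelian.Ext S.X₁ Y n)) (h₂ : Subsingleton (Abelian.Ext S.X₂ Y (n + 1))) :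
    Subsingleton (Abelian.Ext S.X₃ Y (n + 1)) := by
  refine subsingleton_of_forall_eq 0 fun x => ?_
  obtain ⟨y, rfl⟩ := Ext.contravariant_sequence_exact₃ hS Y x (Subsingleton.elim _ _)
    (add_comm 1 n)
  rw [Subsingleton.elim y 0, Ext.comp_zero]

include hS in
theorem subsingleton_ext_X₂ {Y : ModuleCat.{u} R} {n : ℕ}
    (h₁ : Subsingleton (Abelian.Ext S.X₁ Y n)) (h₃ : Subsingleton (Abelian.Ext S.X₃ Y n)) :
    Subsingleton (Abelian.Ext S.X₂ Y n) := by
  refine subsingleton_of_forall_eq 0 fun x => ?_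
  obtain ⟨y, rfl⟩ := Ext.contravariant_sequence_exact₂ hS Y x (Subsingleton.elim _ _)
  rw [Subsingleton.elim y 0, Ext.comp_zero]

include hS in
theorem subsingleton_ext_X₁ {Y : ModuleCat.{u} R} {n : ℕ}
    (h₂ : Subsingleton (Abelian.Ext S.X₂ Y n)) (h₃ : Subsingleton (Abelian.Ext S.X₃ Y (n + 1))) :
    Subsingleton (Abelian.Ext S.X₁ Y n) := by
  refine subsingleton_of_forall_eq 0 fun x => ?_
  obtain ⟨y, rfl⟩ := Ext.contravariant_sequence_exact₁ hS Y x (add_comm 1 n)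
    (Subsingleton.elim _ _)
  rw [Subsingleton.elim y 0, Ext.comp_zero]

include hS in
theorem subsingleton_ext_to_X₁ {U : ModuleCat.{u} R} {n : ℕ}
    (h₃ : Subsingleton (Abelian.Ext U S.X₃ n)) (h₂ : Subsingleton (Abelian.Ext U S.X₂ (n + 1))) :
    Subsingleton (Abelian.Ext U S.X₁ (n + 1)) := by
  refine subsingleton_of_forall_eq 0 fun x => ?_
  obtain ⟨y, rfl⟩ := Ext.covariant_sequence_exact₁ U hS x (Subsingleton.elim _ _) rfl
  rw [Subsingleton.elim y 0, Ext.zero_comp]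

include hS in
theorem subsingleton_ext_to_X₂ {U : ModuleCat.{u} R} {n : ℕ}
    (h₁ : Subsingleton (Abelian.Ext U S.X₁ n)) (h₃ : Subsingleton (Abelian.Ext U S.X₃ n)) :
    Subsingleton (Abelian.Ext U S.X₂ n) := by
  refine subsingleton_of_forall_eq 0 fun x => ?_
  obtain ⟨y, rfl⟩ := Ext.covariant_sequence_exact₂ U hS x (Subsingleton.elim _ _)
  rw [Subsingleton.elim y 0, Ext.zero_comp]

include hS in
theorem subsingleton_ext_to_X₃ {U : ModuleCat.{u} R} {n : ℕ}
    (h₂ : Subsingleton (Abelian.Ext U S.X₂ n)) (h₁ : Subsingleton (Abelian.Ext U S.X₁ (n + 1))) :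
    Subsingleton (Abelian.Ext U S.X₃ n) := by
  refine subsingleton_of_forall_eq 0 fun x => ?_
  obtain ⟨y, rfl⟩ := Ext.covariant_sequence_exact₃ U hS x rfl (Subsingleton.elim _ _)
  rw [Subsingleton.elim y 0, Ext.zero_comp]

/-- Dimension shifting in the first variable. -/
def extShiftLeft (Y : ModuleCat.{u} R) (n : ℕ)
    (h₀ : Subsingleton (Abelian.Ext S.X₂ Y n)) (h₁ : Subsingleton (Abelian.Ext S.X₂ Y (n + 1))) :
    Abelian.Ext S.X₁ Y n ≃ₗ[R] Abelian.Ext S.X₃ Y (n + 1) :=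
  LinearEquiv.ofBijective (hS.extClass.precompOfLinear R Y (add_comm 1 n)) <| by
    constructor
    · rw [injective_iff_map_eq_zero]
      intro x hx
      obtain ⟨y, rfl⟩ := Ext.contravariant_sequence_exact₁ hS Y x (add_comm 1 n) hx
      rw [Subsingleton.elim y 0, Ext.comp_zero]
    · intro x
      exact Ext.contravariant_sequence_exact₃ hS Y x (Subsingleton.elim _ _) (add_comm 1 n)

/-- Dimension shifting in the second variable. -/
def extShiftRight (U : ModuleCat.{u} R) (n : ℕ)
    (h₀ : Subsingleton (Abelian.Ext U S.X₂ n)) (h₁ : Subsingleton (Abelian.Ext U S.X₂ (n + 1))) :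
    Abelian.Ext U S.X₃ n ≃ₗ[R] Abelian.Ext U S.X₁ (n + 1) :=
  LinearEquiv.ofBijective (hS.extClass.postcompOfLinear R U rfl) <| by
    constructor
    · rw [injective_iff_map_eq_zero]
      intro x hx
      obtain ⟨y, rfl⟩ := Ext.covariant_sequence_exact₃ U hS x rfl hx
      rw [Subsingleton.elim y 0, Ext.zero_comp]
    · intro x
      exact Ext.covariant_sequence_exact₁ U hS x (Subsingleton.elim _ _) rfl

/-- If `Ext U S.X₁` vanishes in two consecutive degrees, `S.X₂` and `S.X₃` have the same `Ext`. -/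
def extEquivRight (U : ModuleCat.{u} R) (n : ℕ)
    (h₀ : Subsingleton (Abelian.Ext U S.X₁ n)) (h₁ : Subsingleton (Abelian.Ext U S.X₁ (n + 1))) :
    Abelian.Ext U S.X₂ n ≃ₗ[R] Abelian.Ext U S.X₃ n :=
  LinearEquiv.ofBijective ((Ext.mk₀ S.g).postcompOfLinear R U (add_zero n)) <| by
    constructor
    · rw [injective_iff_map_eq_zero]
      intro x hx
      obtain ⟨y, rfl⟩ := Ext.covariant_sequence_exact₂ U hS x hx
      rw [Subsingleton.elim y 0, Ext.zero_comp]
    · intro x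
      exact Ext.covariant_sequence_exact₃ U hS x rfl (Subsingleton.elim _ _)

end ExtShift

section ExtIso

variable {R : Type u} [CommRing R]

/-- Invariance of `Ext` under isomorphism in the first variable. -/
def extIsoLeft {X X' : ModuleCat.{u} R} (e : X ≅ X') (Y : ModuleCat.{u} R) (n : ℕ) :
    Abelian.Ext X' Y n ≃ₗ[R] Abelian.Ext X Y n :=
  LinearEquiv.ofLinearMap ((Ext.mk₀ e.hom).precompOfLinear R Y (zero_add n))
    ((Ext.mk₀ e.inv).precompOfLinear R Y (zero_add n))
    (by ext x; simp) (by ext x; simp)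

/-- Invariance of `Ext` under isomorphism in the second variable. -/
def extIsoRight (X : ModuleCat.{u} R) {Y Y' : ModuleCat.{u} R} (e : Y ≅ Y') (n : ℕ) :
    Abelian.Ext X Y n ≃ₗ[R] Abelian.Ext X Y' n :=
  LinearEquiv.ofLinearMap ((Ext.mk₀ e.hom).postcompOfLinear R X (add_zero n))
    ((Ext.mk₀ e.inv).postcompOfLinear R X (add_zero n))
    (by ext x; simp) (by ext x; simp)

/-- Transport of `Ext` along an equality of degrees. -/
def extCast (X Y : ModuleCat.{u} R) {m n : ℕ} (h : m = n) :
    Abelian.Ext X Y m ≃ₗ[R] Abelian.Ext X Y n := by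
  subst h; exact LinearEquiv.refl _ _

theorem subsingleton_ext_of_projective (P Y : ModuleCat.{u} R) [Projective P] {n : ℕ}
    (hn : 0 < n) : Subsingleton (Abelian.Ext P Y n) := by
  obtain ⟨n, rfl⟩ := Nat.exists_eq_succ_of_ne_zero hn.ne'
  exact subsingleton_of_forall_eq 0 Ext.eq_zero_of_projective

theorem subsingleton_ext_of_injective (X I : ModuleCat.{u} R) [Injective I] {n : ℕ}
    (hn : 0 < n) : Subsingleton (Abelian.Ext X I n) := by
  obtain ⟨n, rfl⟩ := Nat.exists_eq_succ_of_ne_zero hn.ne'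
  exact subsingleton_of_forall_eq 0 Ext.eq_zero_of_injective

/-- The linear map `Hom(S.X₁, Y) → Ext¹(S.X₃, Y)` attached to a short exact sequence. -/
def homToExtOne {S : ShortComplex (ModuleCat.{u} R)} (hS : S.ShortExact) (Y : ModuleCat.{u} R) :
    (S.X₁ ⟶ Y) →ₗ[R] Abelian.Ext S.X₃ Y 1 :=
  (hS.extClass.precompOfLinear R Y (add_zero 1)).comp
    (Ext.linearEquiv₀ (R := R)).symm.toLinearMap

theorem homToExtOne_eq_zero_iff {S : ShortComplex (ModuleCat.{u} R)} (hS : S.ShortExact)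
    (Y : ModuleCat.{u} R) (φ : S.X₁ ⟶ Y) :
    homToExtOne hS Y φ = 0 ↔ ∃ ψ : S.X₂ ⟶ Y, S.f ≫ ψ = φ := by
  constructor
  · intro h
    obtain ⟨y, hy⟩ := Ext.contravariant_sequence_exact₁ hS Y (Ext.mk₀ φ) (add_zero 1) h
    obtain ⟨ψ, rfl⟩ := Ext.homEquiv₀.symm.surjective y
    refine ⟨ψ, Ext.homEquiv₀.symm.injective ?_⟩
    simpa using hy
  · rintro ⟨ψ, rfl⟩
    change hS.extClass.comp (Ext.mk₀ (S.f ≫ ψ)) (add_zero 1) = 0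
    rw [← Ext.mk₀_comp_mk₀, ShortComplex.ShortExact.extClass_comp_assoc]

theorem homToExtOne_surjective {S : ShortComplex (ModuleCat.{u} R)} (hS : S.ShortExact)
    (Y : ModuleCat.{u} R) (h : Subsingleton (Abelian.Ext S.X₂ Y 1)) :
    Function.Surjective (homToExtOne hS Y) := by
  intro x
  obtain ⟨y, hy⟩ := Ext.contravariant_sequence_exact₃ hS Y x (Subsingleton.elim _ _) (add_zero 1)
  exact ⟨Ext.linearEquiv₀ (R := R) y, by simpa [homToExtOne] using hy⟩

/-- The linear map `Hom(U, S.X₃) → Ext¹(U, S.X₁)` attached to a short exact sequence. -/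
def homToExtOneRight {S : ShortComplex (ModuleCat.{u} R)} (hS : S.ShortExact)
    (U : ModuleCat.{u} R) : (U ⟶ S.X₃) →ₗ[R] Abelian.Ext U S.X₁ 1 :=
  (hS.extClass.postcompOfLinear R U (zero_add 1)).comp
    (Ext.linearEquiv₀ (R := R)).symm.toLinearMap

theorem homToExtOneRight_eq_zero_iff {S : ShortComplex (ModuleCat.{u} R)} (hS : S.ShortExact)
    (U : ModuleCat.{u} R) (φ : U ⟶ S.X₃) :
    homToExtOneRight hS U φ = 0 ↔ ∃ ψ : U ⟶ S.X₂, ψ ≫ S.g = φ := by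
  constructor
  · intro h
    obtain ⟨y, hy⟩ := Ext.covariant_sequence_exact₃ U hS (Ext.mk₀ φ) (zero_add 1) h
    obtain ⟨ψ, rfl⟩ := Ext.homEquiv₀.symm.surjective y
    refine ⟨ψ, Ext.homEquiv₀.symm.injective ?_⟩
    simpa using hy
  · rintro ⟨ψ, rfl⟩
    change (Ext.mk₀ (ψ ≫ S.g)).comp hS.extClass (zero_add 1) = 0
    rw [← Ext.mk₀_comp_mk₀, Ext.comp_assoc_of_second_deg_zero,
      ShortComplex.ShortExact.comp_extClass, Ext.comp_zero]

theorem homToExtOneRight_surjective {S : ShortComplex (ModuleCat.{u} R)} (hS : S.ShortExact)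
    (U : ModuleCat.{u} R) (h : Subsingleton (Abelian.Ext U S.X₂ 1)) :
    Function.Surjective (homToExtOneRight hS U) := by
  intro x
  obtain ⟨y, hy⟩ := Ext.covariant_sequence_exact₁ U hS x (Subsingleton.elim _ _) (zero_add 1)
  exact ⟨Ext.linearEquiv₀ (R := R) y, by simpa [homToExtOneRight] using hy⟩

end ExtIso

/-- Two surjective linear maps with corresponding kernels have isomorphic targets. -/
theorem nonempty_linearEquiv_of_ker {R A B C D : Type*} [CommRing R] [AddCommGroup A]
    [AddCommGroup B] [AddCommGroup C] [AddCommGroup D] [Module R A] [Module R B] [Module R C]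
    [Module R D] (f : A →ₗ[R] C) (g : B →ₗ[R] D) (e : A ≃ₗ[R] B) (hf : Function.Surjective f)
    (hg : Function.Surjective g) (h : ∀ x, f x = 0 ↔ g (e x) = 0) : Nonempty (C ≃ₗ[R] D) := by
  refine ⟨(f.quotKerEquivOfSurjective hf).symm.trans
    ((Submodule.Quotient.equiv _ _ e ?_).trans (g.quotKerEquivOfSurjective hg))⟩
  ext y
  simp only [Submodule.mem_map, LinearMap.mem_ker]
  constructor
  · rintro ⟨x, hx, rfl⟩
    exact (h x).1 hx
  · intro hy
    exact ⟨e.symm y, (h _).2 (by simpa using hy), by simp⟩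

end Linkage

namespace Linkage

open Abelian

section Dual

variable {R : Type u} [CommRing R]

/-- The ring as a module over itself. -/
abbrev unitMod (R : Type u) [CommRing R] : ModuleCat.{u} R := ModuleCat.of R R

/-- The dual module. -/
abbrev dualObj (X : ModuleCat.{u} R) : ModuleCat.{u} R := ModuleCat.of R (Module.Dual R X)

/-- The transpose of a morphism. -/
abbrev dualHom {X Y : ModuleCat.{u} R} (f : X ⟶ Y) : dualObj Y ⟶ dualObj X :=
  ModuleCat.ofHom f.hom.dualMap

theorem shortExact_of_linear (S : ShortComplex (ModuleCat.{u} R))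
    (hf : Function.Injective S.f.hom) (hfg : ∀ x, S.g.hom x = 0 → ∃ y, S.f.hom y = x)
    (hg : Function.Surjective S.g.hom) : S.ShortExact where
  exact := by
    rw [ShortComplex.moduleCat_exact_iff]
    exact hfg
  mono_f := (ModuleCat.mono_iff_injective _).2 hf
  epi_g := (ModuleCat.epi_iff_surjective _).2 hg

theorem injective_of_shortExact {S : ShortComplex (ModuleCat.{u} R)} (hS : S.ShortExact) :
    Function.Injective S.f.hom := hS.moduleCat_injective_f

theorem surjective_of_shortExact {S : ShortComplex (ModuleCat.{u} R)} (hS : S.ShortExact) :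
    Function.Surjective S.g.hom := hS.moduleCat_surjective_g

theorem exists_of_shortExact {S : ShortComplex (ModuleCat.{u} R)} (hS : S.ShortExact)
    (x : S.X₂) (hx : S.g.hom x = 0) : ∃ y, S.f.hom y = x :=
  (ShortComplex.moduleCat_exact_iff S).1 hS.exact x hx

/-- Replacing the kernel of a short exact sequence by an isomorphic object. -/
theorem shortExact_replace_left {S : ShortComplex (ModuleCat.{u} R)} (hS : S.ShortExact)
    {X : ModuleCat.{u} R} (e : X ≅ S.X₁) :
    (ShortComplex.mk (e.hom ≫ S.f) S.g
      (by rw [Category.assoc, S.zero, comp_zero])).ShortExact := by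
  let T := ShortComplex.mk (e.hom ≫ S.f) S.g (by rw [Category.assoc, S.zero, comp_zero])
  have i : S ≅ T := ShortComplex.isoMk (S₂ := T) e.symm (Iso.refl _) (Iso.refl _)
    (by simp [T]) (by simp [T])
  exact ShortComplex.shortExact_of_iso i hS

/-- Replacing the cokernel of a short exact sequence by an isomorphic object. -/
theorem shortExact_replace_right {S : ShortComplex (ModuleCat.{u} R)} (hS : S.ShortExact)
    {X : ModuleCat.{u} R} (e : S.X₃ ≅ X) :
    (ShortComplex.mk S.f (S.g ≫ e.hom)
      (by rw [← Category.assoc, S.zero, zero_comp])).ShortExact := by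
  let T := ShortComplex.mk S.f (S.g ≫ e.hom) (by rw [← Category.assoc, S.zero, zero_comp])
  have i : S ≅ T := ShortComplex.isoMk (S₂ := T) (Iso.refl _) (Iso.refl _) e
    (by simp [T]) (by simp [T])
  exact ShortComplex.shortExact_of_iso i hS

theorem comp_zero_apply (S : ShortComplex (ModuleCat.{u} R)) (x : S.X₁) :
    S.g.hom (S.f.hom x) = 0 := by
  rw [← ModuleCat.comp_apply, S.zero]; rfl

/-- The dual of a short complex. -/
abbrev dualComplex (S : ShortComplex (ModuleCat.{u} R)) : ShortComplex (ModuleCat.{u} R) :=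
  ShortComplex.mk (dualHom S.g) (dualHom S.f) (by
    ext φ x
    simp)

theorem dual_exact_left {S : ShortComplex (ModuleCat.{u} R)} (hS : S.ShortExact)
    (φ : Module.Dual R S.X₂) (hφ : φ.comp S.f.hom = 0) :
    ∃ ψ : Module.Dual R S.X₃, ψ.comp S.g.hom = φ := by
  have : S.f ≫ ModuleCat.ofHom φ = 0 := by
    ext x; exact LinearMap.congr_fun hφ x
  obtain ⟨ψ, hψ⟩ := CokernelCofork.IsColimit.desc' hS.gIsCokernel (ModuleCat.ofHom φ) this
  refine ⟨ψ.hom, ?_⟩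
  change S.g ≫ ψ = ModuleCat.ofHom φ at hψ
  rw [← ModuleCat.hom_comp, hψ]; rfl

theorem dualComplex_shortExact {S : ShortComplex (ModuleCat.{u} R)} (hS : S.ShortExact)
    (h : Subsingleton (Abelian.Ext S.X₃ (unitMod R) 1)) : (dualComplex S).ShortExact := by
  refine shortExact_of_linear _ ?_ ?_ ?_
  · exact LinearMap.dualMap_injective_of_surjective (surjective_of_shortExact hS)
  · intro φ hφ
    exact dual_exact_left hS φ hφ
  · intro φ
    obtain ⟨ψ, hψ⟩ := (homToExtOne_eq_zero_iff hS (unitMod R) (ModuleCat.ofHom φ)).1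
      (Subsingleton.elim _ _)
    refine ⟨ψ.hom, ?_⟩
    change ψ.hom.comp S.f.hom = φ
    rw [← ModuleCat.hom_comp, hψ]; rfl

/-- The isomorphism of duals induced by an isomorphism. -/
def dualIso {X Y : ModuleCat.{u} R} (e : X ≅ Y) : dualObj X ≅ dualObj Y :=
  e.toLinearEquiv.symm.dualMap.toModuleIso

theorem projective_of_finite_projective {P : ModuleCat.{u} R} [Projective P] :
    Module.Projective R P := (IsProjective.iff_projective P).2 inferInstance

instance projective_dualObj (P : ModuleCat.{u} R) [Projective P] [Module.Finite R P] :
    Projective (dualObj P) := by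
  have : Module.Projective R P := projective_of_finite_projective
  exact (IsProjective.iff_projective _).1 inferInstance

instance finite_dualObj_of_projective (P : ModuleCat.{u} R) [Projective P] [Module.Finite R P] :
    Module.Finite R (dualObj P) := by
  have : Module.Projective R P := projective_of_finite_projective
  infer_instance

/-- A presentation: every finite module is the quotient of a finite projective one, with finite
kernel when the ring is Noetherian. -/
theorem exists_syzygy [IsNoetherianRing R] (X : ModuleCat.{u} R) [Module.Finite R X] :
    ∃ S : ShortComplex (ModuleCat.{u} R), S.ShortExact ∧ S.X₃ = X ∧ Projective S.X₂ ∧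
      Module.Finite R S.X₂ ∧ Module.Finite R S.X₁ := by
  obtain ⟨n, f, hf⟩ := Module.Finite.exists_fin' R X
  refine ⟨ShortComplex.mk (ModuleCat.ofHom (LinearMap.ker f).subtype) (ModuleCat.ofHom f)
    (by ext x; simp), ?_, rfl, ?_, ?_, ?_⟩
  · refine shortExact_of_linear _ (Submodule.injective_subtype _) ?_ hf
    intro x hx
    exact ⟨⟨x, hx⟩, rfl⟩
  · exact (IsProjective.iff_projective (ModuleCat.of R (Fin n → R))).1 inferInstance
  · change Module.Finite R (Fin n → R); infer_instance
  · change Module.Finite R (LinearMap.ker f); infer_instance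

theorem finite_dualObj [IsNoetherianRing R] (X : ModuleCat.{u} R) [Module.Finite R X] :
    Module.Finite R (dualObj X) := by
  obtain ⟨n, f, hf⟩ := Module.Finite.exists_fin' R X
  exact Module.Finite.of_injective f.dualMap (LinearMap.dualMap_injective_of_surjective hf)

end Dual

section GProj

variable {R : Type u} [CommRing R]

/-- A finite module with `Ext^i(X, R) = 0` for all `i > 0`. -/
structure IsGProj (X : ModuleCat.{u} R) : Prop where
  finite : Module.Finite R X
  ext_zero : ∀ i : ℕ, 0 < i → Subsingleton (Abelian.Ext X (unitMod R) i)

theorem IsGProj.of_iso {X Y : ModuleCat.{u} R} (hX : IsGProj X) (e : X ≅ Y) : IsGProj Y where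
  finite := by
    have := hX.finite
    exact Module.Finite.equiv e.toLinearEquiv
  ext_zero i hi := by
    have := hX.ext_zero i hi
    exact (extIsoLeft e.symm (unitMod R) i).symm.toEquiv.subsingleton

theorem IsGProj.syzygy [IsNoetherianRing R] {S : ShortComplex (ModuleCat.{u} R)}
    (hS : S.ShortExact) [Projective S.X₂] [Module.Finite R S.X₂] (h : IsGProj S.X₃) :
    IsGProj S.X₁ where
  finite := Module.Finite.of_injective S.f.hom (injective_of_shortExact hS)
  ext_zero i hi := subsingleton_ext_X₁ hS (subsingleton_ext_of_projective _ _ hi)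
    (h.ext_zero _ (Nat.succ_pos i))

/-- `W` has no higher `Ext` from `IsGProj` modules. -/
def IsOrth (W : ModuleCat.{u} R) : Prop :=
  ∀ U : ModuleCat.{u} R, IsGProj U → ∀ i : ℕ, 0 < i → Subsingleton (Abelian.Ext U W i)

theorem IsOrth.retract {W V : ModuleCat.{u} R} (hW : IsOrth W) (s : V ⟶ W) (r : W ⟶ V)
    (h : s ≫ r = 𝟙 V) : IsOrth V := by
  intro U hU i hi
  have := hW U hU i hi
  refine subsingleton_of_forall_eq 0 fun x => ?_
  have hx : (x.comp (Ext.mk₀ s) (add_zero i)).comp (Ext.mk₀ r) (add_zero i) = x := by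
    rw [Ext.comp_assoc_of_third_deg_zero, Ext.mk₀_comp_mk₀, h, Ext.comp_mk₀_id]
  rw [← hx, Subsingleton.elim (x.comp (Ext.mk₀ s) (add_zero i)) 0, Ext.zero_comp]

theorem isOrth_unit : IsOrth (unitMod R) := fun _ hU i hi => hU.ext_zero i hi

/-- The split exact sequence `0 → W → W^(n+1) → W^n → 0`. -/
theorem isOrth_fin (W : ModuleCat.{u} R) (hW : IsOrth W) (n : ℕ) :
    IsOrth (ModuleCat.of R (Fin n → W)) := by
  induction n with
  | zero =>
    intro U _ i _
    refine subsingleton_of_forall_eq 0 fun x => ?_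
    rw [← Ext.comp_mk₀_id x]
    have : 𝟙 (ModuleCat.of R (Fin 0 → W)) = 0 := by
      ext x; exact x.elim0
    rw [this, Ext.mk₀_zero, Ext.comp_zero]
  | succ n ih =>
    have hS : (ShortComplex.mk (ModuleCat.ofHom (LinearMap.single R (fun _ : Fin (n + 1) => W) 0))
        (ModuleCat.ofHom (LinearMap.funLeft R W (Fin.succ (n := n))))
        (by ext x i; rw [ModuleCat.hom_comp]; simp [LinearMap.funLeft_apply]; rfl)).ShortExact := by
      refine shortExact_of_linear _ (fun x y hxy => by simpa using congrFun hxy 0) ?_ ?_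
      · intro x hx
        refine ⟨x 0, ?_⟩
        ext i
        refine Fin.cases ?_ (fun j => ?_) i
        · simp
        · have := congrFun hx j
          simp [LinearMap.funLeft_apply] at this ⊢
          exact this.symm
      · exact LinearMap.funLeft_surjective_of_injective R W _ (Fin.succ_injective n)
    intro U hU i hi
    exact subsingleton_ext_to_X₂ hS (hW U hU i hi) (ih U hU i hi)

theorem isOrth_of_projective (P : ModuleCat.{u} R) [Projective P] [Module.Finite R P] :
    IsOrth P := by
  have : Module.Projective R P := projective_of_finite_projective
  obtain ⟨n, f, hf⟩ := Module.Finite.exists_fin' R P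
  obtain ⟨s, hs⟩ := Module.projective_lifting_property f LinearMap.id hf
  exact (isOrth_fin (unitMod R) isOrth_unit n).retract (ModuleCat.ofHom s) (ModuleCat.ofHom f)
    (by ext x; exact LinearMap.congr_fun hs x)

theorem IsOrth.quotient {S : ShortComplex (ModuleCat.{u} R)} (hS : S.ShortExact)
    (h₁ : IsOrth S.X₁) (h₂ : IsOrth S.X₂) : IsOrth S.X₃ := fun U hU i hi =>
  subsingleton_ext_to_X₃ hS (h₂ U hU i hi) (h₁ U hU _ (Nat.succ_pos i))

/-- Vanishing of `Ext(X^*, W)` when `W` has finite injective dimension relative to finite modules. -/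
theorem subsingleton_ext_dual [IsNoetherianRing R] {W : ModuleCat.{u} R} {r : ℕ}
    (hW : ∀ V : ModuleCat.{u} R, Module.Finite R V → ∀ i, r < i →
      Subsingleton (Abelian.Ext V W i)) {X : ModuleCat.{u} R} (hX : IsGProj X) (i : ℕ)
    (hi : 0 < i) : Subsingleton (Abelian.Ext (dualObj X) W i) := by
  suffices H : ∀ t : ℕ, ∀ X : ModuleCat.{u} R, IsGProj X → ∀ i, 0 < i → r < i + t →
      Subsingleton (Abelian.Ext (dualObj X) W i) from H (r + 1) X hX i hi (by omega)
  intro t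
  induction t with
  | zero =>
    intro X hX i _ hr
    have := hX.finite
    exact hW _ (finite_dualObj X) i hr
  | succ t ih =>
    intro X hX i hi hr
    have := hX.finite
    obtain ⟨S, hS, rfl, hP, hPf, _⟩ := exists_syzygy X
    have hX' := hX.syzygy hS
    exact subsingleton_ext_X₁ (dualComplex_shortExact hS (hX.ext_zero 1 one_pos))
      (subsingleton_ext_of_projective _ _ hi) (ih _ hX' (i + 1) (Nat.succ_pos i) (by omega))

/-- `R` has finite injective dimension, tested on finite modules. -/
def FiniteSelfInj (R : Type u) [CommRing R] : Prop :=
  ∃ r : ℕ, ∀ V : ModuleCat.{u} R, Module.Finite R V → ∀ i, r < i →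
    Subsingleton (Abelian.Ext V (unitMod R) i)

variable [IsNoetherianRing R] (hR : FiniteSelfInj R)

include hR

theorem IsGProj.dual {X : ModuleCat.{u} R} (hX : IsGProj X) : IsGProj (dualObj X) where
  finite := by have := hX.finite; exact finite_dualObj X
  ext_zero i hi := by
    obtain ⟨r, hr⟩ := hR
    exact subsingleton_ext_dual hr hX i hi

theorem IsGProj.eval_surjective {X : ModuleCat.{u} R} (hX : IsGProj X) :
    Function.Surjective (Module.Dual.eval R X) := by
  have := hX.finite
  obtain ⟨S, hS, rfl, hP, hPf, _⟩ := exists_syzygy X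
  have h1 := dualComplex_shortExact hS (hX.ext_zero 1 one_pos)
  have h2 := dualComplex_shortExact h1 (((hX.syzygy hS).dual hR).ext_zero 1 one_pos)
  have : Module.Projective R S.X₂ := projective_of_finite_projective
  intro y
  obtain ⟨z, hz⟩ := surjective_of_shortExact h2 y
  obtain ⟨p, rfl⟩ := (Module.bijective_dual_eval R S.X₂).2 z
  exact ⟨S.g.hom p, hz⟩

theorem IsGProj.eval_bijective {X : ModuleCat.{u} R} (hX : IsGProj X) :
    Function.Bijective (Module.Dual.eval R X) := by
  refine ⟨?_, hX.eval_surjective hR⟩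
  have := hX.finite
  obtain ⟨S, hS, rfl, hP, hPf, _⟩ := exists_syzygy X
  have h1 := dualComplex_shortExact hS (hX.ext_zero 1 one_pos)
  have h2 := dualComplex_shortExact h1 (((hX.syzygy hS).dual hR).ext_zero 1 one_pos)
  have : Module.Projective R S.X₂ := projective_of_finite_projective
  rw [injective_iff_map_eq_zero]
  intro x hx
  obtain ⟨p, rfl⟩ := surjective_of_shortExact hS x
  obtain ⟨y, hy⟩ := exists_of_shortExact h2 (Module.Dual.eval R S.X₂ p) hx
  obtain ⟨z, rfl⟩ := (hX.syzygy hS).eval_surjective hR y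
  have : S.f.hom z = p := (Module.bijective_dual_eval R S.X₂).1 hy
  rw [← this, comp_zero_apply]

/-- Every `IsGProj` module over a ring of finite self-injective dimension is a syzygy of one. -/
theorem IsGProj.exists_cosyzygy {X : ModuleCat.{u} R} (hX : IsGProj X) :
    ∃ S : ShortComplex (ModuleCat.{u} R), S.ShortExact ∧ S.X₁ = X ∧ Projective S.X₂ ∧
      Module.Finite R S.X₂ ∧ IsGProj S.X₃ ∧
      ∃ K : ModuleCat.{u} R, IsGProj K ∧ S.X₃ = dualObj K := by
  have hXd := hX.dual hR
  have := hXd.finite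
  obtain ⟨S, hS, h3, hP, hPf, _⟩ := exists_syzygy (dualObj X)
  have hS3 : IsGProj S.X₃ := h3 ▸ hXd
  have h1 := dualComplex_shortExact hS (hS3.ext_zero 1 one_pos)
  have e : X ≅ dualObj S.X₃ :=
    (LinearEquiv.ofBijective _ (hX.eval_bijective hR)).toModuleIso.trans (eqToIso (by rw [h3]))
  exact ⟨_, shortExact_replace_left h1 e, rfl,
    projective_dualObj S.X₂, finite_dualObj_of_projective S.X₂, (hS3.syzygy hS).dual hR,
    S.X₁, hS3.syzygy hS, rfl⟩

end GProj

end Linkage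

namespace Linkage

open Abelian

section Swap

variable {R : Type u} [CommRing R]

/-- Exchange of the two arguments of a linear map into a dual module. -/
def flipEquiv (X Y : ModuleCat.{u} R) : (X ⟶ dualObj Y) ≃ₗ[R] (Y ⟶ dualObj X) where
  toFun f := ModuleCat.ofHom (LinearMap.flip f.hom)
  invFun f := ModuleCat.ofHom (LinearMap.flip f.hom)
  map_add' _ _ := rfl
  map_smul' _ _ := rfl
  left_inv _ := rfl
  right_inv _ := rfl

theorem swap_ext_one {S : ShortComplex (ModuleCat.{u} R)} (hS : S.ShortExact) [Projective S.X₂]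
    [Module.Finite R S.X₂] (hX : IsGProj S.X₃) {Y : ModuleCat.{u} R} (hY : IsGProj Y) :
    Nonempty (Abelian.Ext S.X₃ (dualObj Y) 1 ≃ₗ[R] Abelian.Ext Y (dualObj S.X₃) 1) := by
  have hD := dualComplex_shortExact hS (hX.ext_zero 1 one_pos)
  refine nonempty_linearEquiv_of_ker (homToExtOne hS (dualObj Y)) (homToExtOneRight hD Y)
    (flipEquiv S.X₁ Y) (homToExtOne_surjective hS _ (subsingleton_ext_of_projective _ _ one_pos))
    (homToExtOneRight_surjective hD _ (isOrth_of_projective (dualObj S.X₂) Y hY 1 one_pos)) ?_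
  intro φ
  rw [homToExtOne_eq_zero_iff, homToExtOneRight_eq_zero_iff]
  constructor
  · rintro ⟨ψ, rfl⟩
    exact ⟨flipEquiv S.X₂ Y ψ, rfl⟩
  · rintro ⟨ψ, hψ⟩
    refine ⟨(flipEquiv S.X₂ Y).symm ψ, (flipEquiv S.X₁ Y).injective ?_⟩
    rw [← hψ]
    rfl

variable [IsNoetherianRing R]

theorem swap_ext {X Y : ModuleCat.{u} R} (hX : IsGProj X) (hY : IsGProj Y) (j : ℕ) :
    Nonempty (Abelian.Ext X (dualObj Y) (j + 1) ≃ₗ[R] Abelian.Ext Y (dualObj X) (j + 1)) := by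
  induction j generalizing X with
  | zero =>
    have := hX.finite
    obtain ⟨S, hS, rfl, hP, hPf, _⟩ := exists_syzygy X
    exact swap_ext_one hS hX hY
  | succ j ih =>
    have := hX.finite
    obtain ⟨S, hS, rfl, hP, hPf, _⟩ := exists_syzygy X
    obtain ⟨e⟩ := ih (hX.syzygy hS)
    have hD := dualComplex_shortExact hS (hX.ext_zero 1 one_pos)
    have hO := isOrth_of_projective (dualObj S.X₂) Y hY
    exact ⟨(extShiftLeft hS (dualObj Y) (j + 1) (subsingleton_ext_of_projective _ _ (by omega))
      (subsingleton_ext_of_projective _ _ (by omega))).symm.trans (e.trans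
        (extShiftRight hD Y (j + 1) (hO _ (by omega)) (hO _ (by omega))))⟩

end Swap

section Syz

variable {R : Type u} [CommRing R]

/-- `Syz p M X`: the module `X` is a `p`-th syzygy of `M` in a resolution by finite projective
modules. -/
def Syz : ℕ → ModuleCat.{u} R → ModuleCat.{u} R → Prop
  | 0, M, X => Nonempty (M ≅ X)
  | p + 1, M, X => ∃ S : ShortComplex (ModuleCat.{u} R), S.ShortExact ∧ S.X₃ = M ∧
      Projective S.X₂ ∧ Module.Finite R S.X₂ ∧ Syz p S.X₁ X

theorem Syz.of_iso_left {p : ℕ} {M M' X : ModuleCat.{u} R} (h : Syz p M X) (e : M ≅ M') :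
    Syz p M' X := by
  cases p with
  | zero =>
    obtain ⟨f⟩ := h
    exact ⟨e.symm.trans f⟩
  | succ p =>
    obtain ⟨S, hS, rfl, hP, hPf, h⟩ := h
    exact ⟨_, shortExact_replace_right hS e, rfl, hP, hPf, h⟩

theorem Syz.trans {p q : ℕ} {M Y X : ModuleCat.{u} R} (h₁ : Syz p M Y) (h₂ : Syz q Y X) :
    Syz (p + q) M X := by
  induction p generalizing M with
  | zero =>
    obtain ⟨e⟩ := h₁
    rw [zero_add]
    exact h₂.of_iso_left e.symm
  | succ p ih =>
    obtain ⟨S, hS, rfl, hP, hPf, h⟩ := h₁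
    rw [Nat.succ_add]
    exact ⟨S, hS, rfl, hP, hPf, ih h⟩

theorem Syz.split {p q : ℕ} {M X : ModuleCat.{u} R} (h : Syz (p + q) M X) :
    ∃ Y, Syz p M Y ∧ Syz q Y X := by
  induction p generalizing M with
  | zero => exact ⟨M, ⟨Iso.refl M⟩, by rwa [zero_add] at h⟩
  | succ p ih =>
    rw [Nat.succ_add] at h
    obtain ⟨S, hS, rfl, hP, hPf, h⟩ := h
    obtain ⟨Y, h1, h2⟩ := ih h
    exact ⟨Y, ⟨S, hS, rfl, hP, hPf, h1⟩, h2⟩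

theorem Syz.refl (M : ModuleCat.{u} R) : Syz 0 M M := ⟨Iso.refl M⟩

theorem Syz.nonempty_ext {p : ℕ} {M X : ModuleCat.{u} R} (h : Syz p M X) (V : ModuleCat.{u} R)
    (j : ℕ) (hj : 0 < j) : Nonempty (Abelian.Ext X V j ≃ₗ[R] Abelian.Ext M V (j + p)) := by
  induction p generalizing M with
  | zero =>
    obtain ⟨e⟩ := h
    exact ⟨extIsoLeft e V j⟩
  | succ p ih =>
    obtain ⟨S, hS, rfl, hP, hPf, h⟩ := h
    obtain ⟨e⟩ := ih h
    exact ⟨e.trans (extShiftLeft hS V (j + p) (subsingleton_ext_of_projective _ _ (by omega))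
      (subsingleton_ext_of_projective _ _ (by omega)))⟩

theorem isOrth_of_subsingleton (W : ModuleCat.{u} R) [Subsingleton W] : IsOrth W := by
  intro U _ i _
  refine subsingleton_of_forall_eq 0 fun x => ?_
  rw [← Ext.comp_mk₀_id x]
  have : 𝟙 W = 0 := by
    ext x; exact Subsingleton.elim _ _
  rw [this, Ext.mk₀_zero, Ext.comp_zero]

/-- `Ext⁰(M, R)` is the dual module. -/
def extZeroEquivDual (M : ModuleCat.{u} R) :
    Abelian.Ext M (unitMod R) 0 ≃ₗ[R] Module.Dual R M :=
  (Ext.linearEquiv₀ (R := R)).trans (ModuleCat.homLinearEquiv (S := R))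

/-- The module `Ext^n(M, R)`. -/
abbrev extDual (n : ℕ) (M : ModuleCat.{u} R) : ModuleCat.{u} R :=
  ModuleCat.of R (Abelian.Ext M (unitMod R) n)

/-- Dualizing `0 → X₁ → X₂ → X₃ → 0` with `X₂` projective gives two short exact sequences
ending in `Ext¹(X₃, R)`. -/
theorem exists_shortExact_extDual_one {S : ShortComplex (ModuleCat.{u} R)} (hS : S.ShortExact)
    [Projective S.X₂] :
    ∃ (W : ModuleCat.{u} R) (ρ : dualObj S.X₂ ⟶ W) (hρ : dualHom S.g ≫ ρ = 0)
      (ι : W ⟶ dualObj S.X₁) (δ : dualObj S.X₁ ⟶ extDual 1 S.X₃) (hι : ι ≫ δ = 0),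
      (ShortComplex.mk (dualHom S.g) ρ hρ).ShortExact ∧
        (ShortComplex.mk ι δ hι).ShortExact := by
  let δ : Module.Dual R S.X₁ →ₗ[R] Abelian.Ext S.X₃ (unitMod R) 1 :=
    (homToExtOne hS (unitMod R)).comp
      (ModuleCat.homLinearEquiv (S := R) (M := S.X₁) (N := unitMod R)).symm.toLinearMap
  have hδ : ∀ φ, δ φ = 0 ↔ ∃ ψ : Module.Dual R S.X₂, ψ.comp S.f.hom = φ := by
    intro φ
    refine (homToExtOne_eq_zero_iff hS (unitMod R) (ModuleCat.ofHom φ)).trans ?_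
    constructor
    · rintro ⟨ψ, hψ⟩
      exact ⟨ψ.hom, by rw [← ModuleCat.hom_comp, hψ]; rfl⟩
    · rintro ⟨ψ, rfl⟩
      exact ⟨ModuleCat.ofHom ψ, rfl⟩
  let W : Submodule R (Module.Dual R S.X₁) := LinearMap.range S.f.hom.dualMap
  let ρ : dualObj S.X₂ ⟶ ModuleCat.of R W := ModuleCat.ofHom S.f.hom.dualMap.rangeRestrict
  let ι : ModuleCat.of R W ⟶ dualObj S.X₁ := ModuleCat.ofHom W.subtype
  let δ' : dualObj S.X₁ ⟶ extDual 1 S.X₃ := ModuleCat.ofHom δ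
  have hρ : dualHom S.g ≫ ρ = 0 := by
    refine ModuleCat.hom_ext (LinearMap.ext fun (φ : Module.Dual R S.X₃) => ?_)
    apply Subtype.ext
    change ((φ.comp S.g.hom).comp S.f.hom : Module.Dual R S.X₁) = 0
    refine LinearMap.ext fun x => ?_
    change φ (S.g.hom (S.f.hom x)) = 0
    rw [comp_zero_apply, map_zero]
  have hι : ι ≫ δ' = 0 := by
    ext φ
    obtain ⟨_, ψ, rfl⟩ := φ
    exact (hδ _).2 ⟨ψ, rfl⟩
  have h1 : (ShortComplex.mk (dualHom S.g) ρ hρ).ShortExact := by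
    refine shortExact_of_linear _
      (LinearMap.dualMap_injective_of_surjective (surjective_of_shortExact hS)) ?_
      (LinearMap.surjective_rangeRestrict _)
    intro φ hφ
    exact dual_exact_left hS φ (congrArg Subtype.val hφ)
  have h2 : (ShortComplex.mk ι δ' hι).ShortExact := by
    refine shortExact_of_linear _ (Submodule.injective_subtype _) ?_ ?_
    · intro φ hφ
      obtain ⟨ψ, rfl⟩ := (hδ φ).1 hφ
      exact ⟨⟨_, ψ, rfl⟩, rfl⟩
    · exact (homToExtOne_surjective hS _ (subsingleton_ext_of_projective _ _ one_pos)).comp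
        (ModuleCat.homLinearEquiv (S := R) (M := S.X₁) (N := unitMod R)).symm.surjective
  exact ⟨_, ρ, hρ, ι, δ', hι, h1, h2⟩

theorem ext_dual_syzygy_one {S : ShortComplex (ModuleCat.{u} R)} (hS : S.ShortExact)
    [Projective S.X₂] [Module.Finite R S.X₂] (hO : IsOrth (dualObj S.X₃))
    {U : ModuleCat.{u} R} (hU : IsGProj U) (b : ℕ) (hb : 0 < b) :
    Nonempty (Abelian.Ext U (dualObj S.X₁) b ≃ₗ[R] Abelian.Ext U (extDual 1 S.X₃) b) := by
  obtain ⟨W, ρ, hρ, ι, δ, hι, h1, h2⟩ := exists_shortExact_extDual_one hS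
  have hW := IsOrth.quotient h1 hO (isOrth_of_projective (dualObj S.X₂))
  exact ⟨extEquivRight h2 U b (hW U hU b hb) (hW U hU _ (Nat.succ_pos b))⟩

theorem ext_dual_syzygy_of_orth {n : ℕ} {M Y : ModuleCat.{u} R} (h : Syz (n + 1) M Y)
    (hO : IsOrth (dualObj M))
    (hM : ∀ i, 0 < i → i < n + 1 → Subsingleton (Abelian.Ext M (unitMod R) i))
    {U : ModuleCat.{u} R} (hU : IsGProj U) (b : ℕ) (hb : 0 < b) :
    Nonempty (Abelian.Ext U (dualObj Y) b ≃ₗ[R] Abelian.Ext U (extDual (n + 1) M) b) := by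
  induction n generalizing M with
  | zero =>
    obtain ⟨S, hS, rfl, hP, hPf, ⟨e⟩⟩ := h
    obtain ⟨f⟩ := ext_dual_syzygy_one hS hO hU b hb
    exact ⟨(extIsoRight U (dualIso e.symm) b).trans f⟩
  | succ n ih =>
    obtain ⟨S, hS, rfl, hP, hPf, h⟩ := h
    have hD := dualComplex_shortExact hS (hM 1 one_pos (by omega))
    have hO' : IsOrth (dualObj S.X₁) :=
      IsOrth.quotient hD hO (isOrth_of_projective (dualObj S.X₂))
    obtain ⟨e⟩ := ih h hO' fun i h0 hi => subsingleton_ext_X₁ hS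
      (subsingleton_ext_of_projective _ _ h0) (hM (i + 1) (Nat.succ_pos i) (by omega))
    exact ⟨e.trans (extIsoRight U (LinearEquiv.toModuleIso
      (extShiftLeft hS (unitMod R) (n + 1) (subsingleton_ext_of_projective _ _ (by omega))
        (subsingleton_ext_of_projective _ _ (by omega)))) b)⟩

theorem ext_dual_syzygy {n : ℕ} {M Y : ModuleCat.{u} R} (h : Syz n M Y)
    (hM : ∀ i, i < n → Subsingleton (Abelian.Ext M (unitMod R) i))
    {U : ModuleCat.{u} R} (hU : IsGProj U) (b : ℕ) (hb : 0 < b) :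
    Nonempty (Abelian.Ext U (dualObj Y) b ≃ₗ[R] Abelian.Ext U (extDual n M) b) := by
  cases n with
  | zero =>
    obtain ⟨e⟩ := h
    exact ⟨extIsoRight U ((dualIso e.symm).trans (extZeroEquivDual M).symm.toModuleIso) b⟩
  | succ n =>
    have := hM 0 (by omega)
    have : Subsingleton (dualObj M) := (extZeroEquivDual M).symm.toEquiv.subsingleton
    exact ext_dual_syzygy_of_orth h (isOrth_of_subsingleton _) (fun i _ hi => hM i hi) hU b hb

variable [IsNoetherianRing R]

theorem exists_syz (p : ℕ) (M : ModuleCat.{u} R) [Module.Finite R M] :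
    ∃ X, Syz p M X ∧ Module.Finite R X := by
  induction p generalizing M with
  | zero => exact ⟨M, Syz.refl M, inferInstance⟩
  | succ p ih =>
    obtain ⟨S, hS, rfl, hP, hPf, hf⟩ := exists_syzygy M
    obtain ⟨X, hX, hXf⟩ := ih S.X₁
    exact ⟨X, ⟨S, hS, rfl, hP, hPf, hX⟩, hXf⟩

theorem Syz.finite {p : ℕ} {M X : ModuleCat.{u} R} (h : Syz p M X) [Module.Finite R M] :
    Module.Finite R X := by
  induction p generalizing M with
  | zero =>
    obtain ⟨e⟩ := h
    exact Module.Finite.equiv e.toLinearEquiv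
  | succ p ih =>
    obtain ⟨S, hS, rfl, hP, hPf, h⟩ := h
    have : Module.Finite R S.X₁ :=
      Module.Finite.of_injective S.f.hom (injective_of_shortExact hS)
    exact ih h

theorem Syz.isGProj_of_vanishing {p : ℕ} {M X : ModuleCat.{u} R} (h : Syz p M X)
    [Module.Finite R M] (hM : ∀ i, p < i → Subsingleton (Abelian.Ext M (unitMod R) i)) :
    IsGProj X where
  finite := h.finite
  ext_zero i hi := by
    obtain ⟨e⟩ := h.nonempty_ext (unitMod R) i hi
    have := hM (i + p) (by omega)
    exact e.toEquiv.subsingleton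

theorem Syz.isGProj {p : ℕ} {M X : ModuleCat.{u} R} (h : Syz p M X) (hM : IsGProj M) :
    IsGProj X :=
  have := hM.finite
  h.isGProj_of_vanishing fun i hi => hM.ext_zero i (by omega)

theorem Syz.nonempty_ext_dual {p : ℕ} {M X : ModuleCat.{u} R} (h : Syz p M X) (hM : IsGProj M)
    {U : ModuleCat.{u} R} (hU : IsGProj U) (j : ℕ) (hj : 0 < j) :
    Nonempty (Abelian.Ext U (dualObj X) j ≃ₗ[R] Abelian.Ext U (dualObj M) (j + p)) := by
  induction p generalizing M with
  | zero =>
    obtain ⟨e⟩ := h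
    exact ⟨extIsoRight U (dualIso e.symm) j⟩
  | succ p ih =>
    obtain ⟨S, hS, rfl, hP, hPf, h⟩ := h
    obtain ⟨e⟩ := ih h (hM.syzygy hS)
    have hD := dualComplex_shortExact hS (hM.ext_zero 1 one_pos)
    have hO := isOrth_of_projective (dualObj S.X₂) U hU
    exact ⟨e.trans (extShiftRight hD U (j + p) (hO _ (by omega)) (hO _ (by omega)))⟩

/-- `Ext^i(M, R) = 0` for all `i ≠ n`, with `M` finite. -/
structure IsCM (n : ℕ) (M : ModuleCat.{u} R) : Prop where
  finite : Module.Finite R M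
  ext_zero : ∀ i, i ≠ n → Subsingleton (Abelian.Ext M (unitMod R) i)

theorem nonempty_ext_extDual {n p q : ℕ} {M Z X : ModuleCat.{u} R} (hM : IsCM n M)
    (hZ : IsGProj Z) (hMX : Syz (n + q) M X) (hZX : Syz p Z X) {U : ModuleCat.{u} R}
    (hU : IsGProj U) (j : ℕ) (hj : 0 < j) :
    Nonempty (Abelian.Ext U (extDual n M) (j + q) ≃ₗ[R] Abelian.Ext U (dualObj Z) (j + p)) := by
  have := hM.finite
  obtain ⟨Y, hMY, hYX⟩ := hMX.split
  obtain ⟨e₁⟩ := ext_dual_syzygy hMY (fun i hi => hM.ext_zero i hi.ne) hU (j + q) (by omega)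
  obtain ⟨e₂⟩ := hYX.nonempty_ext_dual
    (hMY.isGProj_of_vanishing fun i hi => hM.ext_zero i hi.ne') hU j hj
  obtain ⟨e₃⟩ := hZX.nonempty_ext_dual hZ hU j hj
  exact ⟨e₁.symm.trans (e₂.symm.trans e₃)⟩

theorem nonempty_ext_swap {n p q n' p' q' : ℕ} {M Z X M' Z' X' : ModuleCat.{u} R}
    (hM : IsCM n M) (hZ : IsGProj Z) (hMX : Syz (n + q) M X) (hZX : Syz p Z X)
    (hM' : IsCM n' M') (hZ' : IsGProj Z') (hMX' : Syz (n' + q') M' X') (hZX' : Syz p' Z' X')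
    {j j' : ℕ} (hj : 0 < j) (hj' : 0 < j') (h : j' + p' = j + p) :
    Nonempty (Abelian.Ext Z (extDual n' M') (j' + q') ≃ₗ[R]
      Abelian.Ext Z' (extDual n M) (j + q)) := by
  obtain ⟨e₁⟩ := nonempty_ext_extDual hM' hZ' hMX' hZX' hZ j' hj'
  obtain ⟨e₂⟩ := nonempty_ext_extDual hM hZ hMX hZX hZ' j hj
  obtain ⟨s, hs⟩ : ∃ s, j + p = s + 1 := ⟨j + p - 1, by omega⟩
  obtain ⟨e⟩ := swap_ext hZ hZ' s
  exact ⟨e₁.trans ((extCast _ _ (h.trans hs)).trans (e.trans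
    ((extCast _ _ hs.symm).trans e₂.symm)))⟩

theorem IsGProj.exists_cosyz (hR : FiniteSelfInj R) {X : ModuleCat.{u} R} (hX : IsGProj X)
    (p : ℕ) : ∃ Z, IsGProj Z ∧ Syz p Z X := by
  induction p with
  | zero => exact ⟨X, hX, Syz.refl X⟩
  | succ p ih =>
    obtain ⟨Z, hZ, h⟩ := ih
    obtain ⟨S, hS, rfl, hP, hPf, h3, _⟩ := hZ.exists_cosyzygy hR
    exact ⟨S.X₃, h3, S, hS, rfl, hP, hPf, h⟩

end Syz

end Linkage

namespace Linkage

open Abelian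

section Homology

variable {R : Type u} [CommRing R]

/-- The sequence `0 → coker f → C → coker g → 0` attached to `A → B → C`. -/
abbrev cokernelComplex {A B C : ModuleCat.{u} R} (f : A ⟶ B) (g : B ⟶ C) (w : f ≫ g = 0) :
    ShortComplex (ModuleCat.{u} R) :=
  ShortComplex.mk (cokernel.desc f g w) (cokernel.π g) (by
    rw [← cancel_epi (cokernel.π f)]
    simp)

theorem cokernelComplex_shortExact {A B C : ModuleCat.{u} R} {f : A ⟶ B} {g : B ⟶ C}
    {w : f ≫ g = 0} (hS : (ShortComplex.mk f g w).Exact) :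
    (cokernelComplex f g w).ShortExact where
  mono_f := (ShortComplex.mk f g w).exact_iff_mono_cokernel_desc.1 hS
  epi_g := by dsimp; infer_instance
  exact := by
    have h := ShortComplex.exact_cokernel g
    let α : ShortComplex.mk g (cokernel.π g) (by simp) ⟶ cokernelComplex f g w :=
      { τ₁ := cokernel.π f, τ₂ := 𝟙 _, τ₃ := 𝟙 _ }
    have : Epi α.τ₁ := by dsimp [α]; infer_instance
    have : IsIso α.τ₂ := by dsimp [α]; infer_instance
    have : Mono α.τ₃ := by dsimp [α]; infer_instance
    exact (ShortComplex.exact_iff_of_epi_of_isIso_of_mono α).1 h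

theorem nonempty_homology_equiv (S : ShortComplex (ModuleCat.{u} R)) {B E : Type u}
    [AddCommGroup B] [Module R B] [AddCommGroup E] [Module R E]
    (e : B ≃ₗ[R] LinearMap.ker S.g.hom) (φ : B →ₗ[R] E) (hφ : Function.Surjective φ)
    (h : ∀ b, φ b = 0 ↔ ∃ y, S.f y = (e b).1) : Nonempty (S.homology ≃ₗ[R] E) := by
  obtain ⟨f⟩ := nonempty_linearEquiv_of_ker φ
    (Submodule.mkQ (LinearMap.range S.moduleCatToCycles)) e hφ (Submodule.mkQ_surjective _) (by
      intro x
      rw [h]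
      change _ ↔ Submodule.Quotient.mk (e x) = 0
      rw [Submodule.Quotient.mk_eq_zero]
      constructor
      · rintro ⟨y, hy⟩
        exact ⟨y, Subtype.ext hy⟩
      · rintro ⟨y, hy⟩
        exact ⟨y, congrArg Subtype.val hy⟩)
  exact ⟨S.moduleCatHomologyIso.toLinearEquiv.trans f.symm⟩

theorem nonempty_homology_linearYoneda {α : Type} [AddRightCancelSemigroup α] [One α]
    (K : ChainComplex (ModuleCat.{u} R) α) (V : ModuleCat.{u} R) {i j k : α}
    (hi : (ComplexShape.up α).prev j = i) (hk : (ComplexShape.up α).next j = k)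
    [Projective (K.X i)] (hK : (ShortComplex.mk (K.d k j) (K.d j i) (K.d_comp_d k j i)).Exact) :
    Nonempty ((K.linearYonedaObj R V).homology j ≃ₗ[R]
      Abelian.Ext (cokernel (K.d j i)) V 1) := by
  have hS := cokernelComplex_shortExact hK
  let p : (cokernel (K.d k j) ⟶ V) →ₗ[R]
      LinearMap.ker (((K.linearYonedaObj R V).sc' i j k).g.hom) :=
    { toFun := fun h => ⟨(cokernel.π (K.d k j) ≫ h : K.X j ⟶ V), by
        change K.d k j ≫ cokernel.π (K.d k j) ≫ h = 0
        rw [cokernel.condition_assoc, zero_comp]⟩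
      map_add' := fun a b => Subtype.ext (Preadditive.comp_add _ _ _ _ _ _)
      map_smul' := fun a b => Subtype.ext (Linear.comp_smul _ _ _ _ _ _) }
  have hp : Function.Bijective p := by
    constructor
    · intro a b h
      rw [← cancel_epi (cokernel.π (K.d k j))]
      exact congrArg Subtype.val h
    · rintro ⟨h, hh⟩
      exact ⟨cokernel.desc (K.d k j) (show K.X j ⟶ V from h) hh,
        Subtype.ext (cokernel.π_desc _ _ _)⟩
  obtain ⟨f⟩ := nonempty_homology_equiv ((K.linearYonedaObj R V).sc' i j k)
    (LinearEquiv.ofBijective p hp) (homToExtOne hS V)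
    (homToExtOne_surjective hS V (subsingleton_ext_of_projective _ _ one_pos)) (by
      intro h
      refine (homToExtOne_eq_zero_iff hS V h).trans (exists_congr fun ψ => ?_)
      rw [← cancel_epi (cokernel.π (K.d k j)), cokernel.π_desc_assoc]
      exact Iff.rfl)
  exact ⟨((K.linearYonedaObj R V).homologyIsoSc' i j k hi hk).toLinearEquiv.trans f⟩

/-- In an exact sequence `A → B → C → 0`, the module `C` is the cokernel of `A → B`. -/
def cokernelIsoOfExact {S : ShortComplex (ModuleCat.{u} R)} (hS : S.Exact) [Epi S.g] :
    cokernel S.f ≅ S.X₃ :=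
  (cokernelIsCokernel S.f).coconePointUniqueUpToIso hS.gIsCokernel

theorem nonempty_extMod_succ (M V : ModuleCat.{u} R) (i : ℕ) :
    Nonempty (ExtMod R (i + 1) M V ≃ₗ[R] Abelian.Ext M V (i + 1)) := by
  let P := projectiveResolution M
  have hP : ∀ t, Projective (P.complex.X t) := P.projective
  obtain ⟨f⟩ := nonempty_homology_linearYoneda P.complex V (i := i) (j := i + 1) (k := i + 2)
    (by simp) (by simp) (P.exact_succ i)
  have shift : ∀ t j, Nonempty (Abelian.Ext (cokernel (P.complex.d (t + 1) t)) V (j + 1) ≃ₗ[R]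
      Abelian.Ext M V (t + j + 1)) := by
    intro t
    induction t with
    | zero =>
      intro j
      rw [zero_add]
      have : Epi (ShortComplex.mk _ _ P.complex_d_comp_π_f_zero).g := by
        change Epi (P.π.f 0)
        infer_instance
      exact ⟨(extIsoLeft (cokernelIsoOfExact P.exact₀).symm V (j + 1)).trans
        (extCast M V (by omega))⟩
    | succ t ih =>
      intro j
      obtain ⟨e⟩ := ih (j + 1)
      have hS := cokernelComplex_shortExact (P.exact_succ t)
      exact ⟨((extShiftLeft hS V (j + 1) (subsingleton_ext_of_projective _ _ (by omega))
        (subsingleton_ext_of_projective _ _ (by omega))).trans e).trans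
          (extCast _ _ (by omega))⟩
  obtain ⟨g⟩ := shift i 0
  exact ⟨(P.isoExt (R := R) (i + 1) V).toLinearEquiv.trans (f.trans g)⟩

theorem nonempty_extMod_zero (M V : ModuleCat.{u} R) :
    Nonempty (ExtMod R 0 M V ≃ₗ[R] Abelian.Ext M V 0) := by
  let P := projectiveResolution M
  let K := P.complex
  let π : K.X 0 ⟶ M := P.π.f 0
  have hπ : Epi π := by change Epi (P.π.f 0); infer_instance
  have hw : K.d 1 0 ≫ π = 0 := P.complex_d_comp_π_f_zero
  have hex : (ShortComplex.mk _ _ hw).Exact := P.exact₀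
  let p : (M ⟶ V) →ₗ[R] LinearMap.ker (((K.linearYonedaObj R V).sc' 0 0 1).g.hom) :=
    { toFun := fun h => ⟨(π ≫ h : K.X 0 ⟶ V), by
        change K.d 1 0 ≫ π ≫ h = 0
        rw [reassoc_of% hw, zero_comp]⟩
      map_add' := fun a b => Subtype.ext (Preadditive.comp_add _ _ _ _ _ _)
      map_smul' := fun a b => Subtype.ext (Linear.comp_smul _ _ _ _ _ _) }
  have hp : Function.Bijective p := by
    constructor
    · intro a b h
      rw [← cancel_epi π]
      exact congrArg Subtype.val h
    · rintro ⟨h, hh⟩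
      have : Epi (ShortComplex.mk _ _ hw).g := hπ
      refine ⟨hex.desc (show K.X 0 ⟶ V from h) hh, Subtype.ext (hex.g_desc _ _)⟩
  obtain ⟨f⟩ := nonempty_homology_equiv ((K.linearYonedaObj R V).sc' 0 0 1)
    (LinearEquiv.ofBijective p hp) LinearMap.id Function.surjective_id (by
      intro h
      have h0 : ((K.linearYonedaObj R V).sc' 0 0 1).f = 0 :=
        (K.linearYonedaObj R V).shape 0 0 (by simp)
      rw [h0]
      constructor
      · intro hh
        refine ⟨0, ?_⟩
        rw [LinearMap.id_apply] at hh
        rw [hh, map_zero, map_zero]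
        rfl
      · rintro ⟨y, hy⟩
        exact hp.1 (Subtype.ext (hy.symm.trans rfl)))
  exact ⟨(P.isoExt (R := R) 0 V).toLinearEquiv.trans
    ((((K.linearYonedaObj R V).homologyIsoSc' 0 0 1 (by simp) (by simp)).toLinearEquiv.trans f).trans
      (Ext.linearEquiv₀ (R := R)).symm)⟩

theorem nonempty_extMod (M V : ModuleCat.{u} R) (i : ℕ) :
    Nonempty (ExtMod R i M V ≃ₗ[R] Abelian.Ext M V i) := by
  cases i with
  | zero => exact nonempty_extMod_zero M V
  | succ i => exact nonempty_extMod_succ M V i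

theorem isZero_extMod_iff (M V : ModuleCat.{u} R) (i : ℕ) :
    IsZero (ExtMod R i M V) ↔ Subsingleton (Abelian.Ext M V i) := by
  obtain ⟨e⟩ := nonempty_extMod M V i
  rw [ModuleCat.isZero_iff_subsingleton]
  exact e.toEquiv.subsingleton_congr

end Homology

end Linkage

namespace Linkage

open Abelian

section Dimensions

variable {R : Type u} [CommRing R]

theorem subsingleton_ext_of_isZero {X : ModuleCat.{u} R} (hX : IsZero X) (Y : ModuleCat.{u} R)
    (n : ℕ) : Subsingleton (Abelian.Ext X Y n) := by
  refine subsingleton_of_forall_eq 0 fun x => ?_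
  rw [← Ext.mk₀_id_comp x, hX.eq_of_src (𝟙 X) 0, Ext.mk₀_zero, Ext.zero_comp]

theorem subsingleton_ext_to_isZero (X : ModuleCat.{u} R) {Y : ModuleCat.{u} R} (hY : IsZero Y)
    (n : ℕ) : Subsingleton (Abelian.Ext X Y n) := by
  refine subsingleton_of_forall_eq 0 fun x => ?_
  rw [← Ext.comp_mk₀_id x, hY.eq_of_src (𝟙 Y) 0, Ext.mk₀_zero, Ext.comp_zero]

theorem subsingleton_ext_of_resolution {M W : ModuleCat.{u} R}
    (G : ChainComplex (ModuleCat.{u} R) ℕ) (ε : G.X 0 ⟶ M) (hε : Epi ε) (w : G.d 1 0 ≫ ε = 0)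
    (h0 : (ShortComplex.mk (G.d 1 0) ε w).Exact) (hG : ∀ i, 0 < i → G.ExactAt i) {n : ℕ}
    (hn : ∀ i, n < i → IsZero (G.X i))
    (hW : ∀ t i, 0 < i → Subsingleton (Abelian.Ext (G.X t) W i)) (i : ℕ) (hi : n < i) :
    Subsingleton (Abelian.Ext M W i) := by
  have key : ∀ s t i, n < t + s → s ≤ i →
      Subsingleton (Abelian.Ext (cokernel (G.d (t + 1) t)) W i) := by
    intro s
    induction s with
    | zero =>
      intro t i ht _
      refine subsingleton_ext_of_isZero ?_ W i
      exact IsZero.of_epi (cokernel.π (G.d (t + 1) t)) (hn t (by omega))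
    | succ s ih =>
      intro t i ht hi
      obtain ⟨i, rfl⟩ : ∃ i', i = i' + 1 := ⟨i - 1, by omega⟩
      have hex : (ShortComplex.mk (G.d (t + 2) (t + 1)) (G.d (t + 1) t) (G.d_comp_d _ _ _)).Exact :=
        (G.exactAt_iff' (t + 2) (t + 1) t (by simp) (by simp)).1 (hG (t + 1) (by omega))
      exact subsingleton_ext_X₃ (cokernelComplex_shortExact hex) (ih (t + 1) i (by omega) (by omega))
        (hW t (i + 1) (by omega))
  have : Epi (ShortComplex.mk (G.d 1 0) ε w).g := hε
  have e := extIsoLeft (cokernelIsoOfExact h0) W i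
  have := key (n + 1) 0 i (by omega) (by omega)
  exact e.symm.toEquiv.symm.subsingleton

/-- The sequence `0 → ker f → A → ker g → 0` attached to `A → B → C`. -/
abbrev kernelComplex {A B C : ModuleCat.{u} R} (f : A ⟶ B) (g : B ⟶ C) (w : f ≫ g = 0) :
    ShortComplex (ModuleCat.{u} R) :=
  ShortComplex.mk (kernel.ι f) (kernel.lift g f w) (by
    rw [← cancel_mono (kernel.ι g)]
    simp)

theorem kernelComplex_shortExact {A B C : ModuleCat.{u} R} {f : A ⟶ B} {g : B ⟶ C}
    {w : f ≫ g = 0} (hS : (ShortComplex.mk f g w).Exact) :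
    (kernelComplex f g w).ShortExact where
  mono_f := by dsimp; infer_instance
  epi_g := (ShortComplex.mk f g w).exact_iff_epi_kernel_lift.1 hS
  exact := by
    have h := ShortComplex.exact_kernel f
    let α : kernelComplex f g w ⟶ ShortComplex.mk (kernel.ι f) f (by simp) :=
      { τ₁ := 𝟙 _, τ₂ := 𝟙 _, τ₃ := kernel.ι g }
    have : Epi α.τ₁ := by dsimp [α]; infer_instance
    have : IsIso α.τ₂ := by dsimp [α]; infer_instance
    have : Mono α.τ₃ := by dsimp [α]; infer_instance
    exact (ShortComplex.exact_iff_of_epi_of_isIso_of_mono α).2 h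

theorem subsingleton_ext_of_injDimLE {M : ModuleCat.{u} R} {n : ℕ} (h : InjDimLE R M n)
    (V : ModuleCat.{u} R) (i : ℕ) (hi : n < i) : Subsingleton (Abelian.Ext V M i) := by
  obtain ⟨I, ι, hI, hn, hι, ⟨w, h0⟩, hex⟩ := h
  have key : ∀ s t i, n < t + s → s ≤ i →
      Subsingleton (Abelian.Ext V (kernel (I.d t (t + 1))) i) := by
    intro s
    induction s with
    | zero =>
      intro t i ht _
      refine subsingleton_ext_to_isZero V ?_ i
      exact IsZero.of_mono (kernel.ι (I.d t (t + 1))) (hn t (by omega))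
    | succ s ih =>
      intro t i ht hi
      obtain ⟨i, rfl⟩ : ∃ i', i = i' + 1 := ⟨i - 1, by omega⟩
      have hex : (ShortComplex.mk (I.d t (t + 1)) (I.d (t + 1) (t + 2)) (I.d_comp_d _ _ _)).Exact :=
        (I.exactAt_iff' t (t + 1) (t + 2) (by simp) (by simp)).1 (hex (t + 1) (by omega))
      exact subsingleton_ext_to_X₁ (kernelComplex_shortExact hex) (ih (t + 1) i (by omega) (by omega))
        (subsingleton_ext_of_injective _ _ (by omega))
  have : Mono (ShortComplex.mk ι (I.d 0 1) w).f := hι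
  let e : M ≅ kernel (I.d 0 1) :=
    h0.fIsKernel.conePointUniqueUpToIso (limit.isLimit (parallelPair (I.d 0 1) 0))
  have := key (n + 1) 0 i (by omega) (by omega)
  exact (extIsoRight V e i).toEquiv.subsingleton

theorem finiteSelfInj_of_gorenstein (h : IsGorensteinLocalRing R) : FiniteSelfInj R := by
  obtain ⟨n, hn⟩ := h.2.2
  exact ⟨n, fun V _ i hi => subsingleton_ext_of_injDimLE hn V i hi⟩

theorem subsingleton_ext_of_gdimLE {M : ModuleCat.{u} R} {n : ℕ} (h : GDimLE R M n) (i : ℕ)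
    (hi : n < i) : Subsingleton (Abelian.Ext M (unitMod R) i) := by
  obtain ⟨G, ε, hG, hn, hε, ⟨w, h0⟩, hex⟩ := h
  refine subsingleton_ext_of_resolution G ε hε w h0 hex hn (fun t i hi => ?_) i hi
  by_cases ht : t ≤ n
  · exact (isZero_extMod_iff _ _ _).1 ((hG t ht).2.2.1 i hi)
  · exact subsingleton_ext_of_isZero (hn t (by omega)) _ _

theorem subsingleton_ext_of_pdLE {M : ModuleCat.{u} R} {n : ℕ} (h : PdLE R M n)
    (V : ModuleCat.{u} R) (i : ℕ) (hi : n < i) : Subsingleton (Abelian.Ext M V i) := by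
  obtain ⟨G, ε, hG, hn, hε, ⟨w, h0⟩, hex⟩ := h
  exact subsingleton_ext_of_resolution G ε hε w h0 hex hn
    (fun t i hi => have := hG t; subsingleton_ext_of_projective _ _ hi) i hi

theorem isOrth_of_finite_pd [IsNoetherianRing R] {M : ModuleCat.{u} R} [Module.Finite R M] {n : ℕ}
    (h : ∀ V : ModuleCat.{u} R, ∀ i, n < i → Subsingleton (Abelian.Ext M V i)) : IsOrth M := by
  induction n generalizing M with
  | zero =>
    have : HasProjectiveDimensionLT M 1 := by
      rw [hasProjectiveDimensionLT_iff]
      intro i hi Y e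
      have := h Y i hi
      exact Subsingleton.elim _ _
    have : Projective M := projective_iff_hasProjectiveDimensionLT_one.2 this
    exact isOrth_of_projective M
  | succ n ih =>
    obtain ⟨S, hS, rfl, hP, hPf, hf⟩ := exists_syzygy M
    refine IsOrth.quotient hS (ih fun V i hi => ?_) (isOrth_of_projective S.X₂)
    exact subsingleton_ext_X₁ hS (subsingleton_ext_of_projective _ _ (by omega))
      (h V (i + 1) (by omega))

theorem ext_lt_gradeM {M : ModuleCat.{u} R} {n : ℕ} (h : gradeM R M = n) (i : ℕ) (hi : i < n) :
    Subsingleton (Abelian.Ext M (unitMod R) i) := by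
  by_contra hc
  have : gradeM R M ≤ (i : ℕ∞) :=
    sInf_le ⟨i, rfl, fun h => hc ((isZero_extMod_iff _ _ _).1 h)⟩
  rw [h] at this
  exact absurd (by exact_mod_cast this) (not_le.2 hi)

theorem mem_of_sInf_eq {p : ℕ → Prop} {n : ℕ}
    (h : sInf {c : ℕ∞ | ∃ i : ℕ, c = i ∧ p i} = n) : p n := by
  have hne : {c : ℕ∞ | ∃ i : ℕ, c = i ∧ p i}.Nonempty := by
    by_contra hc
    rw [Set.not_nonempty_iff_eq_empty] at hc
    rw [hc, sInf_empty] at h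
    exact ENat.natCast_ne_top n h.symm
  obtain ⟨i, hi, hi'⟩ := csInf_mem hne
  have : (n : ℕ∞) = i := h.symm.trans hi
  rwa [show n = i by exact_mod_cast this]

theorem not_subsingleton_ext_gradeM {M : ModuleCat.{u} R} {n : ℕ} (h : gradeM R M = n) :
    ¬ Subsingleton (Abelian.Ext M (unitMod R) n) := fun hc =>
  mem_of_sInf_eq (p := fun i => ¬ IsZero (ExtMod R i M (ModuleCat.of R R))) h
    ((isZero_extMod_iff _ _ _).2 hc)

theorem subsingleton_ext_of_gradeM_top {M : ModuleCat.{u} R} (h : gradeM R M = ⊤) (i : ℕ) :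
    Subsingleton (Abelian.Ext M (unitMod R) i) := by
  by_contra hc
  have : gradeM R M ≤ (i : ℕ∞) :=
    sInf_le ⟨i, rfl, fun h => hc ((isZero_extMod_iff _ _ _).1 h)⟩
  rw [h] at this
  exact absurd this (by simp)

theorem isCM_of_isGPerfect [IsNoetherianRing R] {M : ModuleCat.{u} R} [Module.Finite R M] {n : ℕ}
    (h₁ : IsGPerfect R M) (h₂ : gdim R M = n) : IsCM n M where
  finite := inferInstance
  ext_zero i hi := by
    rcases lt_or_gt_of_ne hi with h | h
    · exact ext_lt_gradeM (Eq.trans h₁ h₂) i h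
    · exact subsingleton_ext_of_gdimLE (mem_of_sInf_eq h₂) i h

theorem IsGProj.subsingleton [IsNoetherianRing R] (hR : FiniteSelfInj R) {X : ModuleCat.{u} R}
    (hX : IsGProj X) (h : Subsingleton (Abelian.Ext X (unitMod R) 0)) : Subsingleton X := by
  have : Subsingleton (Module.Dual R X) := (extZeroEquivDual X).symm.toEquiv.subsingleton
  have : Subsingleton (Module.Dual R (Module.Dual R X)) :=
    ⟨fun a b => LinearMap.ext fun x => by rw [Subsingleton.elim x 0, map_zero, map_zero]⟩
  exact (hX.eval_bijective hR).1.subsingleton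

theorem exists_grade_of_isPerfectIdeal [IsNoetherianRing R] (hR : FiniteSelfInj R) {c : Ideal R}
    (hc : IsPerfectIdeal R c) [Nontrivial (R ⧸ c)] :
    ∃ g, IsCM g (ModuleCat.of R (R ⧸ c)) ∧ IsOrth (ModuleCat.of R (R ⧸ c)) ∧
      ¬ Subsingleton (Abelian.Ext (ModuleCat.of R (R ⧸ c)) (unitMod R) g) := by
  have hfin : Module.Finite R (ModuleCat.of R (R ⧸ c)) :=
    inferInstanceAs (Module.Finite R (R ⧸ c))
  have hne : gradeM R (ModuleCat.of R (R ⧸ c)) ≠ ⊤ := by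
    intro h
    have hz := subsingleton_ext_of_gradeM_top h
    have hX : IsGProj (ModuleCat.of R (R ⧸ c)) := ⟨hfin, fun i _ => hz i⟩
    have : Subsingleton (R ⧸ c) := hX.subsingleton hR (hz 0)
    exact not_subsingleton (R ⧸ c) this
  obtain ⟨g, hg⟩ := ENat.ne_top_iff_exists.1 hne
  have hp : PdLE R (ModuleCat.of R (R ⧸ c)) g := mem_of_sInf_eq (hc.symm.trans hg.symm)
  refine ⟨g, ⟨hfin, fun i hi => ?_⟩, isOrth_of_finite_pd (subsingleton_ext_of_pdLE hp),
    not_subsingleton_ext_gradeM hg.symm⟩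
  rcases lt_or_gt_of_ne hi with h | h
  · exact ext_lt_gradeM hg.symm i h
  · exact subsingleton_ext_of_pdLE hp _ i h

end Dimensions

end Linkage

namespace Linkage

open Abelian

section Tate

variable {R : Type u} [CommRing R]

theorem exact_of_exactAt {K : ChainComplex (ModuleCat.{u} R) ℤ} (t : ℤ) (h : K.ExactAt (t + 1)) :
    (ShortComplex.mk (K.d (t + 1 + 1) (t + 1)) (K.d (t + 1) t) (K.d_comp_d _ _ _)).Exact :=
  (K.exactAt_iff' (t + 1 + 1) (t + 1) t (by simp) (by simp)).1 h

theorem syz_cokernel {K : ChainComplex (ModuleCat.{u} R) ℤ} (hp : ∀ i, Projective (K.X i))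
    (hf : ∀ i, Module.Finite R (K.X i)) {l : ℤ} (hK : ∀ i, l < i → K.ExactAt i) (p : ℕ) (t s : ℤ)
    (ht : l ≤ t) (hs : s = t + p) :
    Syz p (cokernel (K.d (t + 1) t)) (cokernel (K.d (s + 1) s)) := by
  induction p generalizing t with
  | zero =>
    obtain rfl : s = t := by simpa using hs
    exact Syz.refl _
  | succ p ih =>
    exact ⟨_, cokernelComplex_shortExact (exact_of_exactAt t (hK _ (by omega))), rfl, hp t, hf t,
      ih (t + 1) (by omega) (by push_cast at hs; omega)⟩

variable {M : ModuleCat.{u} R} (C : CompleteResolution R M)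

theorem nonempty_tateExt (V : ModuleCat.{u} R) (t j : ℤ) (p : ℕ) (h : j = t + (p + 1)) :
    Nonempty (TateExt R C V j ≃ₗ[R] Abelian.Ext (cokernel (C.T.d (t + 1) t)) V (p + 1)) := by
  have hp := C.projT
  have hsyz := syz_cokernel C.projT C.fgT (l := t) (fun i _ => C.exactT i) p t (t + p) le_rfl rfl
  obtain ⟨e⟩ := hsyz.nonempty_ext V 1 one_pos
  obtain ⟨f⟩ := nonempty_homology_linearYoneda C.T V (i := t + p) (j := t + p + 1)
    (k := t + p + 1 + 1) (by simp) (by simp) (exact_of_exactAt _ (C.exactT _))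
  obtain rfl : j = t + p + 1 := by omega
  exact ⟨f.trans (e.trans (extCast _ _ (add_comm 1 p)))⟩

theorem isGProj_cokernel_T (t : ℤ) : IsGProj (cokernel (C.T.d (t + 1) t)) where
  finite := by
    have := C.fgT t
    exact Module.Finite.of_surjective (cokernel.π (C.T.d (t + 1) t)).hom
      ((ModuleCat.epi_iff_surjective _).1 inferInstance)
  ext_zero i hi := by
    obtain ⟨p, rfl⟩ : ∃ p, i = p + 1 := ⟨i - 1, by omega⟩
    obtain ⟨e⟩ := nonempty_tateExt C (unitMod R) t (t + (p + 1)) p rfl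
    have h := (C.exactTdual (t + (p + 1))).isZero_homology
    have : Subsingleton (TateExt R C (unitMod R) (t + (p + 1))) :=
      ModuleCat.subsingleton_of_isZero h
    exact e.symm.toEquiv.subsingleton

theorem exists_tate : ∃ s₀ : ℕ, ∀ s : ℕ, s₀ ≤ s → ∀ c : ℕ, ∃ Z X : ModuleCat.{u} R,
    IsGProj Z ∧ Syz (c + s) Z X ∧ Syz s M X ∧ ∀ (V : ModuleCat.{u} R) (j : ℤ) (p : ℕ),
      j + c = p + 1 → Nonempty (TateExt R C V j ≃ₗ[R] Abelian.Ext Z V (p + 1)) := by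
  obtain ⟨n₀, hn₀⟩ := C.iso_eventually
  refine ⟨n₀.toNat, fun s hs c => ⟨cokernel (C.T.d (-c + 1) (-c)),
    cokernel (C.T.d (s + 1) s), isGProj_cokernel_T C _, ?_, ?_, ?_⟩⟩
  · exact syz_cokernel C.projT C.fgT (l := -c) (fun i _ => C.exactT i) (c + s) _ _ le_rfl
      (by push_cast; omega)
  · have h1 := syz_cokernel C.projP C.fgP C.exactP s 0 s le_rfl (by omega)
    have hi : IsIso (C.θ.f s) := hn₀ s (by omega)
    have hi' : IsIso (C.θ.f (s + 1)) := hn₀ (s + 1) (by omega)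
    let e : cokernel (C.T.d (s + 1) s) ≅ cokernel (C.P.d (s + 1) s) :=
      cokernel.mapIso _ _ (asIso (C.θ.f (s + 1))) (asIso (C.θ.f s)) (by simp)
    have hepi : Epi (ShortComplex.mk (C.P.d 1 0) C.π C.wπ).g := C.epiπ
    exact (h1.of_iso_left (cokernelIsoOfExact C.exact0)).trans (q := 0) ⟨e.symm⟩
  · intro V j p h
    exact nonempty_tateExt C V (-c) j p (by omega)

end Tate

end Linkage

namespace Linkage

open Abelian

section InjRank

variable {R : Type u} [CommRing R]

open IsLocalRing RingTheory.Sequence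

theorem eq_bot_of_le_maximalIdeal_smul [IsLocalRing R] {E : Type*} [AddCommGroup E] [Module R E] [Module.Finite R E]
    (h : (⊤ : Submodule R E) ≤ maximalIdeal R • ⊤) : Subsingleton E := by
  have := Submodule.eq_bot_of_le_smul_of_le_jacobson_bot (maximalIdeal R) (⊤ : Submodule R E)
    Module.Finite.fg_top h (maximalIdeal_le_jacobson _)
  exact subsingleton_of_forall_eq 0 fun x => (Submodule.eq_bot_iff _).1 this x trivial

instance finite_quotSMulTop (V : ModuleCat.{u} R) [Module.Finite R V] (x : R) :
    Module.Finite R (ModuleCat.of R (QuotSMulTop x V)) :=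
  inferInstanceAs (Module.Finite R (QuotSMulTop x V))

theorem mk₀_smul_id_comp {V Y : ModuleCat.{u} R} (x : R) {i : ℕ} (ζ : Abelian.Ext V Y i) :
    (Ext.mk₀ (x • 𝟙 V)).comp ζ (zero_add i) = x • ζ := by
  rw [Ext.mk₀_smul, Ext.smul_comp, Ext.mk₀_id_comp]

variable [IsLocalRing R] [IsNoetherianRing R]

/-- Surjectivity of multiplication by a regular element on `Ext`, and Nakayama's lemma. -/
theorem subsingleton_ext_of_quotSMulTop {V : ModuleCat.{u} R} [Module.Finite R V]
    {x : R} (hx : x ∈ maximalIdeal R) (hreg : IsSMulRegular V x) {Y : ModuleCat.{u} R}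
    [Module.Finite R Y] {i : ℕ}
    (h : Subsingleton (Abelian.Ext (ModuleCat.of R (QuotSMulTop x V)) Y (i + 1))) :
    Subsingleton (Abelian.Ext V Y i) := by
  have hS := hreg.smulShortComplex_shortExact
  refine eq_bot_of_le_maximalIdeal_smul (R := R) fun ξ _ => ?_
  obtain ⟨ζ, hζ⟩ := Ext.contravariant_sequence_exact₁ hS Y (n₀ := i) ξ (add_comm 1 i)
    (Subsingleton.elim (α := Abelian.Ext (ModuleCat.of R (QuotSMulTop x V)) Y (i + 1)) _ _)
  have hζ' : x • (ζ : Abelian.Ext V Y i) = ξ := (mk₀_smul_id_comp x _).symm.trans hζ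
  rw [← hζ']
  exact Submodule.smul_mem_smul hx trivial

/-- The injective dimension of `R`, tested on finite modules, is exactly `e`. -/
structure InjRank (R : Type u) [CommRing R] [IsLocalRing R] (e : ℕ) : Prop where
  ext_residue : ¬ Subsingleton (Abelian.Ext (ModuleCat.of R (ResidueField R)) (unitMod R) e)
  ext_zero : ∀ V : ModuleCat.{u} R, Module.Finite R V → ∀ i, e < i →
    Subsingleton (Abelian.Ext V (unitMod R) i)

instance : Module.Finite R (unitMod R) := inferInstanceAs (Module.Finite R R)

theorem subsingleton_ext_of_residue {e : ℕ}
    (h : ∀ V : ModuleCat.{u} R, Module.Finite R V → Subsingleton (Abelian.Ext V (unitMod R) (e + 1)))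
    (hk : Subsingleton (Abelian.Ext (ModuleCat.of R (ResidueField R)) (unitMod R) e))
    (V : ModuleCat.{u} R) (hV : Module.Finite R V) :
    Subsingleton (Abelian.Ext V (unitMod R) e) := by
  refine IsNoetherianRing.induction_on_isQuotientEquivQuotientPrime R (M := V) hV
    (motive := fun N _ _ _ => Subsingleton (Abelian.Ext (ModuleCat.of R N) (unitMod R) e)) ?_ ?_ ?_
  · intro N _ _ _ _
    exact subsingleton_ext_of_isZero (ModuleCat.isZero_iff_subsingleton.2 ‹_›) _ _
  · intro N _ _ _ p eN
    suffices Subsingleton (Abelian.Ext (ModuleCat.of R (R ⧸ p.1)) (unitMod R) e) from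
      (extIsoLeft eN.toModuleIso (unitMod R) e).symm.toEquiv.subsingleton
    have hp : p.1 ≤ maximalIdeal R := le_maximalIdeal p.2.ne_top
    by_cases hpm : p.1 = maximalIdeal R
    · rw [hpm]; exact hk
    · obtain ⟨x, hx, hxp⟩ := SetLike.exists_of_lt (lt_of_le_of_ne hp hpm)
      have : Module.Finite R (ModuleCat.of R (R ⧸ p.1)) := inferInstanceAs (Module.Finite R (R ⧸ p.1))
      refine subsingleton_ext_of_quotSMulTop (V := ModuleCat.of R (R ⧸ p.1)) hx ?_
        (h _ inferInstance)
      intro a b hab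
      obtain ⟨a, rfl⟩ := Ideal.Quotient.mk_surjective a
      obtain ⟨b, rfl⟩ := Ideal.Quotient.mk_surjective b
      have hab' : Ideal.Quotient.mk p.1 (x * a) = Ideal.Quotient.mk p.1 (x * b) := hab
      rw [Ideal.Quotient.eq, ← mul_sub] at hab'
      exact Ideal.Quotient.eq.2 ((p.2.mem_or_mem hab').resolve_left hxp)
  · intro N₁ _ _ _ N₂ _ _ _ N₃ _ _ _ f g hf hg hfg h₁ h₃
    exact subsingleton_ext_X₂ (S := ShortComplex.mk (ModuleCat.ofHom f) (ModuleCat.ofHom g)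
      (by ext x; exact hfg.apply_apply_eq_zero x))
      (shortExact_of_linear _ hf (fun x hx => (hfg x).1 hx) hg) h₁ h₃

theorem exists_injRank (hR : FiniteSelfInj R) : ∃ e, InjRank R e := by
  classical
  have hex : ∃ t : ℕ, ∀ V : ModuleCat.{u} R, Module.Finite R V → ∀ i, t ≤ i →
      Subsingleton (Abelian.Ext V (unitMod R) i) := by
    obtain ⟨r, hr⟩ := hR
    exact ⟨r + 1, fun V hV i hi => hr V hV i hi⟩
  have hspec := Nat.find_spec hex
  obtain ⟨e, he⟩ | h0 : (∃ e, Nat.find hex = e + 1) ∨ Nat.find hex = 0 := by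
    rcases Nat.find hex with _ | e
    · exact Or.inr rfl
    · exact Or.inl ⟨e, rfl⟩
  · rw [he] at hspec
    refine ⟨e, fun hk => ?_, fun V hV i hi => hspec V hV i hi⟩
    refine Nat.find_min hex (m := e) (by omega) fun V hV i hi => ?_
    rcases hi.eq_or_lt with rfl | hi
    · exact subsingleton_ext_of_residue (fun V hV => hspec V hV _ le_rfl) hk V hV
    · exact hspec V hV i hi
  · exfalso
    have h1 := hspec (unitMod R) inferInstance 0 h0.le
    have h2 : Subsingleton (Module.Dual R R) :=
      (extZeroEquivDual (unitMod R)).symm.toEquiv.subsingleton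
    exact one_ne_zero (LinearMap.congr_fun (Subsingleton.elim (LinearMap.id : R →ₗ[R] R) 0) 1)

namespace InjRank

variable {e : ℕ} (he : InjRank R e)

include he

theorem add_length_le {V : ModuleCat.{u} R} [Module.Finite R V] {rs : List R}
    (hrs : ∀ r ∈ rs, r ∈ maximalIdeal R) (hreg : IsWeaklyRegular V rs) {q : ℕ}
    (hq : ¬ Subsingleton (Abelian.Ext V (unitMod R) q)) : q + rs.length ≤ e := by
  induction rs generalizing V q with
  | nil =>
    by_contra h
    exact hq (he.ext_zero V inferInstance q (by simpa using h))
  | cons x rs ih =>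
    rw [isWeaklyRegular_cons_iff] at hreg
    have := ih (V := ModuleCat.of R (QuotSMulTop x V)) (q := q + 1)
      (fun r hr => hrs r (List.mem_cons_of_mem _ hr)) hreg.2
      (fun h => hq (subsingleton_ext_of_quotSMulTop (hrs x List.mem_cons_self) hreg.1 h))
    simp only [List.length_cons]
    omega

theorem exists_isSMulRegular {V : ModuleCat.{u} R} [Module.Finite R V]
    (hV : Subsingleton (Abelian.Ext V (unitMod R) e)) :
    ∃ x ∈ maximalIdeal R, IsSMulRegular V x := by
  have : Subsingleton (ResidueField R →ₗ[R] V) := by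
    refine subsingleton_of_forall_eq 0 fun f => ?_
    by_contra hf
    have hinj : Function.Injective f := by
      have : IsSimpleModule R (ResidueField R) :=
        isSimpleModule_iff_isCoatom.2 (maximalIdeal.isMaximal R).out
      exact (LinearMap.injective_or_eq_zero f).resolve_right hf
    refine he.ext_residue ?_
    refine subsingleton_ext_X₁ (S := ShortComplex.mk (ModuleCat.ofHom f)
      (ModuleCat.ofHom (LinearMap.range f).mkQ) ?_) (shortExact_of_linear _ hinj ?_ ?_) hV
      (he.ext_zero (ModuleCat.of R (V ⧸ LinearMap.range f)) ?_ _ (Nat.lt_succ_self e))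
    · ext x; simp
    · intro x hx
      exact (Submodule.Quotient.mk_eq_zero _).1 hx
    · exact Submodule.mkQ_surjective _
    · exact inferInstanceAs (Module.Finite R (V ⧸ LinearMap.range f))
  obtain ⟨x, hx, hreg⟩ := IsSMulRegular.subsingleton_linearMap_iff.1 this
  refine ⟨x, ?_, hreg⟩
  have : Module.annihilator R (ResidueField R) = maximalIdeal R :=
    Ideal.annihilator_quotient
  rwa [this] at hx

theorem exists_isRegular {V : ModuleCat.{u} R} [Module.Finite R V] [Nontrivial V] {q l : ℕ}
    (hl : q + l ≤ e)
    (hV : ∀ i, q < i → Subsingleton (Abelian.Ext V (unitMod R) i)) :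
    ∃ rs : List R, rs.length = l ∧ (∀ r ∈ rs, r ∈ maximalIdeal R) ∧ IsRegular V rs := by
  induction l generalizing V q with
  | zero => exact ⟨[], rfl, by simp, IsRegular.nil R V⟩
  | succ l ih =>
    obtain ⟨x, hx, hreg⟩ := he.exists_isSMulRegular (V := V) (hV e (by omega))
    have : Nontrivial (ModuleCat.of R (QuotSMulTop x V)) :=
      nontrivial_quotSMulTop_of_mem_maximalIdeal V hx
    obtain ⟨rs, hlen, hmem, hrs⟩ := ih (V := ModuleCat.of R (QuotSMulTop x V)) (q := q + 1)
      (by omega) (fun i hi => by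
        obtain ⟨i, rfl⟩ : ∃ j, i = j + 1 := ⟨i - 1, by omega⟩
        exact subsingleton_ext_X₃ hreg.smulShortComplex_shortExact (hV i (by omega))
          (hV (i + 1) (by omega)))
    refine ⟨x :: rs, by simp [hlen], ?_, (isRegular_cons_iff _ _ _).2 ⟨hreg, hrs⟩⟩
    exact List.forall_mem_cons.2 ⟨hx, hmem⟩

theorem moduleDepth_eq {V : ModuleCat.{u} R} [Nontrivial V] {n : ℕ}
    (hV : IsCM n V) (hn : ¬ Subsingleton (Abelian.Ext V (unitMod R) n)) :
    n ≤ e ∧ moduleDepth R V = ((e - n : ℕ) : ℕ∞) := by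
  have := hV.finite
  have hne : n ≤ e := by
    by_contra h
    exact hn (he.ext_zero V inferInstance n (by omega))
  refine ⟨hne, le_antisymm (sSup_le ?_) (le_sSup ?_)⟩
  · rintro _ ⟨rs, rfl, hmem, hreg⟩
    have := he.add_length_le hmem hreg.toIsWeaklyRegular hn
    exact_mod_cast (by omega : rs.length ≤ e - n)
  · obtain ⟨rs, hlen, hmem, hreg⟩ := he.exists_isRegular (V := V) (q := n) (l := e - n) (by omega)
      (fun i hi => hV.ext_zero i hi.ne')
    exact ⟨rs, by rw [hlen], hmem, hreg⟩

theorem exists_isRegular_self :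
    ∃ rs : List R, rs.length = e ∧ (∀ r ∈ rs, r ∈ maximalIdeal R) ∧ IsRegular R rs := by
  have : Nontrivial (unitMod R) := inferInstanceAs (Nontrivial R)
  refine he.exists_isRegular (V := unitMod R) (q := 0) (l := e) (by omega) fun i hi => ?_
  have : Projective (unitMod R) :=
    (IsProjective.iff_projective (unitMod R)).1 (inferInstanceAs (Module.Projective R R))
  exact subsingleton_ext_of_projective _ _ hi

theorem le_dim {d : ℕ} (hd : ringKrullDim R = d) : e ≤ d := by
  obtain ⟨rs, hlen, hmem, hreg⟩ := he.exists_isRegular_self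
  have h := ringKrullDim_add_length_eq_ringKrullDim_of_isRegular rs hreg
  have : Nontrivial (R ⧸ Ideal.ofList rs) := by
    refine Ideal.Quotient.nontrivial_iff.2 fun h => ?_
    have : Ideal.ofList rs ≤ maximalIdeal R := by
      rw [Ideal.ofList, Ideal.span_le]; exact hmem
    rw [h] at this
    exact (maximalIdeal.isMaximal R).ne_top (top_le_iff.1 this)
  have h0 : 0 ≤ ringKrullDim (R ⧸ Ideal.ofList rs) := ringKrullDim_nonneg_of_nontrivial
  rw [hlen, hd] at h
  have : ((e : ℕ) : WithBot ℕ∞) ≤ d := by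
    rw [← h]; exact le_add_of_nonneg_left h0
  exact_mod_cast this

theorem isCM_residue : IsCM e (ModuleCat.of R (ResidueField R)) where
  finite := inferInstanceAs (Module.Finite R (R ⧸ maximalIdeal R))
  ext_zero i hi := by
    have hfin : Module.Finite R (ModuleCat.of R (ResidueField R)) :=
      inferInstanceAs (Module.Finite R (R ⧸ maximalIdeal R))
    rcases lt_or_gt_of_ne hi with h | h
    · obtain ⟨rs, hlen, hmem, hreg⟩ := he.exists_isRegular_self
      refine ModuleCat.subsingleton_ext_of_exists_isRegular (maximalIdeal R)
        (ModuleCat.of R (ResidueField R)) ?_ (unitMod R) ?_ rs hmem hreg i (hlen ▸ h)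
      · rw [Module.support_eq_zeroLocus]
        exact (congrArg (fun I : Ideal R => PrimeSpectrum.zeroLocus (I : Set R))
          (Ideal.annihilator_quotient (I := maximalIdeal R))).subset
      · change maximalIdeal R • (⊤ : Submodule R R) < ⊤
        rw [smul_eq_mul, Ideal.mul_top]
        exact (maximalIdeal.isMaximal R).ne_top.lt_top
    · exact he.ext_zero _ hfin i h

end InjRank

end InjRank

end Linkage

namespace Linkage

open Abelian IsLocalRing

section Pi

variable {R : Type u} [CommRing R] (W : ModuleCat.{u} R) (t : ℕ)

/-- The `j`-th coordinate inclusion `W ⟶ W^t`. -/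
def piIncl (j : Fin t) : W ⟶ ModuleCat.of R (Fin t → W) :=
  ModuleCat.ofHom (LinearMap.single R (fun _ : Fin t => W) j)

/-- The `j`-th coordinate projection `W^t ⟶ W`. -/
def piProj (j : Fin t) : ModuleCat.of R (Fin t → W) ⟶ W :=
  ModuleCat.ofHom (LinearMap.proj j)

theorem piIncl_piProj (i j : Fin t) :
    piIncl W t i ≫ piProj W t j = if i = j then 𝟙 W else 0 := by
  ext x
  change (Pi.single i x : Fin t → W) j = _
  split_ifs with h
  · subst h; simp
  · rw [Pi.single_eq_of_ne (Ne.symm h)]; rfl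

theorem sum_piProj_piIncl : ∑ j, piProj W t j ≫ piIncl W t j = 𝟙 _ := by
  refine ModuleCat.hom_ext (LinearMap.ext fun x => ?_)
  rw [ModuleCat.hom_sum, LinearMap.sum_apply]
  exact Finset.univ_sum_single (M := fun _ : Fin t => W) x

variable (Y : ModuleCat.{u} R) (i : ℕ)

theorem sum_comp_ext (ξ : Abelian.Ext (ModuleCat.of R (Fin t → W)) Y i) :
    ∑ j, (Ext.mk₀ (piProj W t j)).comp ((Ext.mk₀ (piIncl W t j)).comp ξ (zero_add i))
      (zero_add i) = ξ := by
  calc _ = ∑ j, (Ext.mk₀ (piProj W t j ≫ piIncl W t j)).comp ξ (zero_add i) := by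
        refine Finset.sum_congr rfl fun j _ => ?_
        rw [Ext.mk₀_comp_mk₀_assoc]
    _ = ((Ext.bilinearComp _ _ _ 0 i i (zero_add i)).flip ξ)
          (∑ j, Ext.mk₀ (piProj W t j ≫ piIncl W t j)) := by
        rw [map_sum]; rfl
    _ = _ := by
        rw [← Ext.mk₀_sum, sum_piProj_piIncl]
        exact Ext.mk₀_id_comp ξ

/-- `Ext` turns finite powers in the first variable into finite powers. -/
def extPi : Abelian.Ext (ModuleCat.of R (Fin t → W)) Y i ≃ₗ[R] (Fin t → Abelian.Ext W Y i) :=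
  LinearEquiv.ofLinearMap
    (LinearMap.pi fun j => (Ext.mk₀ (piIncl W t j)).precompOfLinear R Y (zero_add i))
    (∑ j, ((Ext.mk₀ (piProj W t j)).precompOfLinear R Y (zero_add i)) ∘ₗ LinearMap.proj j)
    (by
      refine LinearMap.ext fun f => funext fun k => ?_
      simp only [LinearMap.comp_apply, LinearMap.sum_apply, LinearMap.pi_apply, map_sum,
        LinearMap.proj_apply, LinearMap.id_apply]
      rw [Finset.sum_eq_single k]
      · simp [piIncl_piProj]
      · intro j _ hj
        simp [piIncl_piProj, Ne.symm hj]
      · simp)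
    (by
      ext1 ξ
      simp only [LinearMap.comp_apply, LinearMap.sum_apply]
      exact sum_comp_ext W t Y i ξ)

end Pi

section Socle

variable {R : Type u} [CommRing R] [IsLocalRing R]

theorem length_quotient_eq_of_ker_le {E E' : Type*} [AddCommGroup E] [Module R E] [AddCommGroup E']
    [Module R E'] (φ : E →ₗ[R] E') (hφ : Function.Surjective φ)
    (hker : LinearMap.ker φ ≤ maximalIdeal R • ⊤) :
    Module.length R (E ⧸ (maximalIdeal R • ⊤ : Submodule R E)) =
      Module.length R (E' ⧸ (maximalIdeal R • ⊤ : Submodule R E')) := by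
  have h : LinearMap.ker ((maximalIdeal R • ⊤ : Submodule R E').mkQ ∘ₗ φ) =
      maximalIdeal R • ⊤ := by
    rw [LinearMap.ker_comp, Submodule.ker_mkQ, Submodule.comap_smul_top_of_surjective _ _ hφ,
      sup_eq_left.2 hker]
  exact ((Submodule.quotEquivOfEq _ _ h.symm).trans (LinearMap.quotKerEquivOfSurjective _
    ((Submodule.mkQ_surjective _).comp hφ))).length_eq

/-- The elements annihilated by the maximal ideal. -/
abbrev socle (V : Type*) [AddCommGroup V] [Module R V] : Submodule R V :=
  Submodule.torsionBySet R V (maximalIdeal R : Set R)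

theorem exists_equiv_pi_residueField {T : Type u} [AddCommGroup T] [Module R T] [Module.Finite R T]
    (hT : Module.IsTorsionBySet R T (maximalIdeal R : Set R)) :
    ∃ t : ℕ, Nonempty (T ≃ₗ[R] (Fin t → ResidueField R)) := by
  let : Module (ResidueField R) T := hT.module
  have : IsScalarTower R (ResidueField R) T := hT.isScalarTower
  have : Module.Finite (ResidueField R) T := Module.Finite.of_restrictScalars_finite R _ T
  exact ⟨_, ⟨(Module.finBasis (ResidueField R) T).equivFun.restrictScalars R⟩⟩

instance : IsSimpleModule R (ResidueField R) :=
  isSimpleModule_iff_isCoatom.2 (maximalIdeal.isMaximal R).out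

theorem length_ext_of_isTorsion {T : ModuleCat.{u} R} [Module.Finite R T]
    (hT : Module.IsTorsionBySet R T (maximalIdeal R : Set R)) (Y : ModuleCat.{u} R) (i : ℕ) :
    Module.length R (Abelian.Ext T Y i) = Module.length R T *
      Module.length R (Abelian.Ext (ModuleCat.of R (ResidueField R)) Y i) := by
  obtain ⟨t, ⟨e⟩⟩ := exists_equiv_pi_residueField hT
  have e' : T ≅ ModuleCat.of R (Fin t → ModuleCat.of R (ResidueField R)) := e.toModuleIso
  rw [e.length_eq, Module.length_pi, Module.length_eq_one (R := R) (M := ResidueField R), mul_one,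
    (extIsoLeft e'.symm Y i).length_eq, (extPi _ _ _ _).length_eq, Module.length_pi]

theorem maximalIdeal_smul_ext_eq_bot {T : ModuleCat.{u} R}
    (hT : Module.IsTorsionBySet R T (maximalIdeal R : Set R)) {Y : ModuleCat.{u} R} {i : ℕ} {x : R}
    (hx : x ∈ maximalIdeal R) (ξ : Abelian.Ext T Y i) : x • ξ = 0 := by
  have : x • 𝟙 T = 0 := by
    ext v
    exact hT (x := v) (a := ⟨x, hx⟩)
  rw [← mk₀_smul_id_comp, this, Ext.mk₀_zero, Ext.zero_comp]

variable {e : ℕ} (he : InjRank R e)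

include he in
theorem InjRank.precomp_surjective {U V : ModuleCat.{u} R} [Module.Finite R V] (f : U ⟶ V)
    (hf : Function.Injective f.hom) (ξ : Abelian.Ext U (unitMod R) e) :
    ∃ ζ : Abelian.Ext V (unitMod R) e, (Ext.mk₀ f).comp ζ (zero_add e) = ξ := by
  have hS : (ShortComplex.mk f (ModuleCat.ofHom (LinearMap.range f.hom).mkQ)
      (by ext x; simp)).ShortExact :=
    shortExact_of_linear _ hf (fun x hx => (Submodule.Quotient.mk_eq_zero _).1 hx)
      (Submodule.mkQ_surjective _)
  have : Subsingleton (Abelian.Ext (ModuleCat.of R (V ⧸ LinearMap.range f.hom)) (unitMod R)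
      (e + 1)) := he.ext_zero _ (inferInstanceAs (Module.Finite R (V ⧸ LinearMap.range f.hom))) _
        (Nat.lt_succ_self e)
  exact Ext.contravariant_sequence_exact₁ hS _ ξ (add_comm 1 e)
    (Subsingleton.elim (α := Abelian.Ext (ModuleCat.of R (V ⧸ LinearMap.range f.hom)) (unitMod R)
      (e + 1)) _ _)

include he in
/-- `Ext^e(V, R) / m Ext^e(V, R) ≅ Ext^e(Soc V, R)`. -/
theorem InjRank.length_ext_quotient_of_socle [IsNoetherianRing R] (V : ModuleCat.{u} R) [Module.Finite R V] :
    Module.length R (Abelian.Ext V (unitMod R) e ⧸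
      (maximalIdeal R • ⊤ : Submodule R (Abelian.Ext V (unitMod R) e))) =
    Module.length R (socle (R := R) V) * Module.length R
      (Abelian.Ext (ModuleCat.of R (ResidueField R)) (unitMod R) e) := by
  have hT : Module.IsTorsionBySet R (socle (R := R) V) (maximalIdeal R : Set R) :=
    Submodule.torsionBySet_isTorsionBySet _
  let T : ModuleCat.{u} R := ModuleCat.of R (socle (R := R) V)
  have : Module.Finite R T := inferInstanceAs (Module.Finite R (socle (R := R) V))
  let ι : T ⟶ V := ModuleCat.ofHom (socle (R := R) V).subtype
  let φ : Abelian.Ext V (unitMod R) e →ₗ[R] Abelian.Ext T (unitMod R) e :=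
    (Ext.mk₀ ι).precompOfLinear R (unitMod R) (zero_add e)
  have hφ : Function.Surjective φ :=
    he.precomp_surjective ι (Submodule.injective_subtype _)
  have hker : LinearMap.ker φ ≤ maximalIdeal R • ⊤ := by
    intro ξ hξ
    let π : V ⟶ ModuleCat.of R (V ⧸ socle (R := R) V) := ModuleCat.ofHom (socle (R := R) V).mkQ
    have hS : (ShortComplex.mk ι π (ModuleCat.hom_ext (LinearMap.ext fun x => (Submodule.Quotient.mk_eq_zero _).2 x.2))).ShortExact :=
      shortExact_of_linear _ (Submodule.injective_subtype _)
        (fun x hx => ⟨⟨x, (Submodule.Quotient.mk_eq_zero _).1 hx⟩, rfl⟩)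
        (Submodule.mkQ_surjective _)
    obtain ⟨η, hη⟩ := Ext.contravariant_sequence_exact₂ hS (unitMod R) ξ hξ
    obtain ⟨s, z, hz⟩ := Submodule.fg_iff_exists_fin_generating_family.1
      (maximalIdeal R).fg_of_isNoetherianRing
    let μ : V →ₗ[R] (Fin s → V) := LinearMap.pi fun j => z j • LinearMap.id
    have hμ : LinearMap.ker μ = socle (R := R) V := by
      ext v
      rw [LinearMap.mem_ker, Submodule.mem_torsionBySet_iff]
      constructor
      · intro h a
        have hle : maximalIdeal R ≤ (LinearMap.toSpanSingleton R V v).ker := by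
          rw [← hz, Submodule.span_le]
          rintro _ ⟨j, rfl⟩
          exact congrFun h j
        exact hle a.2
      · intro h
        funext j
        exact h ⟨z j, hz ▸ Submodule.subset_span ⟨j, rfl⟩⟩
    let f : ModuleCat.of R (V ⧸ socle (R := R) V) ⟶ ModuleCat.of R (Fin s → V) :=
      ModuleCat.ofHom ((socle (R := R) V).liftQ μ hμ.ge)
    obtain ⟨ζ, hζ⟩ := he.precomp_surjective (V := ModuleCat.of R (Fin s → V)) f (by
      refine LinearMap.ker_eq_bot.1 (Submodule.ker_liftQ_eq_bot _ _ _ hμ.le)) η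
    have hfac : π ≫ f = ∑ j, z j • piIncl V s j := by
      refine ModuleCat.hom_ext (LinearMap.ext fun v => ?_)
      rw [ModuleCat.hom_sum, LinearMap.sum_apply]
      change μ v = ∑ j, z j • (Pi.single j v : Fin s → V)
      funext k
      simp [μ, Finset.sum_apply, Pi.single_apply]
    have hξ' : ξ = ∑ j, z j • (Ext.mk₀ (piIncl V s j)).comp ζ (zero_add e) := by
      have h1 : (Ext.mk₀ (π ≫ f)).comp ζ (zero_add e) = ξ := by
        rw [← hη, ← hζ, Ext.mk₀_comp_mk₀_assoc]
      rw [← h1, hfac, Ext.mk₀_sum, Ext.sum_comp]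
      refine Finset.sum_congr rfl fun j _ => ?_
      rw [Ext.mk₀_smul, Ext.smul_comp]
    rw [hξ']
    exact Submodule.sum_mem _ fun j _ => Submodule.smul_mem_smul
      (hz ▸ Submodule.subset_span ⟨j, rfl⟩) trivial
  rw [length_quotient_eq_of_ker_le φ hφ hker]
  have hbot : (maximalIdeal R • ⊤ : Submodule R (Abelian.Ext T (unitMod R) e)) = ⊥ := by
    rw [Submodule.eq_bot_iff]
    intro ξ hξ
    refine Submodule.smul_induction_on hξ (fun x hx ξ _ => maximalIdeal_smul_ext_eq_bot hT hx ξ) ?_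
    rintro _ _ rfl rfl
    exact add_zero 0
  rw [(Submodule.quotEquivOfEqBot _ hbot).length_eq]
  exact length_ext_of_isTorsion (T := T) hT _ _

end Socle

end Linkage

namespace Linkage

open Abelian IsLocalRing

section Reduction

variable {R : Type u} [CommRing R] [IsLocalRing R]

/-- `W` is the quotient of `V` by a regular sequence of length `l` in the maximal ideal. -/
inductive Redn : ℕ → ModuleCat.{u} R → ModuleCat.{u} R → Prop
  | nil {V W : ModuleCat.{u} R} (e : V ≅ W) : Redn 0 V W
  | cons {l : ℕ} {V V' W : ModuleCat.{u} R} (x : R) (hx : x ∈ maximalIdeal R) (g : V ⟶ V')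
      (hreg : IsSMulRegular V x) (hg : Function.Surjective g.hom)
      (hker : ∀ v, g.hom v = 0 ↔ ∃ w, x • w = v) (h : Redn l V' W) : Redn (l + 1) V W

theorem Redn.of_iso {l : ℕ} {U V W : ModuleCat.{u} R} (h : Redn l V W) (e : U ≅ V) :
    Redn l U W := by
  cases h with
  | nil e' => exact .nil (e ≪≫ e')
  | cons x hx g hreg hg hker h =>
    refine .cons x hx (e.hom ≫ g) ?_ ?_ ?_ h
    · exact (e.toLinearEquiv.isSMulRegular_congr x).2 hreg
    · exact hg.comp e.toLinearEquiv.surjective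
    · intro v
      refine (hker (e.hom.hom v)).trans ⟨?_, ?_⟩
      · rintro ⟨w, hw⟩
        refine ⟨e.inv.hom w, ?_⟩
        rw [← map_smul, hw]
        exact e.toLinearEquiv.symm_apply_apply v
      · rintro ⟨w, rfl⟩
        exact ⟨e.hom.hom w, (map_smul _ _ _).symm⟩

/-- Regular sequences descend along surjections of local rings. -/
theorem Redn.restrictScalars {S : Type u} [CommRing S] [IsLocalRing S] (f : R →+* S)
    (hf : Function.Surjective f)
    {l : ℕ} {V W : ModuleCat.{u} S} (h : Redn l V W) :
    Redn l ((ModuleCat.restrictScalars f).obj V) ((ModuleCat.restrictScalars f).obj W) := by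
  induction h with
  | nil e => exact .nil ((ModuleCat.restrictScalars f).mapIso e)
  | cons x hx g hreg hg hker h ih =>
    obtain ⟨x, rfl⟩ := hf x
    exact .cons x ((mem_maximalIdeal x).2 fun hu => (mem_maximalIdeal _).1 hx (hu.map f))
      ((ModuleCat.restrictScalars f).map g) hreg hg hker ih

variable [IsNoetherianRing R] {e : ℕ} (he : InjRank R e)

include he

theorem InjRank.exists_redn {V : ModuleCat.{u} R} [Module.Finite R V] {q l : ℕ}
    (hl : q + l ≤ e) (hV : ∀ i, q < i → Subsingleton (Abelian.Ext V (unitMod R) i)) :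
    ∃ W : ModuleCat.{u} R, Redn l V W := by
  induction l generalizing V q with
  | zero => exact ⟨V, .nil (Iso.refl V)⟩
  | succ l ih =>
    obtain ⟨x, hx, hreg⟩ := he.exists_isSMulRegular (V := V) (hV e (by omega))
    obtain ⟨W, hW⟩ := ih (V := ModuleCat.of R (QuotSMulTop x V)) (q := q + 1)
      (by omega) (fun i hi => by
        obtain ⟨i, rfl⟩ : ∃ j, i = j + 1 := ⟨i - 1, by omega⟩
        exact subsingleton_ext_X₃ hreg.smulShortComplex_shortExact (hV i (by omega))
          (hV (i + 1) (by omega)))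
    refine ⟨W, .cons x hx (ModuleCat.ofHom (Submodule.mkQ _)) hreg (Submodule.mkQ_surjective _)
      (fun v => ?_) hW⟩
    refine (Submodule.Quotient.mk_eq_zero _).trans ?_
    rw [Submodule.mem_smul_pointwise_iff_exists]
    simp

/-- The minimal number of generators of `Ext^g(V, R)` is the type of `V` times the type of `R`. -/
theorem InjRank.length_ext_quotient {V W : ModuleCat.{u} R} [Module.Finite R V] {g l : ℕ}
    (h : Redn l V W) (hgl : g + l = e)
    (hV : ∀ i, g < i → Subsingleton (Abelian.Ext V (unitMod R) i)) :
    Module.length R (Abelian.Ext V (unitMod R) g ⧸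
      (maximalIdeal R • ⊤ : Submodule R (Abelian.Ext V (unitMod R) g))) =
    Module.length R (socle (R := R) W) * Module.length R
      (Abelian.Ext (ModuleCat.of R (ResidueField R)) (unitMod R) e) := by
  revert ‹Module.Finite R V›
  induction h generalizing g with
  | nil ι =>
    rename_i V W
    intro hfin
    obtain rfl : g = e := hgl
    have : Module.Finite R W := Module.Finite.equiv ι.toLinearEquiv
    rw [← he.length_ext_quotient_of_socle W]
    refine length_quotient_eq_of_ker_le (extIsoLeft ι.symm (unitMod R) g).toLinearMap
      (extIsoLeft ι.symm (unitMod R) g).surjective ?_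
    rw [LinearEquiv.ker]
    exact bot_le
  | cons x hx φ hreg hφ hker h ih =>
    rename_i l V V' W
    intro hfin
    have hV' : Module.Finite R V' := Module.Finite.of_surjective φ.hom hφ
    have hS : (ShortComplex.mk (x • 𝟙 V) φ (ModuleCat.hom_ext (LinearMap.ext fun v =>
        (hker _).2 ⟨v, rfl⟩))).ShortExact :=
      shortExact_of_linear _ hreg (fun v hv => (hker v).1 hv) hφ
    rw [← ih (g := g + 1) (by omega) (fun i hi => by
      obtain ⟨i, rfl⟩ : ∃ j, i = j + 1 := ⟨i - 1, by omega⟩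
      exact subsingleton_ext_X₃ hS (hV i (by omega)) (hV (i + 1) (by omega)))]
    refine length_quotient_eq_of_ker_le
      (hS.extClass.precompOfLinear R (unitMod R) (add_comm 1 g)) ?_ ?_
    · intro ξ
      have := hV (g + 1) (Nat.lt_succ_self g)
      exact Ext.contravariant_sequence_exact₃ hS (unitMod R) ξ
        (Subsingleton.elim (α := Abelian.Ext V (unitMod R) (g + 1)) _ _) (add_comm 1 g)
    · intro ξ hξ
      obtain ⟨ζ, hζ⟩ := Ext.contravariant_sequence_exact₁ hS (unitMod R) (n₀ := g) ξ
        (add_comm 1 g) hξ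
      have hζ' : x • (ζ : Abelian.Ext V (unitMod R) g) = ξ := (mk₀_smul_id_comp x _).symm.trans hζ
      rw [← hζ']
      exact Submodule.smul_mem_smul hx trivial

omit he [IsLocalRing R] [IsNoetherianRing R] in
instance : Projective (unitMod R) :=
  (IsProjective.iff_projective (unitMod R)).1 (inferInstanceAs (Module.Projective R R))

/-- A Gorenstein ring has type one. -/
theorem InjRank.length_socle_mul {W : ModuleCat.{u} R} (h : Redn e (unitMod R) W) :
    Module.length R (socle (R := R) W) * Module.length R
      (Abelian.Ext (ModuleCat.of R (ResidueField R)) (unitMod R) e) = 1 := by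
  rw [← he.length_ext_quotient h (zero_add e)
    fun i hi => subsingleton_ext_of_projective _ _ hi]
  have ε : Abelian.Ext (unitMod R) (unitMod R) 0 ≃ₗ[R] R :=
    (extZeroEquivDual (unitMod R)).trans (LinearMap.ringLmapEquivSelf R R R)
  rw [length_quotient_eq_of_ker_le (R := R) ε.toLinearMap ε.surjective
    (by rw [LinearEquiv.ker]; exact bot_le)]
  have : (maximalIdeal R • ⊤ : Submodule R R) = maximalIdeal R := by
    rw [smul_eq_mul, Ideal.mul_top]
  rw [(Submodule.quotEquivOfEq _ _ this).length_eq]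
  exact Module.length_eq_one (R := R) (M := ResidueField R)

theorem InjRank.length_socle_eq_one {W : ModuleCat.{u} R} (h : Redn e (unitMod R) W) :
    Module.length R (socle (R := R) W) = 1 :=
  eq_one_of_mul_right (he.length_socle_mul h)

theorem InjRank.length_ext_residue :
    Module.length R (Abelian.Ext (ModuleCat.of R (ResidueField R)) (unitMod R) e) = 1 := by
  obtain ⟨W, hW⟩ := he.exists_redn (V := unitMod R) (q := 0) (l := e) (by omega)
    fun i hi => subsingleton_ext_of_projective _ _ hi
  exact eq_one_of_mul_left (he.length_socle_mul hW)

theorem InjRank.nonempty_extDual_residue :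
    Nonempty (extDual e (ModuleCat.of R (ResidueField R)) ≅ ModuleCat.of R (ResidueField R)) := by
  have : IsSimpleModule R (Abelian.Ext (ModuleCat.of R (ResidueField R)) (unitMod R) e) :=
    Module.length_eq_one_iff.1 he.length_ext_residue
  obtain ⟨I, hI, ⟨ε⟩⟩ := isSimpleModule_iff_quot_maximal.1 this
  rw [eq_maximalIdeal hI] at ε
  exact ⟨ε.toModuleIso⟩

end Reduction

end Linkage

namespace Linkage

open Abelian

section Annihilated

variable {R : Type u} [CommRing R] {c : Ideal R}

/-- The cyclic module `R ⧸ c`. -/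
abbrev quotMod (c : Ideal R) : ModuleCat.{u} R := ModuleCat.of R (R ⧸ c)

/-- The module `V` is annihilated by the ideal `c`. -/
abbrev Killed (c : Ideal R) (V : Type*) [AddCommGroup V] [Module R V] : Prop :=
  ∀ r ∈ c, ∀ v : V, r • v = 0

theorem Killed.of_injective {V W : Type*} [AddCommGroup V] [Module R V] [AddCommGroup W]
    [Module R W] (hW : Killed c W) (f : V →ₗ[R] W) (hf : Function.Injective f) : Killed c V :=
  fun r hr v => hf (by rw [map_smul, hW r hr, map_zero])

theorem killed_quotient : Killed c (R ⧸ c) := by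
  intro r hr v
  obtain ⟨v, rfl⟩ := Ideal.Quotient.mk_surjective v
  exact Ideal.Quotient.eq_zero_iff_mem.2 (Ideal.mul_mem_right v c hr)

theorem Killed.pi {V : Type*} [AddCommGroup V] [Module R V] (hV : Killed c V) (q : ℕ) :
    Killed c (Fin q → V) := fun r hr v => funext fun j => hV r hr (v j)

theorem Killed.ext {V : ModuleCat.{u} R} (hV : Killed c V) (Y : ModuleCat.{u} R) (i : ℕ) :
    Killed c (Abelian.Ext V Y i) := by
  intro r hr ξ
  have : r • 𝟙 V = 0 := by
    ext v
    exact hV r hr v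
  rw [← mk₀_smul_id_comp, this, Ext.mk₀_zero, Ext.zero_comp]

/-- The map `R ⧸ c ⟶ V` sending `1` to `v`. -/
def fromQuot {V : ModuleCat.{u} R} (hV : Killed c V) (v : V) : quotMod c ⟶ V :=
  ModuleCat.ofHom (Submodule.liftQ c (LinearMap.toSpanSingleton R V v) fun r hr => hV r hr v)

theorem fromQuot_mk {V : ModuleCat.{u} R} (hV : Killed c V) (v : V) (r : R) :
    (fromQuot hV v).hom (Ideal.Quotient.mk c r) = r • v := rfl

theorem quotMod_hom_ext {V : ModuleCat.{u} R} {f g : quotMod c ⟶ V}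
    (h : f.hom (Ideal.Quotient.mk c 1) = g.hom (Ideal.Quotient.mk c 1)) : f = g := by
  refine ModuleCat.hom_ext (LinearMap.ext fun x => ?_)
  obtain ⟨r, rfl⟩ := Ideal.Quotient.mk_surjective x
  have : (Ideal.Quotient.mk c r : quotMod c) = r • (Ideal.Quotient.mk c 1 : quotMod c) := by
    change _ = Ideal.Quotient.mk c (r * 1)
    rw [mul_one]
  rw [this, map_smul, map_smul, h]

theorem fromQuot_one {V : ModuleCat.{u} R} (hV : Killed c V) (v : V) :
    (fromQuot hV v).hom (Ideal.Quotient.mk c 1) = v := by rw [fromQuot_mk, one_smul]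

theorem fromQuot_comp {V W : ModuleCat.{u} R} (hV : Killed c V) (hW : Killed c W) (f : V ⟶ W)
    (v : V) : fromQuot hV v ≫ f = fromQuot hW (f.hom v) := by
  refine quotMod_hom_ext ?_
  rw [fromQuot_one, ModuleCat.comp_apply]
  exact congrArg f.hom (fromQuot_one hV v)

theorem fromQuot_add {V : ModuleCat.{u} R} (hV : Killed c V) (v w : V) :
    fromQuot hV (v + w) = fromQuot hV v + fromQuot hV w := by
  refine quotMod_hom_ext ?_
  rw [ModuleCat.hom_add, LinearMap.add_apply, fromQuot_one, fromQuot_one, fromQuot_one]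

theorem fromQuot_smul {V : ModuleCat.{u} R} (hV : Killed c V) (r : R) (v : V) :
    fromQuot hV (r • v) = r • fromQuot hV v := by
  refine quotMod_hom_ext ?_
  rw [ModuleCat.hom_smul, LinearMap.smul_apply, fromQuot_one, fromQuot_one]

theorem fromQuot_mk_self (r : R) :
    fromQuot (V := quotMod c) killed_quotient (Ideal.Quotient.mk c r) = r • 𝟙 _ := by
  refine quotMod_hom_ext ?_
  rw [fromQuot_one]
  change _ = Ideal.Quotient.mk c (r * 1)
  rw [mul_one]

variable {Y : ModuleCat.{u} R} {g : ℕ}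

/-- The comparison `Ext^g(V, Y) → Hom(V, Ext^g(R ⧸ c, Y))`. -/
def extToHom {V : ModuleCat.{u} R} (hV : Killed c V) :
    Abelian.Ext V Y g →ₗ[R] (V →ₗ[R] Abelian.Ext (quotMod c) Y g) :=
  LinearMap.mk₂ R (fun ξ v => (Ext.mk₀ (fromQuot hV v)).comp ξ (zero_add g))
    (fun ξ ζ v => Ext.comp_add _ _ _ _)
    (fun r ξ v => Ext.comp_smul _ _ _ _)
    (fun ξ v w => by rw [fromQuot_add, Ext.mk₀_add, Ext.add_comp])
    (fun r ξ v => by rw [fromQuot_smul, Ext.mk₀_smul, Ext.smul_comp])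

theorem extToHom_apply {V : ModuleCat.{u} R} (hV : Killed c V) (ξ : Abelian.Ext V Y g) (v : V) :
    extToHom hV ξ v = (Ext.mk₀ (fromQuot hV v)).comp ξ (zero_add g) := rfl

theorem extToHom_comp {V W : ModuleCat.{u} R} (hV : Killed c V) (hW : Killed c W) (f : V ⟶ W)
    (ξ : Abelian.Ext W Y g) :
    extToHom hV ((Ext.mk₀ f).comp ξ (zero_add g)) = (extToHom hW ξ).comp f.hom := by
  refine LinearMap.ext fun v => ?_
  rw [LinearMap.comp_apply, extToHom_apply, extToHom_apply, Ext.mk₀_comp_mk₀_assoc,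
    fromQuot_comp hV hW]

theorem fromQuot_single (q : ℕ) (j : Fin q) :
    fromQuot (V := ModuleCat.of R (Fin q → quotMod c)) (killed_quotient.pi q)
      (Pi.single j (Ideal.Quotient.mk c 1)) = piIncl (quotMod c) q j :=
  quotMod_hom_ext (fromQuot_one _ _)

theorem pi_quotient_hom_ext {q : ℕ} {E : Type*} [AddCommGroup E] [Module R E]
    {φ ψ : (Fin q → R ⧸ c) →ₗ[R] E}
    (h : ∀ j, φ (Pi.single j (Ideal.Quotient.mk c 1)) = ψ (Pi.single j (Ideal.Quotient.mk c 1))) :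
    φ = ψ :=
  LinearMap.pi_ext' fun k => Submodule.linearMap_qext _ (LinearMap.ext_ring (h k))

theorem extToHom_pi_injective (q : ℕ) : Function.Injective
    (extToHom (V := ModuleCat.of R (Fin q → quotMod c)) (Y := Y) (g := g)
      (killed_quotient.pi q)) := by
  rw [injective_iff_map_eq_zero]
  intro ξ hξ
  rw [← sum_comp_ext (quotMod c) q Y g ξ]
  refine Finset.sum_eq_zero fun j _ => ?_
  have := LinearMap.congr_fun hξ (Pi.single j (Ideal.Quotient.mk c 1))
  rw [extToHom_apply, fromQuot_single] at this
  rw [this, LinearMap.zero_apply, Ext.comp_zero]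

theorem extToHom_pi_surjective (q : ℕ) : Function.Surjective
    (extToHom (V := ModuleCat.of R (Fin q → quotMod c)) (Y := Y) (g := g)
      (killed_quotient.pi q)) := by
  intro φ
  refine ⟨∑ j, (Ext.mk₀ (piProj (quotMod c) q j)).comp
    (φ (Pi.single j (Ideal.Quotient.mk c 1))) (zero_add g), ?_⟩
  refine pi_quotient_hom_ext fun k => ?_
  rw [extToHom_apply, fromQuot_single, Ext.comp_sum, Finset.sum_eq_single k]
  · rw [Ext.mk₀_comp_mk₀_assoc, piIncl_piProj, if_pos rfl, Ext.mk₀_id_comp]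
  · intro j _ hj
    rw [Ext.mk₀_comp_mk₀_assoc, piIncl_piProj, if_neg hj.symm, Ext.mk₀_zero, Ext.zero_comp]
  · simp

theorem precomp_injective_of_subsingleton {S : ShortComplex (ModuleCat.{u} R)} (hS : S.ShortExact)
    (h : ∀ i, i + 1 = g → Subsingleton (Abelian.Ext S.X₁ Y i)) (ξ : Abelian.Ext S.X₃ Y g)
    (hξ : (Ext.mk₀ S.g).comp ξ (zero_add g) = 0) : ξ = 0 := by
  rcases g with _ | g
  · obtain ⟨f, rfl⟩ := (Ext.mk₀_bijective _ _).2 ξ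
    rw [Ext.mk₀_comp_mk₀] at hξ
    have := hS.epi_g
    rw [(cancel_epi S.g).1 ((Ext.mk₀_eq_zero_iff _).1 hξ |>.trans comp_zero.symm), Ext.mk₀_zero]
  · obtain ⟨η, rfl⟩ := Ext.contravariant_sequence_exact₃ hS Y ξ hξ (add_comm 1 g)
    have := h g rfl
    rw [Subsingleton.elim η 0, Ext.comp_zero]

variable [IsNoetherianRing R]

theorem exists_presentation {V : ModuleCat.{u} R} [Module.Finite R V] (hV : Killed c V) :
    ∃ (q : ℕ) (K : ModuleCat.{u} R) (ι : K ⟶ ModuleCat.of R (Fin q → quotMod c))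
      (π : ModuleCat.of R (Fin q → quotMod c) ⟶ V) (w : ι ≫ π = 0), Module.Finite R K ∧
      Killed c K ∧ (ShortComplex.mk ι π w).ShortExact := by
  obtain ⟨q, f, hf⟩ := Module.Finite.exists_fin' R V
  let π : (Fin q → R ⧸ c) →ₗ[R] V :=
    ∑ j, (fromQuot hV (f (Pi.single j 1))).hom ∘ₗ LinearMap.proj j
  have hπ : Function.Surjective π := by
    intro v
    obtain ⟨x, rfl⟩ := hf v
    refine ⟨fun j => Ideal.Quotient.mk c (x j), ?_⟩
    rw [LinearMap.sum_apply]
    calc _ = ∑ j, x j • f (Pi.single j 1) := Finset.sum_congr rfl fun j _ => rfl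
      _ = f x := by
        conv_rhs => rw [pi_eq_sum_univ' x]
        rw [map_sum]
        refine Finset.sum_congr rfl fun j _ => ?_
        rw [map_smul]
  refine ⟨q, ModuleCat.of R (LinearMap.ker π), ModuleCat.ofHom (LinearMap.ker π).subtype,
    ModuleCat.ofHom π, ModuleCat.hom_ext (LinearMap.ext fun x => x.2), ?_, ?_,
    shortExact_of_linear _ (Submodule.injective_subtype _) (fun x hx => ⟨⟨x, hx⟩, rfl⟩) hπ⟩
  · exact inferInstanceAs (Module.Finite R (LinearMap.ker π))
  · exact (killed_quotient.pi q).of_injective (LinearMap.ker π).subtype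
      (Submodule.injective_subtype _)

theorem Killed.subsingleton_ext {V : ModuleCat.{u} R} [Module.Finite R V] (hV : Killed c V)
    (hc : ∀ i < g, Subsingleton (Abelian.Ext (quotMod c) Y i)) (i : ℕ) (hi : i < g) :
    Subsingleton (Abelian.Ext V Y i) := by
  induction i generalizing V with
  | zero =>
    obtain ⟨q, K, ι, π, w, hK, hK', hS⟩ := exists_presentation hV
    have := hc 0 hi
    have := (extPi (quotMod c) q Y 0).toEquiv.subsingleton
    exact subsingleton_of_forall_eq 0 fun ξ =>
      precomp_injective_of_subsingleton hS (fun i hi => by omega) ξ (Subsingleton.elim _ _)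
  | succ i ih =>
    obtain ⟨q, K, ι, π, w, hK, hK', hS⟩ := exists_presentation hV
    have := hc (i + 1) hi
    exact subsingleton_ext_X₃ hS (ih hK' (by omega))
      (extPi (quotMod c) q Y (i + 1)).toEquiv.subsingleton

theorem extToHom_injective {V : ModuleCat.{u} R} [Module.Finite R V] (hV : Killed c V)
    (hc : ∀ i < g, Subsingleton (Abelian.Ext (quotMod c) Y i)) :
    Function.Injective (extToHom (Y := Y) (g := g) hV) := by
  obtain ⟨q, K, ι, π, w, hK, hK', hS⟩ := exists_presentation hV
  rw [injective_iff_map_eq_zero]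
  intro ξ hξ
  refine precomp_injective_of_subsingleton hS
    (fun i hi => hK'.subsingleton_ext hc i (by omega)) ξ ?_
  refine extToHom_pi_injective q ?_
  rw [map_zero]
  exact (extToHom_comp (killed_quotient.pi q) hV π ξ).trans (by rw [hξ, LinearMap.zero_comp])

theorem extToHom_bijective {V : ModuleCat.{u} R} [Module.Finite R V] (hV : Killed c V)
    (hc : ∀ i < g, Subsingleton (Abelian.Ext (quotMod c) Y i)) :
    Function.Bijective (extToHom (Y := Y) (g := g) hV) := by
  refine ⟨extToHom_injective hV hc, fun φ => ?_⟩
  obtain ⟨q, K, ι, π, w, hK, hK', hS⟩ := exists_presentation hV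
  obtain ⟨ξ, hξ⟩ := extToHom_pi_surjective (Y := Y) (g := g) q (φ ∘ₗ π.hom)
  obtain ⟨ζ, hζ⟩ := Ext.contravariant_sequence_exact₂ hS Y ξ (by
    refine extToHom_injective hK' hc ?_
    rw [map_zero]
    refine (extToHom_comp hK' (killed_quotient.pi q) ι ξ).trans ?_
    rw [hξ]
    refine LinearMap.ext fun x => ?_
    exact (congrArg φ (comp_zero_apply (ShortComplex.mk ι π w) x)).trans (map_zero φ))
  refine ⟨ζ, LinearMap.ext fun v => ?_⟩
  obtain ⟨x, rfl⟩ := surjective_of_shortExact hS v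
  have h := extToHom_comp (killed_quotient.pi q) hV π ζ
  exact (LinearMap.congr_fun h x).symm.trans
    (LinearMap.congr_fun ((congrArg (extToHom (killed_quotient.pi q)) hζ).trans hξ) x)

end Annihilated

end Linkage

namespace Linkage

open Abelian IsLocalRing RingTheory.Sequence

section ExtDual

variable {R : Type u} [CommRing R] [IsNoetherianRing R] (hR : FiniteSelfInj R)

include hR

theorem subsingleton_ext_extDual_succ {n p : ℕ} {K : ModuleCat.{u} R} [Module.Finite R K]
    (hK : ∀ i, 0 < i → i ≠ n + 1 → Subsingleton (Abelian.Ext K (unitMod R) i))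
    (hK' : ∀ i, p ≤ i → Subsingleton (Abelian.Ext (dualObj K) (unitMod R) i)) (i : ℕ)
    (hi : p + n + 1 < i) : Subsingleton (Abelian.Ext (extDual (n + 1) K) (unitMod R) i) := by
  induction n generalizing p K with
  | zero =>
    obtain ⟨S, hS, rfl, hP, hPf, hf⟩ := exists_syzygy K
    have hG : IsGProj S.X₁ := ⟨hf, fun i hi => subsingleton_ext_X₁ hS
      (subsingleton_ext_of_projective _ _ hi) (hK (i + 1) (Nat.succ_pos i) (by omega))⟩
    obtain ⟨W, ρ, hρ, ι, δ, hι, h1, h2⟩ := exists_shortExact_extDual_one hS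
    obtain ⟨j, rfl⟩ : ∃ j, i = j + 2 := ⟨i - 2, by omega⟩
    have hW : Subsingleton (Abelian.Ext W (unitMod R) (j + 1)) :=
      subsingleton_ext_X₃ h1 (hK' j (by omega)) (subsingleton_ext_of_projective _ _ j.succ_pos)
    exact subsingleton_ext_X₃ h2 hW ((hG.dual hR).ext_zero _ (by omega))
  | succ n ih =>
    obtain ⟨S, hS, rfl, hP, hPf, hf⟩ := exists_syzygy K
    have hD := dualComplex_shortExact hS (hK 1 one_pos (by omega))
    have hdual : ∀ i, p + 1 ≤ i → Subsingleton (Abelian.Ext (dualObj S.X₁) (unitMod R) i) := by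
      intro i hi
      obtain ⟨j, rfl⟩ : ∃ j, i = j + 1 := ⟨i - 1, by omega⟩
      exact subsingleton_ext_X₃ hD (hK' j (by omega))
        (subsingleton_ext_of_projective _ _ j.succ_pos)
    have hX : ∀ i, 0 < i → i ≠ n + 1 → Subsingleton (Abelian.Ext S.X₁ (unitMod R) i) :=
      fun i hi hn => subsingleton_ext_X₁ hS (subsingleton_ext_of_projective _ _ hi)
        (hK (i + 1) (Nat.succ_pos i) (by omega))
    have := ih hX hdual (by omega)
    let e := extShiftLeft hS (unitMod R) (n + 1) (subsingleton_ext_of_projective _ _ (by omega))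
      (subsingleton_ext_of_projective _ _ (by omega))
    exact (extIsoLeft e.symm.toModuleIso (unitMod R) i).symm.toEquiv.subsingleton

theorem IsCM.subsingleton_ext_extDual {n : ℕ} {M : ModuleCat.{u} R} (hM : IsCM n M) (i : ℕ)
    (hi : n < i) : Subsingleton (Abelian.Ext (extDual n M) (unitMod R) i) := by
  have := hM.finite
  rcases n with _ | n
  · have hG : IsGProj M := ⟨hM.finite, fun i hi => hM.ext_zero i hi.ne'⟩
    have := (hG.dual hR).ext_zero i hi
    exact (extIsoLeft (extZeroEquivDual M).toModuleIso (unitMod R) i).symm.toEquiv.subsingleton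
  · have h0 := hM.ext_zero 0 (Nat.succ_ne_zero n).symm
    have : Subsingleton (dualObj M) := (extZeroEquivDual M).symm.toEquiv.subsingleton
    exact subsingleton_ext_extDual_succ hR (p := 0) (fun i _ h => hM.ext_zero i h)
      (fun i _ => subsingleton_ext_of_isZero (ModuleCat.isZero_of_subsingleton _) _ _) i (by omega)

end ExtDual

end Linkage

namespace Linkage

open Abelian IsLocalRing RingTheory.Sequence

section Transfer

variable {R : Type u} [CommRing R] [IsLocalRing R] [IsNoetherianRing R]
variable {c : Ideal R} [IsLocalRing (R ⧸ c)]

omit [IsNoetherianRing R] in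
theorem mk_mem_maximalIdeal_iff (r : R) :
    Ideal.Quotient.mk c r ∈ maximalIdeal (R ⧸ c) ↔ r ∈ maximalIdeal R := by
  have : IsLocalHom (Ideal.Quotient.mk c) :=
    IsLocalHom.of_surjective _ Ideal.Quotient.mk_surjective
  rw [mem_maximalIdeal, mem_maximalIdeal, mem_nonunits_iff, mem_nonunits_iff, isUnit_map_iff]

variable (M : Type u) [AddCommGroup M] [Module R M] [Module (R ⧸ c) M] [IsScalarTower R (R ⧸ c) M]

omit [IsNoetherianRing R] in
theorem exists_isWeaklyRegular_quotient {rs : List R} (h : ∀ r ∈ rs, r ∈ maximalIdeal R)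
    (hreg : IsWeaklyRegular M rs) : ∃ ss : List (R ⧸ c), ss.length = rs.length ∧
      (∀ s ∈ ss, s ∈ maximalIdeal (R ⧸ c)) ∧ IsWeaklyRegular M ss := by
  refine ⟨rs.map (algebraMap R (R ⧸ c)), List.length_map _, fun s hs => ?_,
    (isWeaklyRegular_map_algebraMap_iff _ _ _).2 hreg⟩
  obtain ⟨r, hr, rfl⟩ := List.mem_map.1 hs
  exact (mk_mem_maximalIdeal_iff r).2 (h r hr)

omit [IsNoetherianRing R] in
theorem exists_isWeaklyRegular_lift {ss : List (R ⧸ c)}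
    (h : ∀ s ∈ ss, s ∈ maximalIdeal (R ⧸ c)) (hreg : IsWeaklyRegular M ss) :
    ∃ rs : List R, rs.length = ss.length ∧ (∀ r ∈ rs, r ∈ maximalIdeal R) ∧
      IsWeaklyRegular M rs := by
  obtain ⟨rs, rfl⟩ := List.map_surjective_iff.2
    (Ideal.Quotient.mk_surjective (I := c)) ss
  exact ⟨rs, (List.length_map _).symm,
    fun r hr => (mk_mem_maximalIdeal_iff r).1 (h _ (List.mem_map_of_mem hr)),
    (isWeaklyRegular_map_algebraMap_iff (R ⧸ c) M rs).1 hreg⟩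

variable [Module.Finite R M] [Nontrivial M] {e e' g : ℕ} (he : InjRank R e)
  (he' : InjRank (R ⧸ c) e')

include he he'

theorem ext_quotient_bound (q l : ℕ) (hl : q + l ≤ e)
    (hM : ∀ i, q < i → Subsingleton (Abelian.Ext (ModuleCat.of R M) (unitMod R) i)) (i : ℕ)
    (hi : ¬ Subsingleton (Abelian.Ext (ModuleCat.of (R ⧸ c) M) (unitMod (R ⧸ c)) i)) :
    i + l ≤ e' := by
  have : Module.Finite (R ⧸ c) M := Module.Finite.of_restrictScalars_finite R (R ⧸ c) M
  obtain ⟨rs, rfl, hrs, hreg⟩ := he.exists_isRegular (V := ModuleCat.of R M) hl hM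
  obtain ⟨ss, hlen, hss, hreg'⟩ := exists_isWeaklyRegular_quotient (c := c) M hrs
    hreg.toIsWeaklyRegular
  rw [← hlen]
  exact he'.add_length_le (V := ModuleCat.of (R ⧸ c) M) hss hreg' hi

theorem ext_lift_bound (q l : ℕ) (hl : q + l ≤ e')
    (hM : ∀ i, q < i → Subsingleton (Abelian.Ext (ModuleCat.of (R ⧸ c) M) (unitMod (R ⧸ c)) i))
    (i : ℕ) (hi : ¬ Subsingleton (Abelian.Ext (ModuleCat.of R M) (unitMod R) i)) :
    i + l ≤ e := by
  have : Module.Finite (R ⧸ c) M := Module.Finite.of_restrictScalars_finite R (R ⧸ c) M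
  obtain ⟨rs, rfl, hrs, hreg⟩ := he'.exists_isRegular (V := ModuleCat.of (R ⧸ c) M) hl hM
  obtain ⟨ss, hlen, hss, hreg'⟩ := exists_isWeaklyRegular_lift (c := c) M hrs
    hreg.toIsWeaklyRegular
  rw [← hlen]
  exact he.add_length_le (V := ModuleCat.of R M) hss hreg' hi

omit [Module.Finite R M] [Nontrivial M] in
theorem injRank_quotient (hg : IsCM g (quotMod c))
    (hne : ¬ Subsingleton (Abelian.Ext (quotMod c) (unitMod R) g)) : g + e' = e := by
  have h0 : ¬ Subsingleton (Abelian.Ext (unitMod (R ⧸ c)) (unitMod (R ⧸ c)) 0) := by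
    intro h
    have : Subsingleton (Module.Dual (R ⧸ c) (R ⧸ c)) :=
      (extZeroEquivDual (unitMod (R ⧸ c))).symm.toEquiv.subsingleton
    exact one_ne_zero (LinearMap.congr_fun
      (Subsingleton.elim (LinearMap.id : Module.Dual (R ⧸ c) (R ⧸ c)) 0) 1)
  have h1 := ext_lift_bound (R ⧸ c) he he' 0 e' (by omega)
    (fun i hi => subsingleton_ext_of_projective _ _ hi) g hne
  have h2 := ext_quotient_bound (R ⧸ c) he he' g (e - g) (by omega)
    (fun i hi => hg.ext_zero i hi.ne') 0 h0
  omega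

theorem isGProj_of_isCM (hge : g + e' = e) (hM : IsCM g (ModuleCat.of R M)) :
    IsGProj (ModuleCat.of (R ⧸ c) M) where
  finite := Module.Finite.of_restrictScalars_finite R (R ⧸ c) M
  ext_zero i hi := by
    by_contra h
    have := ext_quotient_bound M he he' g e' hge.le (fun i hi => hM.ext_zero i hi.ne') i h
    omega

theorem isCM_of_isGProj (hge : g + e' = e) (hg : IsCM g (quotMod c))
    (hM : IsGProj (ModuleCat.of (R ⧸ c) M)) : IsCM g (ModuleCat.of R M) where
  finite := inferInstance
  ext_zero i hi := by
    rcases hi.lt_or_gt with hi | hi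
    · refine Killed.subsingleton_ext (c := c) ?_ (fun i hi => hg.ext_zero i hi.ne) i hi
      intro r hr v
      change r • (v : M) = 0
      rw [← algebraMap_smul (R ⧸ c) r (v : M)]
      change Ideal.Quotient.mk c r • (v : M) = 0
      rw [Ideal.Quotient.eq_zero_iff_mem.2 hr, zero_smul]
    · by_contra h
      have := ext_lift_bound M he he' 0 e' (by omega) hM.ext_zero i h
      omega

end Transfer

end Linkage

namespace Linkage

open Abelian IsLocalRing RingTheory.Sequence
section Canonical

variable {R : Type u} [CommRing R] [IsLocalRing R]
variable {c : Ideal R} [IsLocalRing (R ⧸ c)]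

omit [IsLocalRing R] [IsLocalRing (R ⧸ c)] in
theorem isCM_extDual_quotMod [IsNoetherianRing R] (hR : FiniteSelfInj R) {g : ℕ}
    (hg : IsCM g (quotMod c)) : IsCM g (extDual g (quotMod c)) where
  finite := inferInstance
  ext_zero i hi := by
    rcases hi.lt_or_gt with hi | hi
    · exact Killed.subsingleton_ext (killed_quotient.ext (V := quotMod c) _ _)
        (fun i hi => hg.ext_zero i hi.ne) i hi
    · exact hg.subsingleton_ext_extDual hR i hi

theorem length_socle_restrictScalars {W : ModuleCat.{u} (R ⧸ c)}
    (h : Module.length (R ⧸ c) (socle (R := R ⧸ c) W) = 1) :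
    Module.length R
      (socle (R := R) ((ModuleCat.restrictScalars (Ideal.Quotient.mk c)).obj W)) = 1 := by
  rw [Module.length_eq_one_iff, isSimpleModule_iff_toSpanSingleton_surjective] at h ⊢
  let W' := (ModuleCat.restrictScalars (Ideal.Quotient.mk c)).obj W
  have hmem : ∀ w : W, w ∈ socle (R := R ⧸ c) W ↔
      (show W' from w) ∈ socle (R := R) W' := by
    intro w
    rw [Submodule.mem_torsionBySet_iff, Submodule.mem_torsionBySet_iff]
    constructor
    · intro hw r
      exact hw ⟨Ideal.Quotient.mk c r.1, (mk_mem_maximalIdeal_iff r.1).2 r.2⟩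
    · rintro hw ⟨s, hs⟩
      obtain ⟨r, rfl⟩ := Ideal.Quotient.mk_surjective s
      exact hw ⟨r, (mk_mem_maximalIdeal_iff r).1 hs⟩
  obtain ⟨hn, hsur⟩ := h
  constructor
  · obtain ⟨⟨x, hx⟩, hx0⟩ := exists_ne (0 : socle (R := R ⧸ c) W)
    exact nontrivial_of_ne (⟨x, (hmem x).1 hx⟩ : socle (R := R) W') 0
      fun h => hx0 (Subtype.ext (show x = 0 from congrArg Subtype.val h))
  · rintro ⟨x, hx⟩ hx0 ⟨y, hy⟩
    obtain ⟨s, hs⟩ := hsur ⟨x, (hmem x).2 hx⟩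
      (fun h => hx0 (Subtype.ext (show x = 0 from congrArg Subtype.val h))) ⟨y, (hmem y).2 hy⟩
    obtain ⟨r, rfl⟩ := Ideal.Quotient.mk_surjective s
    have hs' : Ideal.Quotient.mk c r • (show W from x) = y := congrArg Subtype.val hs
    exact ⟨r, Subtype.ext hs'⟩

variable [IsNoetherianRing R] {e e' g : ℕ} (he : InjRank R e) (he' : InjRank (R ⧸ c) e')
  (hg : IsCM g (quotMod c)) (hge : g + e' = e)

include he he' hg hge

theorem length_extDual_quotMod :
    Module.length R (Abelian.Ext (quotMod c) (unitMod R) g ⧸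
      (maximalIdeal R • ⊤ : Submodule R (Abelian.Ext (quotMod c) (unitMod R) g))) = 1 := by
  obtain ⟨W, hW⟩ := he'.exists_redn (V := unitMod (R ⧸ c)) (q := 0) (l := e') (by omega)
    (fun i hi => subsingleton_ext_of_projective _ _ hi)
  have h1 := length_socle_restrictScalars (he'.length_socle_eq_one hW)
  have h2 := hW.restrictScalars (Ideal.Quotient.mk c) Ideal.Quotient.mk_surjective
  have e : quotMod c ≅ (ModuleCat.restrictScalars (Ideal.Quotient.mk c)).obj (unitMod (R ⧸ c)) :=
    LinearEquiv.toModuleIso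
      { AddEquiv.refl (R ⧸ c) with
        map_smul' := fun r x => by
          change r • x = Ideal.Quotient.mk c r * x
          rw [Algebra.smul_def]; rfl }
  rw [he.length_ext_quotient (h2.of_iso e) hge (fun i hi => hg.ext_zero i hi.ne'), h1,
    he.length_ext_residue, one_mul]

theorem exists_generator_extDual :
    ∃ w : Abelian.Ext (quotMod c) (unitMod R) g, Submodule.span R {w} = ⊤ := by
  have h := length_extDual_quotMod he he' hg hge
  rw [Module.length_eq_one_iff, isSimpleModule_iff_toSpanSingleton_surjective] at h
  obtain ⟨hn, hsur⟩ := h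
  obtain ⟨x, hx⟩ := exists_ne (0 : Abelian.Ext (quotMod c) (unitMod R) g ⧸
      (maximalIdeal R • ⊤ : Submodule R (Abelian.Ext (quotMod c) (unitMod R) g)))
  obtain ⟨w, rfl⟩ := Submodule.mkQ_surjective _ x
  refine ⟨w, ?_⟩
  have hfin : Module.Finite R (Abelian.Ext (quotMod c) (unitMod R) g) := inferInstance
  refine top_le_iff.1 (Submodule.le_of_le_smul_of_le_jacobson_bot hfin.fg_top
    (IsLocalRing.maximalIdeal_le_jacobson ⊥) fun y _ => ?_)
  obtain ⟨r, hr⟩ := hsur _ hx (Submodule.mkQ _ y)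
  rw [LinearMap.toSpanSingleton_apply, ← map_smul, eq_comm, ← sub_eq_zero, ← map_sub,
    Submodule.mkQ_apply, Submodule.Quotient.mk_eq_zero] at hr
  rw [← add_sub_cancel (r • w) y]
  exact Submodule.add_mem_sup (Submodule.smul_mem _ _ (Submodule.mem_span_singleton_self w)) hr

theorem nonempty_extDual_quotMod (hR : FiniteSelfInj R) :
    Nonempty (quotMod c ≅ extDual g (quotMod c)) := by
  obtain ⟨w, hw⟩ := exists_generator_extDual he he' hg hge
  have hK : Killed c (extDual g (quotMod c)) := killed_quotient.ext (V := quotMod c) _ _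
  have hlow : ∀ i < g, Subsingleton (Abelian.Ext (quotMod c) (unitMod R) i) :=
    fun i hi => hg.ext_zero i hi.ne
  have hcm := isCM_extDual_quotMod hR hg
  let s : quotMod c ⟶ extDual g (quotMod c) := fromQuot hK w
  have hs : Function.Surjective s.hom := by
    intro y
    obtain ⟨r, hr⟩ := Submodule.mem_span_singleton.1 (hw ▸ Submodule.mem_top (x := y))
    exact ⟨Ideal.Quotient.mk c r, hr⟩
  let J : ModuleCat.{u} R := ModuleCat.of R (LinearMap.ker s.hom)
  let ι : J ⟶ quotMod c := ModuleCat.ofHom (LinearMap.ker s.hom).subtype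
  have hι : ι ≫ s = 0 := ModuleCat.hom_ext (LinearMap.ext fun x => x.2)
  have hS : (ShortComplex.mk ι s hι).ShortExact :=
    shortExact_of_linear _ (Submodule.injective_subtype _) (fun x hx => ⟨⟨x, hx⟩, rfl⟩) hs
  have hsurj : ∀ ξ : Abelian.Ext (quotMod c) (unitMod R) g,
      ∃ ζ : Abelian.Ext (extDual g (quotMod c)) (unitMod R) g,
        (Ext.mk₀ s).comp ζ (zero_add g) = ξ := by
    intro ξ
    obtain ⟨r, rfl⟩ := Submodule.mem_span_singleton.1 (hw ▸ Submodule.mem_top (x := ξ))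
    obtain ⟨ζ, hζ⟩ := (extToHom_bijective (Y := unitMod R) hK hlow).2 (r • LinearMap.id)
    refine ⟨ζ, extToHom_injective (V := quotMod c) killed_quotient hlow ?_⟩
    rw [extToHom_comp _ hK, hζ, map_smul]
    refine LinearMap.ext fun x => ?_
    obtain ⟨t, rfl⟩ := Ideal.Quotient.mk_surjective x
    rw [LinearMap.smul_apply, extToHom_apply, fromQuot_mk_self, mk₀_smul_id_comp]
    rfl
  have hJ : ∀ i, Subsingleton (Abelian.Ext J (unitMod R) i) := by
    intro i
    by_cases hi : i = g
    · subst hi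
      refine subsingleton_of_forall_eq 0 fun x => ?_
      have := hcm.ext_zero (i + 1) (by omega)
      obtain ⟨y, hy⟩ := Ext.contravariant_sequence_exact₁ hS (unitMod R) x (add_comm 1 i)
        (Subsingleton.elim (α := Abelian.Ext (extDual i (quotMod c)) (unitMod R) (i + 1)) _ _)
      obtain ⟨ζ, hζ⟩ := hsurj y
      rw [← hy, ← hζ]
      change (Ext.mk₀ ι).comp ((Ext.mk₀ s).comp ζ (zero_add i)) (zero_add i) = 0
      rw [Ext.mk₀_comp_mk₀_assoc, hι, Ext.mk₀_zero, Ext.zero_comp]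
    · by_cases hi' : i + 1 = g
      · exact Killed.subsingleton_ext (c := c)
          (Killed.of_injective killed_quotient ι.hom (Submodule.injective_subtype _))
          hlow i (by omega)
      · exact subsingleton_ext_X₁ hS (hg.ext_zero i hi) (hcm.ext_zero (i + 1) hi')
  have hJG : IsGProj J := ⟨inferInstance, fun i _ => hJ i⟩
  have := hJG.subsingleton hR (hJ 0)
  have hinj : Function.Injective s.hom := LinearMap.ker_eq_bot.1 (Submodule.subsingleton_iff_eq_bot.1 this)
  exact ⟨(LinearEquiv.ofBijective s.hom ⟨hinj, hs⟩).toModuleIso⟩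

end Canonical

end Linkage

namespace Linkage

open Abelian IsLocalRing RingTheory.Sequence

section Lambda

variable {S : Type u} [CommRing S] [IsLocalRing S]
variable {M N : Type u} [AddCommGroup M] [Module S M] [AddCommGroup N] [Module S N]

theorem nontrivial_of_isLambdaOf (h : IsLambdaOf S N M) [Nontrivial M] : Nontrivial N := by
  obtain ⟨n₀, n₁, g, f, hg, hfg, hmin, -, ⟨e⟩⟩ := h
  by_contra hN
  rw [not_nontrivial_iff_subsingleton] at hN
  have hP : Subsingleton (Fin n₀ → S) := by
    refine eq_bot_of_le_maximalIdeal_smul (le_trans (fun x _ => ?_) hmin)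
    exact Subsingleton.elim _ _
  have hM : Subsingleton M := by
    refine e.toEquiv.subsingleton_congr.2 ⟨?_⟩
    rintro ⟨_, φ, rfl⟩ ⟨_, ψ, rfl⟩
    refine Subtype.ext (LinearMap.ext fun x => ?_)
    change φ (f x) = ψ (f x)
    rw [Subsingleton.elim (f x) 0, map_zero, map_zero]
  exact not_subsingleton M hM

theorem not_subsingleton_dual_of_isLambdaOf (h : IsLambdaOf S N M) [Nontrivial M] :
    ¬ Subsingleton (Module.Dual S M) := by
  obtain ⟨n₀, n₁, g, f, -, -, -, -, ⟨e⟩⟩ := h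
  intro hD
  refine not_subsingleton M (subsingleton_of_forall_eq 0 fun x => e.injective ?_)
  rw [map_zero]
  refine Subtype.ext (LinearMap.ext fun v => ?_)
  exact LinearMap.congr_fun (Subsingleton.elim
    ((Module.Dual.eval S _ v).comp ((Submodule.subtype _).comp e.toLinearMap)) 0) x

theorem isGProj_of_isLambdaOf [IsNoetherianRing S] (hS : FiniteSelfInj S) (h : IsLambdaOf S M N)
    (hM : IsGProj (ModuleCat.of S M)) : IsGProj (ModuleCat.of S N) := by
  obtain ⟨n₀, n₁, g, f, hg, hfg, -, -, ⟨e⟩⟩ := h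
  let T : ShortComplex (ModuleCat.{u} S) := ShortComplex.mk
    (ModuleCat.ofHom (LinearMap.ker g).subtype) (ModuleCat.ofHom g)
    (ModuleCat.hom_ext (LinearMap.ext fun x => x.2))
  have hT : T.ShortExact :=
    shortExact_of_linear T (Submodule.injective_subtype _) (fun x hx => ⟨⟨x, hx⟩, rfl⟩) hg
  have : Projective T.X₂ :=
    (IsProjective.iff_projective (R := S) (Fin n₀ → S)).1 inferInstance
  have : Module.Finite S T.X₂ := inferInstanceAs (Module.Finite S (Fin n₀ → S))
  have hK : IsGProj T.X₁ := IsGProj.syzygy hT hM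
  have hD := dualComplex_shortExact hT (hM.ext_zero 1 one_pos)
  obtain ⟨e'⟩ := nonempty_linearEquiv_of_ker (C := Module.Dual S (LinearMap.ker g))
    (D := LinearMap.range f.dualMap) (LinearMap.ker g).subtype.dualMap f.dualMap.rangeRestrict
    (LinearEquiv.refl S (Module.Dual S (Fin n₀ → S)))
    (surjective_of_shortExact hD) (LinearMap.surjective_rangeRestrict _) fun φ => by
      constructor
      · intro hφ
        refine Subtype.ext (LinearMap.ext fun x => ?_)
        exact LinearMap.congr_fun hφ (⟨f x, hfg ▸ ⟨x, rfl⟩⟩ : LinearMap.ker g)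
      · intro hφ
        refine LinearMap.ext fun ⟨x, hx⟩ => ?_
        obtain ⟨y, rfl⟩ := hfg.symm ▸ hx
        exact LinearMap.congr_fun (congrArg Subtype.val hφ) y
  exact (hK.dual hS).of_iso (e'.trans e.symm).toModuleIso

end Lambda

section Dual

variable {R : Type u} [CommRing R] [IsLocalRing R] [IsNoetherianRing R]
variable {c : Ideal R} [IsLocalRing (R ⧸ c)]
variable {e e' g : ℕ} (he : InjRank R e) (he' : InjRank (R ⧸ c) e')
  (hg : IsCM g (quotMod c)) (hge : g + e' = e) (hR : FiniteSelfInj R)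
  (M : Type u) [AddCommGroup M] [Module R M] [Module (R ⧸ c) M] [IsScalarTower R (R ⧸ c) M]

omit [IsLocalRing R] [IsNoetherianRing R] [IsLocalRing (R ⧸ c)] in
theorem killed_of_isScalarTower : Killed c M := by
  intro r hr v
  rw [← algebraMap_smul (R ⧸ c) r v, Ideal.Quotient.algebraMap_eq,
    Ideal.Quotient.eq_zero_iff_mem.2 hr, zero_smul]

include he he' hg hge hR in
theorem nonempty_extDual_dual [Module.Finite R M] :
    Nonempty (Abelian.Ext (ModuleCat.of R M) (unitMod R) g ≃ₗ[R] Module.Dual (R ⧸ c) M) := by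
  obtain ⟨i⟩ := nonempty_extDual_quotMod he he' hg hge hR
  exact ⟨(LinearEquiv.ofBijective _ (extToHom_bijective (V := ModuleCat.of R M)
    (killed_of_isScalarTower M) (fun i hi => hg.ext_zero i hi.ne))).trans
      ((LinearEquiv.congrRight i.toLinearEquiv.symm).trans
        (LinearMap.extendScalarsOfSurjectiveEquiv (Ideal.Quotient.mk_surjective)))⟩

variable {M} in
include he he' hg hge hR in
/-- A link by a perfect Gorenstein ideal gives a short exact sequence
`0 → Ext^g(M, R) → F → N → 0` with `F` a finite direct sum of copies of `R ⧸ c`. -/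
theorem exists_shortExact_of_isLambdaOf [Module.Finite R M] {N : Type u} [AddCommGroup N]
    [Module R N] [Module (R ⧸ c) N] [IsScalarTower R (R ⧸ c) N] (h : IsLambdaOf (R ⧸ c) M N) :
    ∃ (q : ℕ) (ι : extDual g (ModuleCat.of R M) ⟶ ModuleCat.of R (Fin q → quotMod c))
      (π : ModuleCat.of R (Fin q → quotMod c) ⟶ ModuleCat.of R N) (w : ι ≫ π = 0),
      (ShortComplex.mk ι π w).ShortExact := by
  obtain ⟨n₀, n₁, p, f, hp, hpf, -, -, ⟨i⟩⟩ := h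
  obtain ⟨j⟩ := nonempty_extDual_dual he he' hg hge hR M
  let F : (Fin n₀ → R ⧸ c) ≃ₗ[R] Module.Dual (R ⧸ c) (Fin n₀ → R ⧸ c) :=
    ((Pi.basisFun (R ⧸ c) (Fin n₀)).constr (R ⧸ c)).restrictScalars R
  let ι : Abelian.Ext (ModuleCat.of R M) (unitMod R) g →ₗ[R] (Fin n₀ → R ⧸ c) :=
    F.symm.toLinearMap.comp ((p.dualMap.restrictScalars R).comp j.toLinearMap)
  let π : (Fin n₀ → R ⧸ c) →ₗ[R] N :=
    (i.symm.toLinearMap.restrictScalars R).comp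
      ((f.dualMap.rangeRestrict.restrictScalars R).comp F.toLinearMap)
  have hπ : ∀ x, π x = 0 ↔ (F x).comp f = 0 := by
    intro x
    change i.symm (f.dualMap.rangeRestrict (F x)) = 0 ↔ _
    rw [LinearEquiv.map_eq_zero_iff]
    exact ⟨fun h => congrArg Subtype.val h, fun h => Subtype.ext h⟩
  have hFι : ∀ ξ, F (ι ξ) = (j ξ).comp p := fun ξ => F.apply_symm_apply _
  refine ⟨n₀, ModuleCat.ofHom ι, ModuleCat.ofHom π, ModuleCat.hom_ext (LinearMap.ext fun ξ => ?_),
    shortExact_of_linear _ ?_ ?_ ?_⟩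
  · refine (hπ _).2 ?_
    change (F (ι ξ)).comp f = 0
    rw [hFι]
    refine LinearMap.ext fun x => ?_
    have : p (f x) = 0 := LinearMap.mem_ker.1 (hpf ▸ ⟨x, rfl⟩)
    change (j ξ) (p (f x)) = 0
    rw [this, map_zero]
  · exact F.symm.injective.comp
      ((LinearMap.dualMap_injective_of_surjective hp).comp j.injective)
  · intro x hx
    have hx := (hπ x).1 hx
    have hker : LinearMap.ker p ≤ LinearMap.ker (F x) := by
      rw [← hpf]
      rintro _ ⟨y, rfl⟩
      exact LinearMap.congr_fun hx y
    obtain ⟨φ, hφ⟩ : ∃ φ : Module.Dual (R ⧸ c) M, φ.comp p = F x :=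
      ⟨((LinearMap.ker p).liftQ (F x) hker).comp
        (p.quotKerEquivOfSurjective hp).symm.toLinearMap, LinearMap.ext fun y => by
          change (LinearMap.ker p).liftQ (F x) hker
            ((p.quotKerEquivOfSurjective hp).symm (p y)) = F x y
          have : (p.quotKerEquivOfSurjective hp).symm (p y) = Submodule.Quotient.mk y :=
            (LinearEquiv.symm_apply_eq _).2 rfl
          rw [this]; rfl⟩
    refine ⟨j.symm φ, F.injective ?_⟩
    change F (ι (j.symm φ)) = F x
    rw [hFι, LinearEquiv.apply_symm_apply, hφ]
  · exact i.symm.surjective.comp ((LinearMap.surjective_rangeRestrict _).comp F.surjective)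

end Dual

end Linkage

namespace Linkage

open Abelian IsLocalRing RingTheory.Sequence

section Link

variable {R : Type u} [CommRing R]

/-- There is a short exact sequence `0 → Ext^n(X, R) → F → Y → 0` in which `F` is orthogonal to
all modules of G-dimension zero. -/
def DualSeq (n : ℕ) (X Y : ModuleCat.{u} R) : Prop :=
  ∃ (F : ModuleCat.{u} R) (ι : extDual n X ⟶ F) (π : F ⟶ Y) (w : ι ≫ π = 0),
    IsOrth F ∧ (ShortComplex.mk ι π w).ShortExact

theorem DualSeq.nonempty_ext {n : ℕ} {X Y : ModuleCat.{u} R} (h : DualSeq n X Y)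
    {U : ModuleCat.{u} R} (hU : IsGProj U) (j : ℕ) (hj : 0 < j) :
    Nonempty (Abelian.Ext U Y j ≃ₗ[R] Abelian.Ext U (extDual n X) (j + 1)) := by
  obtain ⟨F, ι, π, w, hF, hS⟩ := h
  exact ⟨extShiftRight hS U j (hF U hU j hj) (hF U hU _ (Nat.succ_pos j))⟩

variable [IsLocalRing R]

theorem link_of_isCM (hR : IsGorensteinLocalRing R) {c : Ideal R} [IsLocalRing (R ⧸ c)]
    (hc₁ : IsGorensteinLocalRing (R ⧸ c)) (hc₂ : IsPerfectIdeal R c)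
    {M N : Type u} [AddCommGroup M] [Module R M] [Module (R ⧸ c) M] [IsScalarTower R (R ⧸ c) M]
    [AddCommGroup N] [Module R N] [Module (R ⧸ c) N] [IsScalarTower R (R ⧸ c) N]
    [Module.Finite R M] [Module.Finite R N] (hL : LinkedBy R c M N) [Nontrivial M] {n : ℕ}
    (hM : IsCM n (ModuleCat.of R M)) :
    Nontrivial N ∧ IsCM n (ModuleCat.of R N) ∧
      DualSeq n (ModuleCat.of R M) (ModuleCat.of R N) ∧
      DualSeq n (ModuleCat.of R N) (ModuleCat.of R M) := by
  have := hR.2.1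
  have := hc₁.2.1
  have hRi := finiteSelfInj_of_gorenstein hR
  have hci := finiteSelfInj_of_gorenstein hc₁
  obtain ⟨e, he⟩ := exists_injRank hRi
  obtain ⟨e', he'⟩ := exists_injRank hci
  obtain ⟨g, hg, hO, hne⟩ := exists_grade_of_isPerfectIdeal hRi hc₂
  have hge := injRank_quotient he he' hg hne
  obtain ⟨φ⟩ := nonempty_extDual_dual he he' hg hge hRi M
  obtain rfl : g = n := by
    by_contra hgn
    have := hM.ext_zero g hgn
    exact not_subsingleton_dual_of_isLambdaOf hL.1 φ.symm.toEquiv.subsingleton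
  have hN := nontrivial_of_isLambdaOf hL.1
  refine ⟨hN, isCM_of_isGProj N he he' hge hg
    (isGProj_of_isLambdaOf hci hL.2 (isGProj_of_isCM M he he' hge hM)), ?_, ?_⟩
  · obtain ⟨q, ι, π, w, h⟩ := exists_shortExact_of_isLambdaOf he he' hg hge hRi hL.2
    exact ⟨_, ι, π, w, isOrth_fin _ hO q, h⟩
  · obtain ⟨q, ι, π, w, h⟩ := exists_shortExact_of_isLambdaOf he he' hg hge hRi hL.1
    exact ⟨_, ι, π, w, isOrth_fin _ hO q, h⟩

end Link

end Linkage

namespace Linkage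

open Abelian IsLocalRing RingTheory.Sequence

section Numbers

variable {R : Type u} [CommRing R] [IsLocalRing R] [IsNoetherianRing R]

/-- The residue field as an object of the category of modules. -/
abbrev resMod (R : Type u) [CommRing R] [IsLocalRing R] : ModuleCat.{u} R :=
  ModuleCat.of R (ResidueField R)

variable {e : ℕ} (he : InjRank R e)

include he

theorem nonempty_ext_residue {n p q p' q' : ℕ} {M N Z X Z' X' : ModuleCat.{u} R}
    (hM : IsCM n M) (hMN : DualSeq n M N) (hZ : IsGProj Z) (hMX : Syz (n + q) M X)
    (hZX : Syz p Z X) (hZ' : IsGProj Z') (hkX : Syz (e + q') (resMod R) X')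
    (hZX' : Syz p' Z' X') {a b : ℕ} (ha : q' < a) (hb : q < b + 1) (hb0 : 0 < b)
    (h : a + p' + q = b + 1 + p + q') :
    Nonempty (Abelian.Ext Z (resMod R) a ≃ₗ[R] Abelian.Ext Z' N b) := by
  obtain ⟨i⟩ := he.nonempty_extDual_residue
  obtain ⟨f⟩ := nonempty_ext_swap hM hZ hMX hZX he.isCM_residue hZ' hkX hZX'
    (j := b + 1 - q) (j' := a - q') (by omega) (by omega) (by omega)
  obtain ⟨f'⟩ := hMN.nonempty_ext hZ' b hb0
  exact ⟨(extIsoRight Z i.symm a).trans ((extCast _ _ (by omega)).trans (f.trans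
    ((extCast _ _ (by omega)).trans f'.symm)))⟩

theorem exists_syz_residue : ∃ Y : ModuleCat.{u} R, Syz e (resMod R) Y ∧ IsGProj Y := by
  obtain ⟨Y, hY, -⟩ := exists_syz e (resMod R)
  exact ⟨Y, hY, hY.isGProj_of_vanishing fun i hi => he.isCM_residue.ext_zero i hi.ne'⟩

omit [IsLocalRing R] he in
theorem IsCM.exists_syz {n : ℕ} {M : ModuleCat.{u} R} (hM : IsCM n M) :
    ∃ Y : ModuleCat.{u} R, Syz n M Y ∧ IsGProj Y := by
  have := hM.finite
  obtain ⟨Y, hY, -⟩ := Linkage.exists_syz n M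
  exact ⟨Y, hY, hY.isGProj_of_vanishing fun i hi => hM.ext_zero i hi.ne'⟩

theorem nonempty_tate_betti_bass {n m : ℕ} (hnm : n + m = e) {M N : ModuleCat.{u} R}
    (hM : IsCM n M) (hMN : DualSeq n M N) (CM : CompleteResolution R M)
    (Ck : CompleteResolution R (resMod R)) (i : ℤ) :
    Nonempty (TateExt R CM (resMod R) i ≃ₗ[R] TateExt R Ck N (m + i - 1)) := by
  obtain ⟨s₀, hs⟩ := exists_tate CM
  obtain ⟨t₀, ht⟩ := exists_tate Ck
  obtain ⟨Z, X, hZ, hZX, hMX, hT⟩ := hs (n + s₀) (by omega) (i.natAbs + t₀ + 1)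
  obtain ⟨Z', X', hZ', hZX', hkX, hT'⟩ := ht (e + t₀) (by omega) (i.natAbs + s₀ + 2)
  obtain ⟨a, ha⟩ : ∃ a : ℕ, i + (i.natAbs + t₀ + 1 : ℕ) = a + 1 :=
    ⟨(i + (i.natAbs + t₀ + 1 : ℕ) - 1).toNat, by omega⟩
  obtain ⟨b, hb⟩ : ∃ b : ℕ, m + i - 1 + (i.natAbs + s₀ + 2 : ℕ) = b + 1 :=
    ⟨(m + i - 1 + (i.natAbs + s₀ + 2 : ℕ) - 1).toNat, by omega⟩
  obtain ⟨f⟩ := hT (resMod R) i a ha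
  obtain ⟨f'⟩ := hT' N _ b hb
  obtain ⟨f''⟩ := nonempty_ext_residue he hM hMN hZ hMX hZX hZ' hkX hZX' (a := a + 1)
    (b := b + 1) (by omega) (by omega) (by omega) (by omega)
  exact ⟨f.trans (f''.trans f'.symm)⟩

theorem nonempty_betti_bass {n m : ℕ} (hnm : n + m = e) {M N : ModuleCat.{u} R}
    (hM : IsCM n M) (hMN : DualSeq n M N) (i : ℕ) (hi : n + 1 < i) :
    Nonempty (Abelian.Ext M (resMod R) i ≃ₗ[R] Abelian.Ext (resMod R) N (m + i - 1)) := by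
  obtain ⟨Z, hMZ, hZ⟩ := hM.exists_syz
  obtain ⟨Z', hkZ', hZ'⟩ := exists_syz_residue he
  obtain ⟨f⟩ := hMZ.nonempty_ext (resMod R) (i - n) (by omega)
  obtain ⟨f'⟩ := hkZ'.nonempty_ext N (i - n - 1) (by omega)
  obtain ⟨f''⟩ := nonempty_ext_residue he hM hMN (q := 0) hZ hMZ (Syz.refl Z) hZ' (q' := 0) hkZ'
    (Syz.refl Z') (a := i - n) (b := i - n - 1) (by omega) (by omega) (by omega) (by omega)
  exact ⟨(extCast _ _ (by omega)).trans (f.symm.trans (f''.trans (f'.trans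
    (extCast _ _ (by omega)))))⟩

theorem nonempty_tate_betti (hR : FiniteSelfInj R) {n : ℕ} {M N L : ModuleCat.{u} R}
    (hM : IsCM n M) (hL : IsCM n L) (hMN : DualSeq n M N) (hLN : DualSeq n L N)
    (CM : CompleteResolution R M) (CL : CompleteResolution R L) (i : ℤ) :
    Nonempty (TateExt R CM (resMod R) i ≃ₗ[R] TateExt R CL (resMod R) i) := by
  obtain ⟨s₀, hs⟩ := exists_tate CM
  obtain ⟨t₀, ht⟩ := exists_tate CL
  obtain ⟨Z, X, hZ, hZX, hMX, hT⟩ := hs (n + (s₀ + t₀)) (by omega) (i.natAbs + 1)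
  obtain ⟨Z', X', hZ', hZX', hLX, hT'⟩ := ht (n + (s₀ + t₀)) (by omega) (i.natAbs + 1)
  obtain ⟨Y, hkY, hY⟩ := exists_syz_residue he
  obtain ⟨U, hU, hUY⟩ := hY.exists_cosyz hR (i.natAbs + 1 + (n + (s₀ + t₀)) + 1)
  obtain ⟨a, ha⟩ : ∃ a : ℕ, i + (i.natAbs + 1 : ℕ) = a + 1 :=
    ⟨(i + (i.natAbs + 1 : ℕ) - 1).toNat, by omega⟩
  obtain ⟨f⟩ := hT (resMod R) i a ha
  obtain ⟨f'⟩ := hT' (resMod R) i a ha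
  obtain ⟨h⟩ := nonempty_ext_residue he hM hMN hZ hMX hZX hU (q' := 0) hkY hUY (a := a + 1)
    (b := a + 1 + (s₀ + t₀)) (by omega) (by omega) (by omega) (by omega)
  obtain ⟨h'⟩ := nonempty_ext_residue he hL hLN hZ' hLX hZX' hU (q' := 0) hkY hUY (a := a + 1)
    (b := a + 1 + (s₀ + t₀)) (by omega) (by omega) (by omega) (by omega)
  exact ⟨f.trans (h.trans (h'.symm.trans f'.symm))⟩

theorem nonempty_betti (hR : FiniteSelfInj R) {n : ℕ} {M N L : ModuleCat.{u} R}
    (hM : IsCM n M) (hL : IsCM n L) (hMN : DualSeq n M N) (hLN : DualSeq n L N) (i : ℕ)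
    (hi : n < i) :
    Nonempty (Abelian.Ext M (resMod R) i ≃ₗ[R] Abelian.Ext L (resMod R) i) := by
  obtain ⟨Z, hMZ, hZ⟩ := hM.exists_syz
  obtain ⟨Z', hLZ', hZ'⟩ := hL.exists_syz
  obtain ⟨Y, hkY, hY⟩ := exists_syz_residue he
  obtain ⟨U, hU, hUY⟩ := hY.exists_cosyz hR 1
  obtain ⟨f⟩ := hMZ.nonempty_ext (resMod R) (i - n) (by omega)
  obtain ⟨f'⟩ := hLZ'.nonempty_ext (resMod R) (i - n) (by omega)
  obtain ⟨h⟩ := nonempty_ext_residue he hM hMN (q := 0) hZ hMZ (Syz.refl Z) hU (q' := 0) hkY hUY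
    (a := i - n) (b := i - n) (by omega) (by omega) (by omega) (by omega)
  obtain ⟨h'⟩ := nonempty_ext_residue he hL hLN (q := 0) hZ' hLZ' (Syz.refl Z') hU (q' := 0) hkY
    hUY (a := i - n) (b := i - n) (by omega) (by omega) (by omega) (by omega)
  exact ⟨(extCast _ _ (by omega)).trans (f.symm.trans (h.trans (h'.symm.trans (f'.trans
    (extCast _ _ (by omega))))))⟩

omit [IsLocalRing R] [IsNoetherianRing R] he in
theorem nonempty_tate_bass {n : ℕ} {K M N L : ModuleCat.{u} R} (hNM : DualSeq n N M)
    (hNL : DualSeq n N L) (C : CompleteResolution R K) (i : ℤ) :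
    Nonempty (TateExt R C M i ≃ₗ[R] TateExt R C L i) := by
  obtain ⟨s₀, hs⟩ := exists_tate C
  obtain ⟨Z, X, hZ, hZX, hMX, hT⟩ := hs s₀ le_rfl (i.natAbs + 1)
  obtain ⟨a, ha⟩ : ∃ a : ℕ, i + (i.natAbs + 1 : ℕ) = a + 1 :=
    ⟨(i + (i.natAbs + 1 : ℕ) - 1).toNat, by omega⟩
  obtain ⟨f⟩ := hT M i a ha
  obtain ⟨f'⟩ := hT L i a ha
  obtain ⟨h⟩ := hNM.nonempty_ext hZ (a + 1) a.succ_pos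
  obtain ⟨h'⟩ := hNL.nonempty_ext hZ (a + 1) a.succ_pos
  exact ⟨f.trans (h.trans (h'.symm.trans f'.symm))⟩

theorem nonempty_bass {n : ℕ} {M N L : ModuleCat.{u} R} (hNM : DualSeq n N M)
    (hNL : DualSeq n N L) (i : ℕ) (hi : e < i) :
    Nonempty (Abelian.Ext (resMod R) M i ≃ₗ[R] Abelian.Ext (resMod R) L i) := by
  obtain ⟨Y, hkY, hY⟩ := exists_syz_residue he
  obtain ⟨f⟩ := hkY.nonempty_ext M (i - e) (by omega)
  obtain ⟨f'⟩ := hkY.nonempty_ext L (i - e) (by omega)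
  obtain ⟨h⟩ := hNM.nonempty_ext hY (i - e) (by omega)
  obtain ⟨h'⟩ := hNL.nonempty_ext hY (i - e) (by omega)
  exact ⟨(extCast _ _ (by omega)).trans (f.symm.trans (h.trans (h'.symm.trans (f'.trans
    (extCast _ _ (by omega))))))⟩

end Numbers

end Linkage

/-- Let `R` be a Gorenstein local ring of dimension `d`, `a`, `b` perfect Gorenstein
ideals, `M ∈ CM^n(R)` with `M ∼_a N`, and `m = depth_R M`. Then:
(i) `β̂_i(M) = μ̂^{m+i-1}(N)` for all `i ∈ ℤ`; in particular `β_i(M) = μ^{m+i-1}(N)` for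
all `i > n+1`. (ii) If moreover `M ∼_a N ∼_b L` (`M` evenly linked to `L`), then
`β̂_i(M) = β̂_i(L)` and `μ̂^i(M) = μ̂^i(L)` for all `i ∈ ℤ`; in particular
`β_i(M) = β_i(L)` for `i > n` and `μ^i(M) = μ^i(L)` for `i > d`. (Equalities of stable
Betti/Bass numbers are expressed as isomorphisms of the corresponding Tate cohomology
modules with residue-field coefficients, and equalities of ordinary Betti/Bass numbers as
isomorphisms of the corresponding `Ext` modules.) -/
theorem stmt_18 (R : Type) [CommRing R] [IsLocalRing R] (hR : IsGorensteinLocalRing R)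
    (d : ℕ) (hd : ringKrullDim R = d)
    (a b : Ideal R) [IsLocalRing (R ⧸ a)] [IsLocalRing (R ⧸ b)]
    (ha₁ : IsGorensteinLocalRing (R ⧸ a)) (ha₂ : IsPerfectIdeal R a)
    (hb₁ : IsGorensteinLocalRing (R ⧸ b)) (hb₂ : IsPerfectIdeal R b)
    (M N L : Type) [AddCommGroup M] [Module R M] [Module.Finite R M]
    [Module (R ⧸ a) M] [IsScalarTower R (R ⧸ a) M]
    [AddCommGroup N] [Module R N] [Module.Finite R N]
    [Module (R ⧸ a) N] [IsScalarTower R (R ⧸ a) N]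
    [Module (R ⧸ b) N] [IsScalarTower R (R ⧸ b) N]
    [AddCommGroup L] [Module R L] [Module.Finite R L]
    [Module (R ⧸ b) L] [IsScalarTower R (R ⧸ b) L]
    (n : ℕ) (hMperf : IsGPerfect R (ModuleCat.of R M))
    (hMdim : gdim R (ModuleCat.of R M) = (n : ℕ∞))
    (hMN : LinkedBy R a M N)
    (m : ℕ) (hm : moduleDepth R M = (m : ℕ∞)) :
    ((∀ (CM : CompleteResolution R (ModuleCat.of R M))
        (Ck : CompleteResolution R (ModuleCat.of R (IsLocalRing.ResidueField R))) (i : ℤ),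
        Nonempty ((TateExt R CM (ModuleCat.of R (IsLocalRing.ResidueField R)) i) ≃ₗ[R]
          (TateExt R Ck (ModuleCat.of R N) ((m : ℤ) + i - 1)))) ∧
      (∀ i : ℕ, n + 1 < i →
        Nonempty ((ExtMod R i (ModuleCat.of R M)
            (ModuleCat.of R (IsLocalRing.ResidueField R))) ≃ₗ[R]
          (ExtMod R (m + i - 1) (ModuleCat.of R (IsLocalRing.ResidueField R))
            (ModuleCat.of R N))))) ∧
    (LinkedBy R b N L →
      ((∀ (CM : CompleteResolution R (ModuleCat.of R M))
          (CL : CompleteResolution R (ModuleCat.of R L)) (i : ℤ),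
          Nonempty ((TateExt R CM (ModuleCat.of R (IsLocalRing.ResidueField R)) i) ≃ₗ[R]
            (TateExt R CL (ModuleCat.of R (IsLocalRing.ResidueField R)) i))) ∧
        (∀ (Ck : CompleteResolution R (ModuleCat.of R (IsLocalRing.ResidueField R)))
          (i : ℤ),
          Nonempty ((TateExt R Ck (ModuleCat.of R M) i) ≃ₗ[R]
            (TateExt R Ck (ModuleCat.of R L) i))) ∧
        (∀ i : ℕ, n < i →
          Nonempty ((ExtMod R i (ModuleCat.of R M)
              (ModuleCat.of R (IsLocalRing.ResidueField R))) ≃ₗ[R]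
            (ExtMod R i (ModuleCat.of R L)
              (ModuleCat.of R (IsLocalRing.ResidueField R))))) ∧
        (∀ i : ℕ, d < i →
          Nonempty ((ExtMod R i (ModuleCat.of R (IsLocalRing.ResidueField R))
              (ModuleCat.of R M)) ≃ₗ[R]
            (ExtMod R i (ModuleCat.of R (IsLocalRing.ResidueField R))
              (ModuleCat.of R L)))))) := by
  have := hR.2.1
  have hRi := Linkage.finiteSelfInj_of_gorenstein hR
  obtain ⟨e, he⟩ := Linkage.exists_injRank hRi
  have hgrade := hMperf.trans hMdim
  have hM := Linkage.isCM_of_isGPerfect hMperf hMdim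
  have hne := Linkage.not_subsingleton_ext_gradeM hgrade
  have hMnt : Nontrivial M := by
    by_contra h
    rw [not_nontrivial_iff_subsingleton] at h
    exact hne (Linkage.subsingleton_ext_of_isZero
      (ModuleCat.isZero_of_subsingleton (ModuleCat.of R M)) _ _)
  obtain ⟨hN, hNcm, hMNs, hNMs⟩ := Linkage.link_of_isCM hR ha₁ ha₂ hMN hM
  obtain ⟨hnle, hdepth⟩ := he.moduleDepth_eq hM hne
  have hnm : n + m = e := by
    have := Nat.cast_injective (hm.symm.trans hdepth)
    omega
  refine ⟨⟨fun CM Ck i => Linkage.nonempty_tate_betti_bass he hnm hM hMNs CM Ck i,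
    fun i hi => ?_⟩, fun hNL => ?_⟩
  · obtain ⟨f⟩ := Linkage.nonempty_betti_bass he hnm hM hMNs i hi
    obtain ⟨f₁⟩ := Linkage.nonempty_extMod (ModuleCat.of R M) (Linkage.resMod R) i
    obtain ⟨f₂⟩ := Linkage.nonempty_extMod (Linkage.resMod R) (ModuleCat.of R N) (m + i - 1)
    exact ⟨f₁.trans (f.trans f₂.symm)⟩
  obtain ⟨-, hLcm, hNLs, hLNs⟩ := Linkage.link_of_isCM hR hb₁ hb₂ hNL hNcm
  refine ⟨fun CM CL i => Linkage.nonempty_tate_betti he hRi hM hLcm hMNs hLNs CM CL i,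
    fun Ck i => Linkage.nonempty_tate_bass hNMs hNLs Ck i, fun i hi => ?_, fun i hi => ?_⟩
  · obtain ⟨f⟩ := Linkage.nonempty_betti he hRi hM hLcm hMNs hLNs i hi
    obtain ⟨f₁⟩ := Linkage.nonempty_extMod (ModuleCat.of R M) (Linkage.resMod R) i
    obtain ⟨f₂⟩ := Linkage.nonempty_extMod (ModuleCat.of R L) (Linkage.resMod R) i
    exact ⟨f₁.trans (f.trans f₂.symm)⟩
  · obtain ⟨f⟩ := Linkage.nonempty_bass he hNMs hNLs i ((he.le_dim hd).trans_lt hi)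
    obtain ⟨f₁⟩ := Linkage.nonempty_extMod (Linkage.resMod R) (ModuleCat.of R M) i
    obtain ⟨f₂⟩ := Linkage.nonempty_extMod (Linkage.resMod R) (ModuleCat.of R L) i
    exact ⟨f₁.trans (f.trans f₂.symm)⟩

end
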